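/- arXiv:0806.0097 — 2 statements merged into one kernel-verified Lean document; each statement's English description precedes it below -/
import Mathlib

section
/- Let Ω ⊆ ℂ be a Denjoy domain with Ω ∩ ℝ = (−∞, 0) ∪ ⋃_{n=1}^∞ (a_n, b_n), where 0 < a_n < b_n ≤ a_{n+1} for every n ≥ 1 and lim_{n→∞} a_n = ∞. If lim_{n→∞} (b_n − a_n)/a_n = 0, then the metric space (Ω, k_Ω) with the quasihyperbolic metric is not Gromov hyperbolic. -/
open Set Metric Filter Complex

noncomputable section

/-- The length of a curve `γ : [0,1] → E` with respect to the conformal density `ρ`. -/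
def curveLen {E : Type*} [NormedAddCommGroup E] [NormedSpace ℝ E]
    (ρ : E → ℝ) (γ : ℝ → E) : ℝ :=
  ∫ t in (0:ℝ)..1, ρ (γ t) * ‖deriv γ t‖

/-- The distance induced on the set `S` by the conformal density `ρ`, defined as the infimum
of the `ρ`-lengths of C¹ curves joining the two points inside `S`. -/
def densityDist {E : Type*} [NormedAddCommGroup E] [NormedSpace ℝ E]
    (S : Set E) (ρ : E → ℝ) (z w : E) : ℝ :=
  sInf { L | ∃ γ : ℝ → E, ContDiffOn ℝ 1 γ (Icc 0 1) ∧ γ 0 = z ∧ γ 1 = w ∧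
      (∀ t ∈ Icc (0:ℝ) 1, γ t ∈ S) ∧ L = curveLen ρ γ }

/-- The quasihyperbolic density `1/δ_Ω(z)` of a domain `Ω`. -/
def qhDensity {E : Type*} [NormedAddCommGroup E] [NormedSpace ℝ E] (Ω : Set E) : E → ℝ :=
  fun z => (Metric.infDist z Ωᶜ)⁻¹

/-- The quasihyperbolic distance of a domain `Ω`. -/
def qhDist {E : Type*} [NormedAddCommGroup E] [NormedSpace ℝ E] (Ω : Set E) : E → E → ℝ :=
  densityDist Ω (qhDensity Ω)

/-- `lam` is the density of the Poincaré (hyperbolic) metric of the plane domain `Ω`: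
it is the pushforward of the density `2/(1-|z|²)` of the unit disk under a holomorphic
universal covering map `p : 𝔻 → Ω`. -/
def IsPoincareDensity (Ω : Set ℂ) (lam : ℂ → ℝ) : Prop :=
  ∃ p : ℂ → ℂ,
    (∀ z ∈ ball (0:ℂ) 1, DifferentiableAt ℂ p z) ∧
    p '' ball (0:ℂ) 1 = Ω ∧
    IsCoveringMapOn (fun z : ball (0:ℂ) 1 => p z) Ω ∧
    ∀ z ∈ ball (0:ℂ) 1, lam (p z) * ‖deriv p z‖ = 2 / (1 - ‖z‖ ^ 2)

/-- `g` is a geodesic in `(S, d)` from `x` to `y`, parametrized by arclength on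
`[0, d x y]`. -/
def IsGeodesicIn {α : Type*} (S : Set α) (d : α → α → ℝ) (g : ℝ → α) (x y : α) : Prop :=
  g 0 = x ∧ g (d x y) = y ∧ (∀ t ∈ Icc (0:ℝ) (d x y), g t ∈ S) ∧
  ∀ s ∈ Icc (0:ℝ) (d x y), ∀ t ∈ Icc (0:ℝ) (d x y), d (g s) (g t) = |s - t|

/-- Every geodesic triangle of `(S, d)` is `δ`-thin (Rips condition). -/
def GromovHyperbolicWith {α : Type*} (S : Set α) (d : α → α → ℝ) (δ : ℝ) : Prop :=
  ∀ x ∈ S, ∀ y ∈ S, ∀ z ∈ S, ∀ gxy gxz gzy : ℝ → α,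
    IsGeodesicIn S d gxy x y → IsGeodesicIn S d gxz x z → IsGeodesicIn S d gzy z y →
    ∀ t ∈ Icc (0:ℝ) (d x y),
      ∃ p ∈ gxz '' Icc (0:ℝ) (d x z) ∪ gzy '' Icc (0:ℝ) (d z y), d (gxy t) p ≤ δ

/-- `(S, d)` is Gromov hyperbolic: some `δ ≥ 0` works for all geodesic triangles. -/
def IsGromovHyperbolic {α : Type*} (S : Set α) (d : α → α → ℝ) : Prop :=
  ∃ δ : ℝ, 0 ≤ δ ∧ GromovHyperbolicWith S d δ

/-- The real axis inside `ℂ`. -/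
def realLine : Set ℂ := {z : ℂ | z.im = 0}

/-- A Denjoy domain: a domain whose boundary is contained in the real axis. -/
def IsDenjoyDomain (Ω : Set ℂ) : Prop :=
  IsOpen Ω ∧ IsConnected Ω ∧ frontier Ω ⊆ realLine

/-- The distance (for the distance function `d`) from a point to a set. -/
def distToSet {α : Type*} (d : α → α → ℝ) (z : α) (A : Set α) : ℝ :=
  sInf (d z '' A)

/-- A fundamental geodesic: a geodesic of `(S, d)` contained in the closed upper half plane,
joining a point of the boundary interval `I` (on the real axis) to a point of the boundary
interval `J`. -/
def IsFundGeodesic (S : Set ℂ) (d : ℂ → ℂ → ℝ) (I J : Set ℝ) (g : ℝ → ℂ) (x y : ℂ) : Prop :=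
  IsGeodesicIn S d g x y ∧ x.im = 0 ∧ x.re ∈ I ∧ y.im = 0 ∧ y.re ∈ J ∧
  ∀ t ∈ Icc (0:ℝ) (d x y), 0 ≤ (g t).im

end

section Curves

variable {E : Type*} [NormedAddCommGroup E] [NormedSpace ℝ E]

/-- `γ` restricts to a `C¹` curve in `S`, parametrized by `[0,1]`, from `z` to `w`. -/
structure IsC1Curve (S : Set E) (γ : ℝ → E) (z w : E) : Prop where
  contDiffOn : ContDiffOn ℝ 1 γ (Icc 0 1)
  source : γ 0 = z
  target : γ 1 = w
  mem : ∀ t ∈ Icc (0:ℝ) 1, γ t ∈ S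

variable {S : Set E} {ρ : E → ℝ} {γ : ℝ → E} {z w y : E}

theorem IsC1Curve.continuousOn (h : IsC1Curve S γ z w) : ContinuousOn γ (Icc 0 1) :=
  h.contDiffOn.continuousOn

theorem curveLen_eq_derivWithin (ρ : E → ℝ) (γ : ℝ → E) :
    curveLen ρ γ = ∫ t in (0:ℝ)..1, ρ (γ t) * ‖derivWithin γ (Icc 0 1) t‖ := by
  unfold curveLen
  refine intervalIntegral.integral_congr_uIoo fun t ht => ?_
  rw [uIoo_of_le zero_le_one] at ht
  rw [derivWithin_of_mem_nhds (Icc_mem_nhds ht.1 ht.2)]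

theorem IsC1Curve.continuousOn_integrand (h : IsC1Curve S γ z w) (hρ : ContinuousOn ρ S) :
    ContinuousOn (fun t => ρ (γ t) * ‖derivWithin γ (Icc 0 1) t‖) (Icc 0 1) :=
  (hρ.comp h.continuousOn h.mem).mul
    (h.contDiffOn.continuousOn_derivWithin (uniqueDiffOn_Icc zero_lt_one) le_rfl).norm

theorem IsC1Curve.intervalIntegrable (h : IsC1Curve S γ z w) (hρ : ContinuousOn ρ S) :
    IntervalIntegrable (fun t => ρ (γ t) * ‖deriv γ t‖) MeasureTheory.volume 0 1 := by
  refine ((h.continuousOn_integrand hρ).intervalIntegrable_of_Icc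
    zero_le_one).congr_uIoo fun t ht => ?_
  rw [uIoo_of_le zero_le_one] at ht
  simp only
  rw [derivWithin_of_mem_nhds (Icc_mem_nhds ht.1 ht.2)]

theorem curveLen_nonneg (h : IsC1Curve S γ z w) (hρ : ∀ x ∈ S, 0 ≤ ρ x) : 0 ≤ curveLen ρ γ :=
  intervalIntegral.integral_nonneg zero_le_one fun t ht =>
    mul_nonneg (hρ _ (h.mem t ht)) (norm_nonneg _)

theorem densityDist_eq : densityDist S ρ z w =
    sInf {L | ∃ γ : ℝ → E, IsC1Curve S γ z w ∧ L = curveLen ρ γ} := by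
  unfold densityDist
  congr 1
  ext L
  constructor
  · rintro ⟨γ, h1, h2, h3, h4, h5⟩
    exact ⟨γ, ⟨h1, h2, h3, h4⟩, h5⟩
  · rintro ⟨γ, ⟨h1, h2, h3, h4⟩, h5⟩
    exact ⟨γ, h1, h2, h3, h4, h5⟩

theorem densityDist_nonneg (hρ : ∀ x ∈ S, 0 ≤ ρ x) : 0 ≤ densityDist S ρ z w := by
  rw [densityDist_eq]
  refine Real.sInf_nonneg ?_
  rintro L ⟨γ, h, rfl⟩
  exact curveLen_nonneg h hρ

theorem IsC1Curve.densityDist_le (h : IsC1Curve S γ z w) (hρ : ∀ x ∈ S, 0 ≤ ρ x) :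
    densityDist S ρ z w ≤ curveLen ρ γ := by
  rw [densityDist_eq]
  refine csInf_le ⟨0, ?_⟩ ⟨γ, h, rfl⟩
  rintro L ⟨γ, h, rfl⟩
  exact curveLen_nonneg h hρ

theorem exists_curveLen_lt {c : ℝ} (hne : ∃ γ, IsC1Curve S γ z w)
    (hc : densityDist S ρ z w < c) : ∃ γ, IsC1Curve S γ z w ∧ curveLen ρ γ < c := by
  rw [densityDist_eq] at hc
  obtain ⟨γ₀, h₀⟩ := hne
  obtain ⟨L, ⟨γ, h, rfl⟩, hL⟩ := exists_lt_of_csInf_lt (by exact ⟨_, γ₀, h₀, rfl⟩) hc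
  exact ⟨γ, h, hL⟩

theorem IsC1Curve.segment (h : ∀ t ∈ Icc (0:ℝ) 1, z + t • (w - z) ∈ S) :
    IsC1Curve S (fun t : ℝ => z + t • (w - z)) z w where
  contDiffOn := by fun_prop
  source := by simp
  target := by simp
  mem := h

theorem isC1Curve_const (hz : z ∈ S) : IsC1Curve S (fun _ => z) z z where
  contDiffOn := contDiffOn_const
  source := rfl
  target := rfl
  mem := fun _ _ => hz

theorem densityDist_self (hρ : ∀ x ∈ S, 0 ≤ ρ x) (hz : z ∈ S) : densityDist S ρ z z = 0 := by
  refine le_antisymm ?_ (densityDist_nonneg hρ)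
  simpa [curveLen] using (isC1Curve_const hz).densityDist_le hρ

theorem IsC1Curve.subcurve (h : IsC1Curve S γ z w) {u v : ℝ} (hu : u ∈ Icc (0:ℝ) 1)
    (hv : v ∈ Icc (0:ℝ) 1) :
    IsC1Curve S (fun t => γ ((v - u) * t + u)) (γ u) (γ v) := by
  have hm : MapsTo (fun t : ℝ => (v - u) * t + u) (Icc 0 1) (Icc 0 1) := by
    rintro t ⟨ht0, ht1⟩
    constructor <;> nlinarith [hu.1, hu.2, hv.1, hv.2]
  refine ⟨?_, by simp, by simp, fun t ht => h.mem _ (hm ht)⟩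
  exact h.contDiffOn.comp (by fun_prop) hm

theorem curveLen_comp_mul_add (ρ : E → ℝ) (γ : ℝ → E) (c u : ℝ) :
    curveLen ρ (fun t => γ (c * t + u)) =
      |c| * ∫ t in (0:ℝ)..1, ρ (γ (c * t + u)) * ‖deriv γ (c * t + u)‖ := by
  have hd : ∀ t, deriv (fun t => γ (c * t + u)) t = c • deriv γ (c * t + u) := fun t => by
    rw [deriv_comp_mul_left c (fun s => γ (s + u)) t, deriv_comp_add_const]
  unfold curveLen
  rw [← intervalIntegral.integral_const_mul]
  congr 1
  ext t
  rw [hd, norm_smul, Real.norm_eq_abs]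
  ring

theorem curveLen_subcurve (ρ : E → ℝ) (γ : ℝ → E) {u v : ℝ} (huv : u ≤ v) :
    curveLen ρ (fun t => γ ((v - u) * t + u)) = ∫ t in u..v, ρ (γ t) * ‖deriv γ t‖ := by
  rw [curveLen_comp_mul_add, abs_of_nonneg (sub_nonneg.2 huv)]
  have := intervalIntegral.smul_integral_comp_mul_add (a := 0) (b := 1)
    (fun t => ρ (γ t) * ‖deriv γ t‖) (v - u) u
  simpa using this

theorem densityDist_comm_le (hρ : ∀ x ∈ S, 0 ≤ ρ x) (hne : ∃ γ, IsC1Curve S γ z w) :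
    densityDist S ρ w z ≤ densityDist S ρ z w := by
  refine le_of_forall_gt fun c hc => ?_
  obtain ⟨γ, h, hL⟩ := exists_curveLen_lt hne hc
  have h' := h.subcurve (u := 1) (v := 0) (by simp) (by simp)
  rw [h.source, h.target] at h'
  refine (h'.densityDist_le hρ).trans_lt ?_
  rw [curveLen_comp_mul_add]
  have := intervalIntegral.smul_integral_comp_mul_add (a := 0) (b := 1)
    (fun t => ρ (γ t) * ‖deriv γ t‖) (-1) 1
  simp only [smul_eq_mul, mul_zero, zero_add, mul_one, neg_add_cancel] at this
  rw [intervalIntegral.integral_symm 0 1] at this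
  norm_num at this ⊢
  rw [this]
  exact hL

theorem IsC1Curve.symm (h : IsC1Curve S γ z w) : ∃ γ, IsC1Curve S γ w z := by
  have h' := h.subcurve (u := 1) (v := 0) (by simp) (by simp)
  rw [h.source, h.target] at h'
  exact ⟨_, h'⟩

theorem IsC1Curve.comp_smoothTransition (h : IsC1Curve S γ z w) :
    ContDiff ℝ 1 (fun t => γ (Real.smoothTransition t)) := by
  rw [← contDiffOn_univ]
  exact h.contDiffOn.comp (Real.smoothTransition.contDiff (n := 1)).contDiffOn
    fun t _ => ⟨Real.smoothTransition.nonneg t, Real.smoothTransition.le_one t⟩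

theorem curveLen_comp_smoothTransition (h : IsC1Curve S γ z w) (hρ : ContinuousOn ρ S) :
    curveLen ρ (fun t => γ (Real.smoothTransition t)) = curveLen ρ γ := by
  rw [curveLen_eq_derivWithin ρ γ]
  have hs : ContDiff ℝ 1 Real.smoothTransition := Real.smoothTransition.contDiff (n := 1)
  have key := intervalIntegral.integral_comp_mul_deriv'' (a := 0) (b := 1)
    (f := Real.smoothTransition) (f' := deriv Real.smoothTransition)
    (g := fun t => ρ (γ t) * ‖derivWithin γ (Icc 0 1) t‖)
    Real.smoothTransition.continuous.continuousOn
    (fun t _ => (hs.differentiable one_ne_zero t).hasDerivAt.hasDerivWithinAt)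
    (hs.continuous_deriv le_rfl).continuousOn
    ((h.continuousOn_integrand hρ).mono (by
      rintro _ ⟨t, -, rfl⟩
      exact ⟨Real.smoothTransition.nonneg t, Real.smoothTransition.le_one t⟩))
  rw [Real.smoothTransition.zero, Real.smoothTransition.one] at key
  rw [← key]
  unfold curveLen
  refine intervalIntegral.integral_congr_uIoo fun t ht => ?_
  rw [uIoo_of_le zero_le_one] at ht
  have h0 := Real.smoothTransition.pos_of_pos ht.1
  have h1 := Real.smoothTransition.lt_one_of_lt_one ht.2
  have hd : HasDerivAt γ (derivWithin γ (Icc 0 1) (Real.smoothTransition t))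
      (Real.smoothTransition t) :=
    ((h.contDiffOn.differentiableOn one_ne_zero _ ⟨h0.le, h1.le⟩).hasDerivWithinAt).hasDerivAt
      (Icc_mem_nhds h0 h1)
  have hc := (hd.scomp t (hs.differentiable one_ne_zero t).hasDerivAt).deriv
  simp only [Function.comp_def] at hc ⊢
  rw [hc, norm_smul, Real.norm_eq_abs, abs_of_nonneg
    (Real.smoothTransition.monotone.deriv_nonneg)]
  ring

theorem IsC1Curve.trans {γ₁ γ₂ : ℝ → E} (h₁ : IsC1Curve S γ₁ z w) (h₂ : IsC1Curve S γ₂ w y)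
    (hρ : ContinuousOn ρ S) :
    ∃ γ, IsC1Curve S γ z y ∧ curveLen ρ γ = curveLen ρ γ₁ + curveLen ρ γ₂ := by
  set s := Real.smoothTransition with hs
  set σ : ℝ → E := fun t => γ₁ (s (2 * t)) + γ₂ (s (2 * t + (-1))) - w with hσ
  have hl : ∀ t ≤ 1 / 2, σ t = γ₁ (s (2 * t + 0)) := fun t ht => by
    simp [hσ, hs, Real.smoothTransition.zero_of_nonpos (show 2 * t + (-1) ≤ 0 by linarith),
      h₂.source]
  have hr : ∀ t ≥ 1 / 2, σ t = γ₂ (s (2 * t + (-1))) := fun t ht => by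
    simp [hσ, hs, Real.smoothTransition.one_of_one_le (show 1 ≤ 2 * t by linarith), h₁.target]
  have hI : ∀ t, s t ∈ Icc (0:ℝ) 1 := fun t =>
    ⟨Real.smoothTransition.nonneg t, Real.smoothTransition.le_one t⟩
  have hcd : ContDiff ℝ 1 σ := by
    have e1 := h₁.comp_smoothTransition.comp (g := fun t => γ₁ (s t)) (f := fun t : ℝ => 2 * t)
      (by fun_prop)
    have e2 := h₂.comp_smoothTransition.comp (g := fun t => γ₂ (s t))
      (f := fun t : ℝ => 2 * t + (-1)) (by fun_prop)
    exact (e1.add e2).sub contDiff_const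
  have hmem : ∀ t, σ t ∈ S := fun t => by
    rcases le_total t (1 / 2) with ht | ht
    · rw [hl t ht]; exact h₁.mem _ (hI _)
    · rw [hr t ht]; exact h₂.mem _ (hI _)
  have hC : IsC1Curve S σ z y := by
    refine ⟨hcd.contDiffOn, ?_, ?_, fun t _ => hmem t⟩
    · rw [hl 0 (by norm_num)]; simpa [hs] using h₁.source
    · rw [hr 1 (by norm_num)]; norm_num [hs]; exact h₂.target
  refine ⟨σ, hC, ?_⟩
  have hcont : Continuous fun t => ρ (σ t) * ‖deriv σ t‖ :=
    (hρ.comp_continuous hcd.continuous hmem).mul (hcd.continuous_deriv le_rfl).norm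
  have hhalf : ∀ (γ : ℝ → E) (a b d : ℝ), a ≤ b → 2 * a + d = 0 → 2 * b + d = 1 →
      (∀ t ∈ Ioo a b, σ =ᶠ[nhds t] fun t => γ (s (2 * t + d))) →
      ∫ t in a..b, ρ (σ t) * ‖deriv σ t‖ = curveLen ρ (fun t => γ (s t)) := by
    intro γ a b d hab ha hb heq
    have h2 := intervalIntegral.smul_integral_comp_mul_add (a := a) (b := b)
      (fun t => ρ (γ (s t)) * ‖deriv (fun t => γ (s t)) t‖) 2 d
    rw [ha, hb] at h2
    unfold curveLen
    rw [← h2, smul_eq_mul, ← intervalIntegral.integral_const_mul]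
    refine intervalIntegral.integral_congr_uIoo fun t ht => ?_
    rw [uIoo_of_le hab] at ht
    have he := heq t ht
    rw [he.deriv_eq, he.eq_of_nhds, deriv_comp_mul_left 2 (fun t => γ (s (t + d))) t,
      deriv_comp_add_const (fun t => γ (s t)), norm_smul]
    norm_num
    ring
  rw [← curveLen_comp_smoothTransition h₁ hρ, ← curveLen_comp_smoothTransition h₂ hρ]
  rw [curveLen, ← intervalIntegral.integral_add_adjacent_intervals
    (hcont.intervalIntegrable 0 (1 / 2)) (hcont.intervalIntegrable (1 / 2) 1)]
  congr 1
  · refine hhalf γ₁ 0 (1 / 2) 0 (by norm_num) (by norm_num) (by norm_num) fun t ht => ?_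
    filter_upwards [Iio_mem_nhds ht.2] with x hx using hl x (le_of_lt hx)
  · refine hhalf γ₂ (1 / 2) 1 (-1) (by norm_num) (by norm_num) (by norm_num) fun t ht => ?_
    filter_upwards [Ioi_mem_nhds ht.1] with x hx using hr x (le_of_lt hx)

theorem densityDist_triangle (hρ : ContinuousOn ρ S) (hρ0 : ∀ x ∈ S, 0 ≤ ρ x)
    (h₁ : ∃ γ, IsC1Curve S γ z w) (h₂ : ∃ γ, IsC1Curve S γ w y) :
    densityDist S ρ z y ≤ densityDist S ρ z w + densityDist S ρ w y := by
  refine le_of_forall_pos_lt_add fun ε hε => ?_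
  obtain ⟨γ₁, hγ₁, hl₁⟩ := exists_curveLen_lt h₁
    (show densityDist S ρ z w < densityDist S ρ z w + ε / 2 by linarith)
  obtain ⟨γ₂, hγ₂, hl₂⟩ := exists_curveLen_lt h₂
    (show densityDist S ρ w y < densityDist S ρ w y + ε / 2 by linarith)
  obtain ⟨γ, hγ, hl⟩ := hγ₁.trans hγ₂ hρ
  have := hγ.densityDist_le hρ0
  linarith

end Curves

section Quasihyperbolic

theorem mem_of_infDist_compl_pos {X : Type*} [PseudoMetricSpace X] {S : Set X} {z : X}
    (hz : 0 < infDist z Sᶜ) : z ∈ S := by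
  by_contra h
  exact hz.ne' (infDist_zero_of_mem h)

variable {E : Type*} [NormedAddCommGroup E] [NormedSpace ℝ E] {S : Set E} {γ : ℝ → E} {z w y : E}

/-- `S` is a proper open subset in which any two points are joined by a `C¹` curve. -/
structure IsC1Domain (S : Set E) : Prop where
  isOpen : IsOpen S
  nonempty_compl : Sᶜ.Nonempty
  exists_curve : ∀ z ∈ S, ∀ w ∈ S, ∃ γ, IsC1Curve S γ z w

theorem IsC1Domain.infDist_pos (hS : IsC1Domain S) (hz : z ∈ S) : 0 < infDist z Sᶜ :=
  (hS.isOpen.isClosed_compl.notMem_iff_infDist_pos hS.nonempty_compl).1 (by simpa using hz)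

theorem qhDensity_nonneg (S : Set E) (z : E) : 0 ≤ qhDensity S z :=
  inv_nonneg.2 infDist_nonneg

theorem IsC1Domain.continuousOn_qhDensity (hS : IsC1Domain S) : ContinuousOn (qhDensity S) S :=
  (continuous_infDist_pt _).continuousOn.inv₀ fun _ hx => (hS.infDist_pos hx).ne'

theorem qhDist_nonneg (S : Set E) (z w : E) : 0 ≤ qhDist S z w :=
  densityDist_nonneg fun x _ => qhDensity_nonneg S x

theorem qhDist_self (hz : z ∈ S) : qhDist S z z = 0 :=
  densityDist_self (fun x _ => qhDensity_nonneg S x) hz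

theorem IsC1Domain.qhDist_comm (hS : IsC1Domain S) (hz : z ∈ S) (hw : w ∈ S) :
    qhDist S z w = qhDist S w z :=
  le_antisymm
    (densityDist_comm_le (fun x _ => qhDensity_nonneg S x) (hS.exists_curve w hw z hz))
    (densityDist_comm_le (fun x _ => qhDensity_nonneg S x) (hS.exists_curve z hz w hw))

theorem IsC1Domain.qhDist_triangle (hS : IsC1Domain S) (hz : z ∈ S) (hw : w ∈ S) (hy : y ∈ S) :
    qhDist S z y ≤ qhDist S z w + qhDist S w y :=
  densityDist_triangle hS.continuousOn_qhDensity (fun x _ => qhDensity_nonneg S x)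
    (hS.exists_curve z hz w hw) (hS.exists_curve w hw y hy)

theorem IsC1Curve.qhDist_le (h : IsC1Curve S γ z w) : qhDist S z w ≤ curveLen (qhDensity S) γ :=
  h.densityDist_le fun x _ => qhDensity_nonneg S x

theorem IsC1Domain.norm_sub_le_of_curveLen_lt (hS : IsC1Domain S) (h : IsC1Curve S γ z w) {c : ℝ}
    (hc : curveLen (qhDensity S) γ < c) :
    ‖w - z‖ ≤ infDist z Sᶜ * (Real.exp c - 1) := by
  have hz : z ∈ S := h.source ▸ h.mem 0 (by simp)
  have hδ := hS.infDist_pos hz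
  set δ := infDist z Sᶜ with hδ_def
  set F : ℝ → ℝ := fun t => qhDensity S (γ t) * ‖derivWithin γ (Icc 0 1) t‖ with hF
  have hFc : ContinuousOn F (Icc 0 1) := h.continuousOn_integrand hS.continuousOn_qhDensity
  set G : ℝ → ℝ := IccExtend zero_le_one ((Icc (0:ℝ) 1).domRestrict F) with hG
  have hGc : Continuous G := (continuousOn_iff_continuous_domRestrict.1 hFc).Icc_extend'
  have hGF : ∀ t ∈ Icc (0:ℝ) 1, G t = F t := fun t ht => by
    rw [hG, IccExtend_of_mem _ _ ht]; rfl
  set ℓ : ℝ → ℝ := fun t => ∫ s in (0:ℝ)..t, G s with hℓ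
  have hℓ' : ∀ t, HasDerivAt ℓ (G t) t := fun t =>
    intervalIntegral.integral_hasDerivAt_right (hGc.intervalIntegrable _ _)
      (hGc.stronglyMeasurableAtFilter _ _) hGc.continuousAt
  have hℓ1 : ℓ 1 = curveLen (qhDensity S) γ := by
    rw [curveLen_eq_derivWithin]
    refine intervalIntegral.integral_congr fun t ht => ?_
    rw [uIcc_of_le zero_le_one] at ht
    exact hGF t ht
  set ε := c - curveLen (qhDensity S) γ with hε
  have hε0 : 0 < ε := sub_pos.2 hc
  have hB : ∀ t, HasDerivAt (fun t => δ * (Real.exp (ℓ t + ε * t) - 1))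
      (δ * (Real.exp (ℓ t + ε * t) * (G t + ε))) t := fun t => by
    have := ((((hℓ' t).add ((hasDerivAt_id t).const_mul ε)).exp).sub_const 1).const_mul δ
    simpa using this
  have key := image_norm_le_of_norm_deriv_right_lt_deriv_boundary (a := 0) (b := 1)
    (f := fun t => γ t - z) (f' := derivWithin γ (Icc 0 1))
    (h.continuousOn.sub continuousOn_const) (fun t ht => by
      have hd := ((h.contDiffOn.differentiableOn one_ne_zero) t
        ⟨ht.1, ht.2.le⟩).hasDerivWithinAt.sub_const z
      exact hd.mono_of_mem_nhdsWithin (Icc_mem_nhdsGE_of_mem ht))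
    (by simp [hℓ, h.source]) hB (fun t ht hEq => by
      have ht' : t ∈ Icc (0:ℝ) 1 := ⟨ht.1, ht.2.le⟩
      have hpos := hS.infDist_pos (h.mem t ht')
      have hFt : ‖derivWithin γ (Icc 0 1) t‖ = F t * infDist (γ t) Sᶜ := by
        simp only [hF, qhDensity]
        field_simp
      have hF0 : 0 ≤ F t := mul_nonneg (qhDensity_nonneg _ _) (norm_nonneg _)
      have hle : infDist (γ t) Sᶜ ≤ δ * Real.exp (ℓ t + ε * t) := by
        have := infDist_le_infDist_add_dist (s := Sᶜ) (x := γ t) (y := z)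
        rw [dist_eq_norm, hEq] at this
        linarith
      rw [hFt, hGF t ht']
      have hpe : 0 < δ * Real.exp (ℓ t + ε * t) := mul_pos hδ (Real.exp_pos _)
      calc F t * infDist (γ t) Sᶜ ≤ F t * (δ * Real.exp (ℓ t + ε * t)) :=
            mul_le_mul_of_nonneg_left hle hF0
        _ < _ := by nlinarith) (x := 1) (by simp)
  rw [h.target, hℓ1] at key
  have he : curveLen (qhDensity S) γ + ε * 1 = c := by rw [hε]; ring
  rwa [he] at key

theorem IsC1Domain.norm_sub_le (hS : IsC1Domain S) (hz : z ∈ S) (hw : w ∈ S) :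
    ‖w - z‖ ≤ infDist z Sᶜ * (Real.exp (qhDist S z w) - 1) := by
  have hlim : Tendsto (fun c => infDist z Sᶜ * (Real.exp c - 1))
      (nhdsWithin (qhDist S z w) (Ioi (qhDist S z w)))
      (nhds (infDist z Sᶜ * (Real.exp (qhDist S z w) - 1))) :=
    Continuous.continuousWithinAt (by fun_prop)
  refine ge_of_tendsto hlim ?_
  filter_upwards [self_mem_nhdsWithin] with c hc
  obtain ⟨γ, h, hL⟩ := exists_curveLen_lt (hS.exists_curve z hz w hw) hc
  exact hS.norm_sub_le_of_curveLen_lt h hL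

theorem IsC1Domain.eq_of_qhDist_nonpos (hS : IsC1Domain S) (hz : z ∈ S) (hw : w ∈ S)
    (h : qhDist S z w ≤ 0) : w = z := by
  have h1 := hS.norm_sub_le hz hw
  rw [le_antisymm h (qhDist_nonneg S z w)] at h1
  simpa [sub_eq_zero] using h1

theorem IsC1Domain.infDist_le (hS : IsC1Domain S) (hz : z ∈ S) (hw : w ∈ S) :
    infDist w Sᶜ ≤ infDist z Sᶜ * Real.exp (qhDist S z w) := by
  have h1 := hS.norm_sub_le hz hw
  have h2 := infDist_le_infDist_add_dist (s := Sᶜ) (x := w) (y := z)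
  rw [dist_eq_norm] at h2
  linarith

theorem qhDist_le_of_segment {m : ℝ} (hm : 0 < m)
    (h : ∀ t ∈ Icc (0:ℝ) 1, m ≤ infDist (z + t • (w - z)) Sᶜ) :
    qhDist S z w ≤ ‖w - z‖ / m := by
  have hC : IsC1Curve S (fun t : ℝ => z + t • (w - z)) z w :=
    .segment fun t ht => mem_of_infDist_compl_pos (hm.trans_le (h t ht))
  refine hC.qhDist_le.trans ?_
  have hd : ∀ t, deriv (fun t : ℝ => z + t • (w - z)) t = w - z := fun t => by
    have := (((hasDerivAt_id t).smul_const (w - z)).const_add z).deriv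
    simpa using this
  have hc : ∀ t ∈ Ioc (0:ℝ) 1,
      ‖qhDensity S (z + t • (w - z)) * ‖deriv (fun t : ℝ => z + t • (w - z)) t‖‖ ≤
        ‖w - z‖ / m := fun t ht => by
    rw [hd, Real.norm_of_nonneg (mul_nonneg (qhDensity_nonneg _ _) (norm_nonneg _)), qhDensity,
      div_eq_inv_mul]
    gcongr
    exact h t ⟨ht.1.le, ht.2⟩
  have := intervalIntegral.norm_integral_le_of_norm_le_const (a := 0) (b := 1)
    (by rwa [uIoc_of_le zero_le_one])
  simp only [sub_zero, abs_one, mul_one] at this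
  exact (le_abs_self _).trans this

theorem IsC1Domain.qhDist_le_of_near (hS : IsC1Domain S) (hz : z ∈ S)
    (hw : ‖w - z‖ ≤ infDist z Sᶜ / 2) : qhDist S z w ≤ ‖w - z‖ / (infDist z Sᶜ / 2) := by
  refine qhDist_le_of_segment (half_pos (hS.infDist_pos hz)) fun t ht => ?_
  have h2 := infDist_le_infDist_add_dist (s := Sᶜ) (x := z) (y := z + t • (w - z))
  rw [dist_eq_norm, sub_add_cancel_left, norm_neg, norm_smul, Real.norm_of_nonneg ht.1] at h2
  nlinarith [norm_nonneg (w - z), ht.2]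

theorem IsC1Domain.tendsto_qhDist (hS : IsC1Domain S) (hz : z ∈ S) {ι : Type*} {l : Filter ι}
    {f : ι → E} (hf : Tendsto f l (nhds z)) :
    Tendsto (fun i => qhDist S z (f i)) l (nhds 0) := by
  have hpos := half_pos (hS.infDist_pos hz)
  have hn : Tendsto (fun i => ‖f i - z‖) l (nhds 0) := by
    simpa using (hf.sub_const z).norm
  have hn' : Tendsto (fun i => ‖f i - z‖ / (infDist z Sᶜ / 2)) l (nhds 0) := by
    simpa using hn.div_const (infDist z Sᶜ / 2)
  refine tendsto_of_tendsto_of_tendsto_of_le_of_le' tendsto_const_nhds hn'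
    (Eventually.of_forall fun i => qhDist_nonneg S _ _) ?_
  filter_upwards [hn.eventually (gt_mem_nhds hpos)] with i hi
  exact hS.qhDist_le_of_near hz hi.le

/-- Arclength reparametrizations of almost shortest curves are almost geodesics. -/
theorem IsC1Domain.exists_approx_geodesic (hS : IsC1Domain S) (hz : z ∈ S) (hw : w ∈ S) {ε : ℝ}
    (hε : 0 < ε) : ∃ g : ℝ → E, ∀ t ∈ Icc 0 (qhDist S z w), g t ∈ S ∧ qhDist S z (g t) ≤ t ∧
      qhDist S (g t) w ≤ qhDist S z w - t + ε ∧
      ∀ s ∈ Icc 0 (qhDist S z w), qhDist S (g s) (g t) ≤ |s - t| := by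
  obtain ⟨γ, h, hL⟩ := exists_curveLen_lt (hS.exists_curve z hz w hw)
    (show densityDist S (qhDensity S) z w < qhDist S z w + ε by simpa [qhDist] using hε)
  have hintegral : IntervalIntegrable (fun t => qhDensity S (γ t) * ‖deriv γ t‖)
      MeasureTheory.volume 0 1 := h.intervalIntegrable hS.continuousOn_qhDensity
  set F : ℝ → ℝ := fun t => qhDensity S (γ t) * ‖deriv γ t‖ with hF
  set ℓ : ℝ → ℝ := fun t => ∫ s in (0:ℝ)..t, F s with hℓ
  have hsub : ∀ u ∈ Icc (0:ℝ) 1, ∀ v ∈ Icc (0:ℝ) 1, IntervalIntegrable F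
      MeasureTheory.volume u v := fun u hu v hv => by
    refine hintegral.mono_set ?_
    rw [uIcc_of_le zero_le_one]
    exact uIcc_subset_Icc hu hv
  have hle : ∀ u ∈ Icc (0:ℝ) 1, ∀ v ∈ Icc (0:ℝ) 1, u ≤ v →
      qhDist S (γ u) (γ v) ≤ ℓ v - ℓ u := fun u hu v hv huv => by
    refine (h.subcurve hu hv).qhDist_le.trans_eq ?_
    rw [curveLen_subcurve _ _ huv, hℓ]
    exact (intervalIntegral.integral_interval_sub_left (hsub 0 (by simp) v hv)
      (hsub 0 (by simp) u hu)).symm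
  have habs : ∀ u ∈ Icc (0:ℝ) 1, ∀ v ∈ Icc (0:ℝ) 1,
      qhDist S (γ u) (γ v) ≤ |ℓ u - ℓ v| := fun u hu v hv => by
    rcases le_total u v with huv | huv
    · rw [abs_sub_comm]
      exact (hle u hu v hv huv).trans (le_abs_self _)
    · rw [hS.qhDist_comm (h.mem u hu) (h.mem v hv)]
      exact (hle v hv u hu huv).trans (le_abs_self _)
  have hℓc : ContinuousOn ℓ (Icc 0 1) := by
    have := intervalIntegral.continuousOn_primitive_interval (μ := MeasureTheory.volume)
      (f := F) (a := 0) (b := 1)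
      (by
        rw [uIcc_of_le zero_le_one]
        exact (intervalIntegrable_iff_integrableOn_Icc_of_le zero_le_one).1 hintegral)
    rwa [uIcc_of_le zero_le_one] at this
  have hℓ0 : ℓ 0 = 0 := by simp [hℓ]
  have hL1 : qhDist S z w ≤ ℓ 1 := h.qhDist_le
  have hivt := intermediate_value_Icc zero_le_one hℓc
  rw [hℓ0] at hivt
  have hu : ∀ t ∈ Icc 0 (qhDist S z w), ∃ u ∈ Icc (0:ℝ) 1, ℓ u = t := fun t ht =>
    hivt ⟨ht.1, ht.2.trans hL1⟩
  choose! u hu1 hu2 using hu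
  refine ⟨fun t => γ (u t), fun t ht => ⟨h.mem _ (hu1 t ht), ?_, ?_, fun s hs => ?_⟩⟩
  · have := hle 0 (by simp) (u t) (hu1 t ht) (hu1 t ht).1
    rwa [h.source, hu2 t ht, hℓ0, sub_zero] at this
  · have := hle (u t) (hu1 t ht) 1 (by simp) (hu1 t ht).2
    rw [h.target, hu2 t ht] at this
    have h1 : ℓ 1 < qhDist S z w + ε := hL
    linarith
  · have := habs (u s) (hu1 s hs) (u t) (hu1 t ht)
    rwa [hu2 s hs, hu2 t ht] at this

theorem IsC1Domain.exists_isGeodesicIn [ProperSpace E] (hS : IsC1Domain S) (hz : z ∈ S)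
    (hw : w ∈ S) : ∃ g, IsGeodesicIn S (qhDist S) g z w := by
  set L := qhDist S z w with hL
  have hL0 : 0 ≤ L := qhDist_nonneg S z w
  have happ : ∀ n : ℕ, ∃ g : ℝ → E, ∀ t ∈ Icc 0 L, g t ∈ S ∧ qhDist S z (g t) ≤ t ∧
      qhDist S (g t) w ≤ L - t + 1 / ((n:ℝ) + 1) ∧
      ∀ s ∈ Icc 0 L, qhDist S (g s) (g t) ≤ |s - t| := fun n =>
    hS.exists_approx_geodesic hz hw (by positivity)
  choose G hG using happ
  set m := infDist z Sᶜ * Real.exp (-L) with hm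
  have hm0 : 0 < m := mul_pos (hS.infDist_pos hz) (Real.exp_pos _)
  set K := closedBall z (infDist z Sᶜ * (Real.exp L - 1)) ∩ {x | m ≤ infDist x Sᶜ} with hK
  have hKc : IsCompact K := (isCompact_closedBall _ _).inter_right
    (isClosed_le continuous_const (continuous_infDist_pt _))
  have hGK : ∀ t ∈ Icc 0 L, ∀ n, G n t ∈ K := fun t ht n => by
    obtain ⟨h1, h2, -, -⟩ := hG n t ht
    have h3 := h2.trans ht.2
    constructor
    · rw [mem_closedBall, dist_eq_norm]
      refine (hS.norm_sub_le hz h1).trans ?_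
      have := (hS.infDist_pos hz).le
      gcongr
    · have h4 := hS.infDist_le h1 hz
      rw [hS.qhDist_comm h1 hz] at h4
      have h5 : infDist z Sᶜ ≤ infDist (G n t) Sᶜ * Real.exp L :=
        h4.trans (by gcongr; exact infDist_nonneg)
      rw [mem_ofPred_eq, hm, Real.exp_neg, ← div_eq_mul_inv, div_le_iff₀ (Real.exp_pos _)]
      exact h5
  set U : Ultrafilter ℕ := hyperfilter ℕ with hU
  have hUle : (U : Filter ℕ) ≤ atTop := Nat.hyperfilter_le_atTop
  have hlim : ∀ t ∈ Icc 0 L, ∃ x ∈ S, Tendsto (fun n => G n t) U (nhds x) := fun t ht => by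
    obtain ⟨x, hx, hle⟩ := hKc.ultrafilter_le_nhds (U.map fun n => G n t) (by
      rw [le_principal_iff, Ultrafilter.mem_coe, Ultrafilter.mem_map]
      exact univ_mem' (hGK t ht))
    exact ⟨x, mem_of_infDist_compl_pos (hm0.trans_le hx.2), hle⟩
  choose! g hgS hgt using hlim
  have hdist : ∀ t ∈ Icc 0 L, Tendsto (fun n => qhDist S (g t) (G n t)) U (nhds 0) :=
    fun t ht => hS.tendsto_qhDist (hgS t ht) (hgt t ht)
  have hz' : ∀ t ∈ Icc 0 L, qhDist S z (g t) ≤ t := fun t ht => by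
    have h0 := (hdist t ht).const_add t
    rw [add_zero] at h0
    refine ge_of_tendsto' h0 fun n => ?_
    obtain ⟨h1, h2, -, -⟩ := hG n t ht
    have := hS.qhDist_triangle hz h1 (hgS t ht)
    rw [hS.qhDist_comm h1 (hgS t ht)] at this
    linarith
  have hw' : ∀ t ∈ Icc 0 L, qhDist S (g t) w ≤ L - t := fun t ht => by
    have h0 := ((hdist t ht).add_const (L - t)).add
      (tendsto_one_div_add_atTop_nhds_zero_nat.mono_left hUle)
    rw [add_zero, zero_add] at h0
    refine ge_of_tendsto' h0 fun n => ?_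
    obtain ⟨h1, -, h2, -⟩ := hG n t ht
    have := hS.qhDist_triangle (hgS t ht) h1 hw
    linarith
  have hst : ∀ s ∈ Icc 0 L, ∀ t ∈ Icc 0 L, qhDist S (g s) (g t) ≤ |s - t| :=
    fun s hs t ht => by
    have h0 := ((hdist s hs).add_const |s - t|).add (hdist t ht)
    rw [add_zero, zero_add] at h0
    refine ge_of_tendsto' h0 fun n => ?_
    obtain ⟨h1, -, -, h2⟩ := hG n t ht
    have h3 := (hG n s hs).1
    have h4 := hS.qhDist_triangle (hgS s hs) h3 (hgS t ht)
    have h5 := hS.qhDist_triangle h3 h1 (hgS t ht)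
    rw [hS.qhDist_comm h1 (hgS t ht)] at h5
    linarith [h2 s hs]
  have h0L : (0:ℝ) ∈ Icc 0 L := ⟨le_rfl, hL0⟩
  have hLL : L ∈ Icc 0 L := ⟨hL0, le_rfl⟩
  refine ⟨g, hS.eq_of_qhDist_nonpos hz (hgS 0 h0L) (hz' 0 h0L),
    (hS.eq_of_qhDist_nonpos (hgS L hLL) hw (by simpa using hw' L hLL)).symm, hgS, ?_⟩
  have hge : ∀ s ∈ Icc 0 L, ∀ t ∈ Icc 0 L, s ≤ t → t - s ≤ qhDist S (g s) (g t) :=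
    fun s hs t ht hle => by
    have h1 := hS.qhDist_triangle hz (hgS s hs) hw
    have h2 := hS.qhDist_triangle (hgS s hs) (hgS t ht) hw
    linarith [hz' s hs, hw' t ht]
  intro s hs t ht
  refine le_antisymm (hst s hs t ht) ?_
  rcases le_total s t with h | h
  · rw [abs_sub_comm, abs_of_nonneg (sub_nonneg.2 h)]
    exact hge s hs t ht h
  · rw [abs_of_nonneg (sub_nonneg.2 h), hS.qhDist_comm (hgS s hs) (hgS t ht)]
    exact hge t ht s hs h

end Quasihyperbolic

section QuasihyperbolicCurves

variable {E : Type*} [NormedAddCommGroup E] [NormedSpace ℝ E] {S : Set E} {γ : ℝ → E} {z w : E}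

theorem IsC1Curve.qhDist_le_curveLen (hS : IsC1Domain S) (h : IsC1Curve S γ z w) {u : ℝ}
    (hu : u ∈ Icc (0:ℝ) 1) : qhDist S z (γ u) ≤ curveLen (qhDensity S) γ := by
  have hsub := (h.subcurve (u := 0) (by simp) hu).qhDist_le
  rw [curveLen_subcurve _ _ hu.1, h.source] at hsub
  refine hsub.trans (intervalIntegral.integral_mono_interval le_rfl hu.1 hu.2 ?_
    (h.intervalIntegrable hS.continuousOn_qhDensity))
  exact Eventually.of_forall fun t => mul_nonneg (qhDensity_nonneg S _) (norm_nonneg _)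

theorem IsGeodesicIn.continuousOn (hS : IsC1Domain S) {g : ℝ → E}
    (hg : IsGeodesicIn S (qhDist S) g z w) : ContinuousOn g (Icc 0 (qhDist S z w)) := by
  intro s hs
  obtain ⟨-, -, hmem, hd⟩ := hg
  have hlim : Tendsto (fun t => infDist (g s) Sᶜ * (Real.exp |s - t| - 1))
      (nhdsWithin s (Icc 0 (qhDist S z w))) (nhds 0) := by
    have hc : Continuous fun t => infDist (g s) Sᶜ * (Real.exp |s - t| - 1) := by fun_prop
    simpa [ContinuousWithinAt] using hc.continuousWithinAt (s := Icc 0 (qhDist S z w)) (x := s)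
  rw [ContinuousWithinAt, tendsto_iff_norm_sub_tendsto_zero]
  refine squeeze_zero' (Eventually.of_forall fun _ => norm_nonneg _) ?_ hlim
  filter_upwards [self_mem_nhdsWithin] with t ht
  rw [← hd s hs t ht]
  exact hS.norm_sub_le (hmem s hs) (hmem t ht)

theorem IsGeodesicIn.restrict {α : Type*} {S : Set α} {d : α → α → ℝ} {g : ℝ → α} {z w : α}
    (hg : IsGeodesicIn S d g z w) {s t : ℝ} (hs : s ∈ Icc 0 (d z w)) (ht : t ∈ Icc 0 (d z w))
    (hst : s ≤ t) :
    d (g s) (g t) = t - s ∧ IsGeodesicIn S d (fun r => g (s + r)) (g s) (g t) := by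
  obtain ⟨-, -, hmem, hd⟩ := hg
  have hL : d (g s) (g t) = t - s := by
    rw [hd s hs t ht, abs_sub_comm, abs_of_nonneg (sub_nonneg.2 hst)]
  have hm : ∀ r ∈ Icc 0 (t - s), s + r ∈ Icc 0 (d z w) := fun r hr =>
    ⟨add_nonneg hs.1 hr.1, by linarith [hr.2, ht.2]⟩
  refine ⟨hL, by simp, by simp [hL], ?_, ?_⟩ <;> rw [hL]
  · exact fun r hr => hmem _ (hm r hr)
  · intro r hr r' hr'
    rw [hd _ (hm r hr) _ (hm r' hr'), add_sub_add_left_eq_sub]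

end QuasihyperbolicCurves

section PlaneDomains

open ComplexConjugate

variable {Ω : Set ℂ} {z w : ℂ}

theorem exists_real_qhDist_lt (hΩ : IsC1Domain Ω) (hz : z ∈ Ω) (hw : w ∈ Ω)
    (him : z.im * w.im ≤ 0) {c : ℝ} (hc : qhDist Ω z w < c) :
    ∃ x : ℝ, (x : ℂ) ∈ Ω ∧ qhDist Ω z x < c := by
  obtain ⟨γ, h, hL⟩ := exists_curveLen_lt (hΩ.exists_curve z hz w hw) hc
  have hcont : ContinuousOn (fun t => (γ t).im) (uIcc 0 1) := by
    rw [uIcc_of_le zero_le_one]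
    exact Complex.continuous_im.comp_continuousOn h.continuousOn
  have h0 : (0:ℝ) ∈ uIcc (γ 0).im (γ 1).im := by
    rw [h.source, h.target, mem_uIcc]
    rcases mul_nonpos_iff.1 him with h | h
    · exact Or.inr ⟨h.2, h.1⟩
    · exact Or.inl ⟨h.1, h.2⟩
  obtain ⟨u, hu, hu0⟩ := intermediate_value_uIcc hcont h0
  rw [uIcc_of_le zero_le_one] at hu
  have he : (((γ u).re : ℝ) : ℂ) = γ u := Complex.ext (by simp) (by simpa using hu0.symm)
  exact ⟨(γ u).re, he ▸ h.mem u hu, by rw [he]; exact (h.qhDist_le_curveLen hΩ hu).trans_lt hL⟩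

theorem infDist_compl_conj (hconj : ∀ z, conj z ∈ Ω ↔ z ∈ Ω) (z : ℂ) :
    infDist (conj z) Ωᶜ = infDist z Ωᶜ := by
  have himg : (conj : ℂ → ℂ) '' Ωᶜ = Ωᶜ := by
    ext y
    constructor
    · rintro ⟨x, hx, rfl⟩
      exact fun h => hx ((hconj x).1 h)
    · exact fun hy => ⟨conj y, fun h => hy ((hconj y).1 h), Complex.conj_conj y⟩
  conv_lhs => rw [← himg]
  exact infDist_image Complex.isometry_conj

theorem qhDist_conj_le (hΩ : IsC1Domain Ω) (hconj : ∀ z, conj z ∈ Ω ↔ z ∈ Ω) (hz : z ∈ Ω)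
    (hw : w ∈ Ω) : qhDist Ω (conj z) (conj w) ≤ qhDist Ω z w := by
  refine le_of_forall_gt fun c hc => ?_
  obtain ⟨γ, h, hL⟩ := exists_curveLen_lt (hΩ.exists_curve z hz w hw) hc
  have h' : IsC1Curve Ω (fun t => conj (γ t)) (conj z) (conj w) :=
    ⟨Complex.conjCLE.contDiff.comp_contDiffOn h.contDiffOn, by simp [h.source],
      by simp [h.target], fun t ht => (hconj _).2 (h.mem t ht)⟩
  refine h'.qhDist_le.trans_lt (lt_of_eq_of_lt ?_ hL)
  unfold curveLen
  congr 1
  ext t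
  have hd : deriv (fun t => conj (γ t)) t = conj (deriv γ t) := deriv.star
  rw [hd, qhDensity, infDist_compl_conj hconj, Complex.norm_conj]
  rfl

theorem qhDist_conj (hΩ : IsC1Domain Ω) (hconj : ∀ z, conj z ∈ Ω ↔ z ∈ Ω) (hz : z ∈ Ω)
    (hw : w ∈ Ω) : qhDist Ω (conj z) (conj w) = qhDist Ω z w := by
  refine le_antisymm (qhDist_conj_le hΩ hconj hz hw) ?_
  simpa using qhDist_conj_le hΩ hconj ((hconj z).2 hz) ((hconj w).2 hw)

theorem IsGeodesicIn.conj (hΩ : IsC1Domain Ω) (hconj : ∀ z, conj z ∈ Ω ↔ z ∈ Ω) (hz : z ∈ Ω)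
    (hw : w ∈ Ω) {g : ℝ → ℂ} (hg : IsGeodesicIn Ω (qhDist Ω) g z w) :
    IsGeodesicIn Ω (qhDist Ω) (fun t => conj (g t)) (conj z) (conj w) := by
  obtain ⟨h0, h1, hmem, hd⟩ := hg
  have hL := qhDist_conj hΩ hconj hz hw
  refine ⟨by simp [h0], by simp [hL, h1], ?_, ?_⟩ <;> rw [hL]
  · exact fun t ht => (hconj _).2 (hmem t ht)
  · intro s hs t ht
    rw [qhDist_conj hΩ hconj (hmem s hs) (hmem t ht), hd s hs t ht]

/-- If a geodesic between two points of the real axis that stays in one closed half plane contains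
a point far away from `Ω ∩ ℝ`, then the triangle formed by it and its mirror image is not thin. -/
theorem exists_real_near_of_isGromovHyperbolic (hΩ : IsC1Domain Ω)
    (hconj : ∀ z, conj z ∈ Ω ↔ z ∈ Ω) {D : ℝ} (hD : GromovHyperbolicWith Ω (qhDist Ω) D)
    (hz : z ∈ Ω) (hw : w ∈ Ω) (hzr : z.im = 0) (hwr : w.im = 0) {g : ℝ → ℂ}
    (hg : IsGeodesicIn Ω (qhDist Ω) g z w)
    (hside : ∀ s ∈ Icc 0 (qhDist Ω z w), ∀ t ∈ Icc 0 (qhDist Ω z w), 0 ≤ (g s).im * (g t).im)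
    {t : ℝ} (ht : t ∈ Icc 0 (qhDist Ω z w)) {c : ℝ} (hc : D < c) :
    ∃ x : ℝ, (x : ℂ) ∈ Ω ∧ qhDist Ω (g t) x < c := by
  have hself : qhDist Ω z z = 0 := qhDist_self hz
  have hconst : IsGeodesicIn Ω (qhDist Ω) (fun _ => z) z z := by
    refine ⟨rfl, rfl, fun _ _ => hz, fun s hs t ht => ?_⟩
    rw [hself] at hs ht ⊢
    rw [le_antisymm hs.2 hs.1, le_antisymm ht.2 ht.1]
    simp
  have hg' := hg.conj hΩ hconj hz hw
  rw [Complex.conj_eq_iff_im.2 hzr, Complex.conj_eq_iff_im.2 hwr] at hg'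
  have hgt := hg.2.2.1 t ht
  obtain ⟨p, hp, hdp⟩ := hD z hz w hw z hz _ _ _ hg hconst hg' t ht
  have hpΩ : p ∈ Ω ∧ (g t).im * p.im ≤ 0 := by
    rcases hp with ⟨s, -, rfl⟩ | ⟨s, hs, rfl⟩
    · exact ⟨hz, by simp [hzr]⟩
    · refine ⟨hg'.2.2.1 s hs, ?_⟩
      simpa using hside t ht s hs
  exact exists_real_qhDist_lt hΩ hgt hpΩ.1 hpΩ.2 (hdp.trans_lt hc)

theorem exists_point_of_isGromovHyperbolic (hΩ : IsC1Domain Ω)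
    (hconj : ∀ z, conj z ∈ Ω ↔ z ∈ Ω) (h0 : (0:ℂ) ∉ Ω) {D : ℝ}
    (hD : GromovHyperbolicWith Ω (qhDist Ω) D) {p q κ : ℝ} (hp : (p:ℂ) ∈ Ω) (hq : (q:ℂ) ∈ Ω)
    (hp0 : 0 < p) (hq0 : q < 0) (hκ : 0 < κ) {c : ℝ} (hc : D < c) :
    ∃ z ∈ Ω, |z.im| = κ * z.re ∧ qhDist Ω p z + qhDist Ω z q = qhDist Ω p q ∧
      ∃ x : ℝ, (x : ℂ) ∈ Ω ∧ qhDist Ω z x < c := by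
  obtain ⟨g, hg⟩ := hΩ.exists_isGeodesicIn hp hq
  have hgc := hg.continuousOn hΩ
  obtain ⟨hg0, hg1, hmem, hd⟩ := id hg
  set L := qhDist Ω p q with hL
  have hL0 : 0 ≤ L := qhDist_nonneg _ _ _
  have hre : ContinuousOn (fun t => (g t).re) (Icc 0 L) :=
    Complex.continuous_re.comp_continuousOn hgc
  have him : ContinuousOn (fun t => (g t).im) (Icc 0 L) :=
    Complex.continuous_im.comp_continuousOn hgc
  have hne : ∀ t ∈ Icc 0 L, (g t).im = 0 → (g t).re ≠ 0 := fun t ht h1 h2 =>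
    h0 ((Complex.ext h2 h1 : g t = 0) ▸ hmem t ht)
  have hTc : IsCompact (Icc 0 L ∩ (fun t => ((g t).im, (g t).re)) ⁻¹' ({0} ×ˢ Ici 0)) :=
    isCompact_Icc.of_isClosed_subset ((him.prodMk hre).preimage_isClosed_of_isClosed
      isClosed_Icc (isClosed_singleton.prod isClosed_Ici)) inter_subset_left
  obtain ⟨τ₀, ⟨hτ₀, hτ₀'⟩, hmax⟩ := hTc.exists_isGreatest
    ⟨0, ⟨le_rfl, hL0⟩, by simp [hg0, hp0.le]⟩
  obtain ⟨him₀, hre₀⟩ : (g τ₀).im = 0 ∧ 0 ≤ (g τ₀).re := by simpa using hτ₀'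
  have hre₀' := lt_of_le_of_ne hre₀ (hne τ₀ hτ₀ him₀).symm
  have hsub₀ : Icc τ₀ L ⊆ Icc 0 L := Icc_subset_Icc_left hτ₀.1
  have hTc' : IsCompact (Icc τ₀ L ∩ (fun t => ((g t).im, (g t).re)) ⁻¹' ({0} ×ˢ Iic 0)) :=
    isCompact_Icc.of_isClosed_subset (((him.prodMk hre).mono hsub₀).preimage_isClosed_of_isClosed
      isClosed_Icc (isClosed_singleton.prod isClosed_Iic)) inter_subset_left
  obtain ⟨τ₁, ⟨hτ₁, hτ₁'⟩, hmin⟩ := hTc'.exists_isLeast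
    ⟨L, ⟨hτ₀.2, le_rfl⟩, by simp [hg1, hq0.le]⟩
  obtain ⟨him₁, hre₁⟩ : (g τ₁).im = 0 ∧ (g τ₁).re ≤ 0 := by simpa using hτ₁'
  have hre₁' := lt_of_le_of_ne hre₁ (hne τ₁ (hsub₀ hτ₁) him₁)
  have hsub : Icc τ₀ τ₁ ⊆ Icc 0 L := Icc_subset_Icc hτ₀.1 hτ₁.2
  have hIoo : ∀ t ∈ Ioo τ₀ τ₁, (g t).im ≠ 0 := fun t ht h => by
    have ht' := hsub ⟨ht.1.le, ht.2.le⟩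
    rcases le_total 0 (g t).re with h' | h'
    · exact absurd (hmax ⟨ht', by simp [h, h']⟩) (not_le.2 ht.1)
    · exact absurd (hmin ⟨⟨ht.1.le, ht'.2⟩, by simp [h, h']⟩) (not_le.2 ht.2)
  have hside : ∀ s ∈ Icc τ₀ τ₁, ∀ t ∈ Icc τ₀ τ₁, 0 ≤ (g s).im * (g t).im := by
    intro s hs t ht
    by_contra! hneg
    have hend : ∀ r ∈ Icc τ₀ τ₁, (g r).im ≠ 0 → r ∈ Ioo τ₀ τ₁ := fun r hr h =>
      ⟨lt_of_le_of_ne hr.1 (by rintro rfl; exact h him₀),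
        lt_of_le_of_ne hr.2 (by rintro rfl; exact h him₁)⟩
    have hs' := hend s hs fun h => by simp [h] at hneg
    have ht' := hend t ht fun h => by simp [h] at hneg
    have hst : uIcc s t ⊆ Ioo τ₀ τ₁ := (ordConnected_Ioo).uIcc_subset hs' ht'
    have h00 : (0:ℝ) ∈ uIcc (g s).im (g t).im := by
      rw [mem_uIcc]
      rcases mul_neg_iff.1 hneg with h | h
      · exact Or.inr ⟨h.2.le, h.1.le⟩
      · exact Or.inl ⟨h.1.le, h.2.le⟩
    obtain ⟨r, hr, hr0⟩ := intermediate_value_uIcc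
      (him.mono ((hst.trans Ioo_subset_Icc_self).trans hsub)) h00
    exact hIoo r (hst hr) hr0
  have hφ : ContinuousOn (fun t => |(g t).im| - κ * (g t).re) (Icc τ₀ τ₁) :=
    (him.abs.sub (continuousOn_const.mul hre)).mono hsub
  obtain ⟨τ, hτ, hτ0⟩ := intermediate_value_Icc hτ₁.1 hφ (show (0:ℝ) ∈ _ by
    constructor
    · simp only [him₀, abs_zero]; nlinarith
    · simp only [him₁, abs_zero]; nlinarith)
  have hτL := hsub hτ
  obtain ⟨hlen, hrestr⟩ := hg.restrict hτ₀ (hsub₀ hτ₁) hτ₁.1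
  refine ⟨g τ, hmem τ hτL, by linarith [show |(g τ).im| - κ * (g τ).re = 0 from hτ0], ?_, ?_⟩
  · have h1 := hd 0 ⟨le_rfl, hL0⟩ τ hτL
    have h2 := hd τ hτL L ⟨hL0, le_rfl⟩
    rw [hg0, zero_sub, abs_neg, abs_of_nonneg hτL.1] at h1
    rw [hg1, abs_sub_comm, abs_of_nonneg (sub_nonneg.2 hτL.2)] at h2
    rw [h1, h2]; ring
  · have hs : ∀ r ∈ Icc 0 (τ₁ - τ₀), τ₀ + r ∈ Icc τ₀ τ₁ := fun r hr =>
      ⟨by linarith [hr.1], by linarith [hr.2]⟩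
    have := exists_real_near_of_isGromovHyperbolic hΩ hconj hD (hmem _ hτ₀) (hmem _ (hsub₀ hτ₁))
      him₀ him₁ hrestr (by
        rw [hlen]; exact fun s hs' t ht' => hside _ (hs s hs') _ (hs t ht')) (t := τ - τ₀) (by
        rw [hlen]; exact ⟨by linarith [hτ.1], by linarith [hτ.2]⟩) hc
    simpa using this

end PlaneDomains

section DenjoyDomains

variable {Ω : Set ℂ} {a b : ℕ → ℝ} {z w : ℂ}

open ComplexConjugate

theorem IsDenjoyDomain.mem_of_im_ne_zero (hΩ : IsDenjoyDomain Ω) {x : ℝ} (hx : (x : ℂ) ∈ Ω)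
    (hz : z.im ≠ 0) : z ∈ Ω := by
  obtain ⟨ho, -, hf⟩ := hΩ
  obtain ⟨ε, hε, hball⟩ := Metric.isOpen_iff.1 ho x hx
  have hnear : ∀ s : ℝ, |s| < ε → (x + s * I : ℂ) ∈ Ω := fun s hs => hball (by
    simpa [dist_eq_norm] using hs)
  have hhalf : ∀ H : Set ℂ, IsPreconnected H → (∀ y ∈ H, y.im ≠ 0) → (H ∩ Ω).Nonempty →
      H ⊆ Ω := fun H hH him hne => by
    refine hH.subset_of_closure_inter_subset ho hne ?_
    rintro y ⟨hy, hyH⟩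
    by_contra hyΩ
    exact him y hyH (hf ⟨hy, by rwa [ho.interior_eq]⟩)
  rcases lt_or_gt_of_ne hz with h | h
  · refine hhalf {y | y.im < 0} (convex_halfSpace_im_lt 0).isPreconnected
      (fun y hy => ne_of_lt hy) ⟨x + (-(ε / 2) : ℝ) * I, ?_, hnear _ ?_⟩ h
    · simpa using hε
    · rw [abs_neg, abs_of_pos (half_pos hε)]; exact half_lt_self hε
  · refine hhalf {y | 0 < y.im} (convex_halfSpace_im_gt 0).isPreconnected
      (fun y hy => ne_of_gt hy) ⟨x + (ε / 2 : ℝ) * I, ?_, hnear _ ?_⟩ h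
    · simpa using hε
    · rw [abs_of_pos (half_pos hε)]; exact half_lt_self hε

/-- `Ω` is the plane slit along `[0, ∞)`, with the gaps `(a n, b n)` of the slit put back. -/
structure IsGappedSlitPlane (Ω : Set ℂ) (a b : ℕ → ℝ) : Prop where
  isOpen : IsOpen Ω
  mem_iff : ∀ z, z ∈ Ω ↔ z.im ≠ 0 ∨ z.re < 0 ∨ ∃ n, z.re ∈ Ioo (a n) (b n)
  pos : ∀ n, 0 < a n
  lt : ∀ n, a n < b n
  le_succ : ∀ n, b n ≤ a (n + 1)

theorem IsDenjoyDomain.isGappedSlitPlane (hΩ : IsDenjoyDomain Ω) (hapos : ∀ n, 0 < a n)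
    (hab : ∀ n, a n < b n) (hba : ∀ n, b n ≤ a (n + 1))
    (hre : (fun x : ℝ => (x : ℂ)) ⁻¹' Ω = Iio 0 ∪ ⋃ n, Ioo (a n) (b n)) :
    IsGappedSlitPlane Ω a b := by
  have hr : ∀ x : ℝ, (x : ℂ) ∈ Ω ↔ x < 0 ∨ ∃ n, x ∈ Ioo (a n) (b n) := fun x => by
    have := Set.ext_iff.1 hre x
    simpa using this
  refine ⟨hΩ.1, fun z => ?_, hapos, hab, hba⟩
  by_cases hz : z.im = 0
  · have he : ((z.re : ℝ) : ℂ) = z := Complex.ext (by simp) (by simp [hz])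
    rw [← hr, he]
    simp [hz]
  · simp only [hz, ne_eq, not_false_eq_true, true_or, iff_true]
    exact hΩ.mem_of_im_ne_zero ((hr (-1)).2 (Or.inl (by norm_num))) hz

namespace IsGappedSlitPlane

theorem conj_mem (h : IsGappedSlitPlane Ω a b) (z : ℂ) : conj z ∈ Ω ↔ z ∈ Ω := by
  simp [h.mem_iff]

theorem ofReal_mem (h : IsGappedSlitPlane Ω a b) {x : ℝ} :
    (x : ℂ) ∈ Ω ↔ x < 0 ∨ ∃ n, x ∈ Ioo (a n) (b n) := by
  simp [h.mem_iff]

theorem zero_notMem (h : IsGappedSlitPlane Ω a b) : (0 : ℂ) ∉ Ω := by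
  simp only [h.mem_iff, Complex.zero_im, ne_eq, not_true_eq_false, Complex.zero_re, lt_self_iff_false,
    false_or, not_exists]
  exact fun n hn => (h.pos n).not_gt hn.1

theorem strictMono (h : IsGappedSlitPlane Ω a b) : StrictMono a :=
  strictMono_nat_of_lt_succ fun n => (h.lt n).trans_le (h.le_succ n)

theorem le_left_of_lt (h : IsGappedSlitPlane Ω a b) {m n : ℕ} (hmn : m < n) : b m ≤ a n :=
  (h.le_succ m).trans (h.strictMono.monotone hmn)

theorem left_notMem (h : IsGappedSlitPlane Ω a b) (n : ℕ) : ((a n : ℝ) : ℂ) ∉ Ω := by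
  rw [h.ofReal_mem]
  rintro (h1 | ⟨m, h1, h2⟩)
  · exact (h.pos n).not_gt h1
  · exact (h.le_left_of_lt (h.strictMono.lt_iff_lt.1 h1)).not_gt h2

theorem isC1Domain (h : IsGappedSlitPlane Ω a b) : IsC1Domain Ω := by
  refine ⟨h.isOpen, ⟨0, h.zero_notMem⟩, ?_⟩
  have hslit : ∀ z : ℂ, z.im ≠ 0 ∨ z.re < 0 → ∃ γ, IsC1Curve Ω γ z (-1) := fun z hz => by
    refine ⟨_, .segment fun t ht => (h.mem_iff _).2 ?_⟩
    have e1 : (z + t • (-1 - z)).im = (1 - t) * z.im := by simp; ring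
    have e2 : (z + t • (-1 - z)).re = (1 - t) * z.re - t := by simp; ring
    rw [e1, e2]
    rcases ht.2.eq_or_lt with rfl | ht1
    · right; left; norm_num
    · rcases hz with hz | hz
      · left; exact mul_ne_zero (sub_pos.2 ht1).ne' hz
      · right; left
        have := mul_neg_of_pos_of_neg (sub_pos.2 ht1) hz
        linarith [ht.1]
  have hcont : ContinuousOn (qhDensity Ω) Ω :=
    (continuous_infDist_pt _).continuousOn.inv₀ fun x hx =>
      ((h.isOpen.isClosed_compl.notMem_iff_infDist_pos ⟨0, h.zero_notMem⟩).1
        (by simpa using hx)).ne'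
  have hall : ∀ z ∈ Ω, ∃ γ, IsC1Curve Ω γ z (-1) := fun z hz => by
    by_cases hz' : z.im ≠ 0 ∨ z.re < 0
    · exact hslit z hz'
    · push Not at hz'
      have h1 : IsC1Curve Ω (fun t : ℝ => z + t • ((z + I) - z)) z (z + I) :=
        .segment fun t ht => by
          rw [h.mem_iff]
          rcases ht.1.eq_or_lt with rfl | ht0
          · simpa using (h.mem_iff z).1 hz
          · left; simp [hz'.1, ht0.ne']
      obtain ⟨γ, h2⟩ := hslit (z + I) (Or.inl (by simp [hz'.1]))
      obtain ⟨γ', h3, -⟩ := h1.trans h2 hcont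
      exact ⟨γ', h3⟩
  intro z hz w hw
  obtain ⟨γ₁, h₁⟩ := hall z hz
  obtain ⟨γ₂, h₂⟩ := hall w hw
  obtain ⟨γ₃, h₃⟩ := h₂.symm
  obtain ⟨γ, h4, -⟩ := h₁.trans h₃ hcont
  exact ⟨γ, h4⟩

theorem compl_nonempty (h : IsGappedSlitPlane Ω a b) : Ωᶜ.Nonempty := ⟨0, h.zero_notMem⟩

theorem of_notMem (h : IsGappedSlitPlane Ω a b) (hz : z ∉ Ω) :
    z.im = 0 ∧ 0 ≤ z.re ∧ ∀ n, z.re ≤ a n ∨ b n ≤ z.re := by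
  rw [h.mem_iff] at hz
  push Not at hz
  refine ⟨hz.1, hz.2.1, fun n => ?_⟩
  by_contra! hn
  exact hz.2.2 n hn

theorem abs_im_le_infDist (h : IsGappedSlitPlane Ω a b) (z : ℂ) : |z.im| ≤ infDist z Ωᶜ := by
  refine (le_infDist h.compl_nonempty).2 fun y hy => ?_
  rw [dist_eq_norm]
  simpa [(h.of_notMem hy).1] using Complex.abs_im_le_norm (z - y)

theorem neg_re_le_infDist (h : IsGappedSlitPlane Ω a b) (z : ℂ) : -z.re ≤ infDist z Ωᶜ := by
  refine (le_infDist h.compl_nonempty).2 fun y hy => ?_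
  rw [dist_eq_norm]
  have h1 := Complex.abs_re_le_norm (z - y)
  have h2 := neg_abs_le (z - y).re
  have h3 := (h.of_notMem hy).2.1
  simp only [Complex.sub_re] at h1 h2
  linarith

theorem infDist_le_norm (h : IsGappedSlitPlane Ω a b) (z : ℂ) : infDist z Ωᶜ ≤ ‖z‖ := by
  simpa using infDist_le_dist_of_mem (x := z) (show (0:ℂ) ∈ Ωᶜ from h.zero_notMem)

theorem infDist_midpoint_le (h : IsGappedSlitPlane Ω a b) (n : ℕ) :
    infDist (((a n + b n) / 2 : ℝ) : ℂ) Ωᶜ ≤ (b n - a n) / 2 := by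
  refine (infDist_le_dist_of_mem (show ((a n : ℝ) : ℂ) ∈ Ωᶜ from h.left_notMem n)).trans ?_
  rw [dist_eq_norm, ← Complex.ofReal_sub, Complex.norm_real, Real.norm_of_nonneg] <;>
    linarith [h.lt n]

theorem sqrt_le_infDist (h : IsGappedSlitPlane Ω a b) (n : ℕ) (s : ℝ) :
    √(((b n - a n) / 2) ^ 2 + s ^ 2) ≤ infDist (((a n + b n) / 2 : ℝ) + s * I : ℂ) Ωᶜ := by
  refine (le_infDist h.compl_nonempty).2 fun y hy => ?_
  obtain ⟨h1, -, h2⟩ := h.of_notMem hy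
  rw [dist_eq_norm, Complex.norm_eq_sqrt_sq_add_sq]
  have hn := h.lt n
  refine Real.sqrt_le_sqrt ?_
  simp only [Complex.sub_re, Complex.add_re, Complex.ofReal_re, Complex.mul_re, Complex.I_re,
    mul_zero, Complex.ofReal_im, Complex.I_im, mul_one, sub_zero, add_zero, Complex.sub_im,
    Complex.add_im, Complex.mul_im, zero_add, h1, sub_self]
  rcases h2 n with h2 | h2 <;> nlinarith

theorem exists_infDist_le (h : IsGappedSlitPlane Ω a b)
    (hlim0 : Tendsto (fun n => (b n - a n) / a n) atTop (nhds 0)) {η : ℝ} (hη : 0 < η) :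
    ∃ C, 0 ≤ C ∧ ∀ x : ℝ, 0 ≤ x → infDist (x : ℂ) Ωᶜ ≤ η * x + C := by
  obtain ⟨N, hN⟩ := eventually_atTop.1 (hlim0.eventually (gt_mem_nhds hη))
  refine ⟨a N, (h.pos N).le, fun x hx => ?_⟩
  have hηx := mul_nonneg hη.le hx
  have hN0 := h.pos N
  by_cases hxΩ : (x : ℂ) ∈ Ω
  · rcases h.ofReal_mem.1 hxΩ with hx' | ⟨n, hn⟩
    · exact absurd hx' (not_lt.2 hx)
    · rcases lt_or_ge n N with hnN | hnN
      · have h1 := h.infDist_le_norm (x : ℂ)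
        rw [Complex.norm_real, Real.norm_of_nonneg hx] at h1
        linarith [hn.2, h.le_left_of_lt hnN]
      · have h1 := infDist_le_dist_of_mem (x := (x:ℂ))
          (show ((a n : ℝ) : ℂ) ∈ Ωᶜ from h.left_notMem n)
        rw [dist_eq_norm, ← Complex.ofReal_sub, Complex.norm_real,
          Real.norm_of_nonneg (by linarith [hn.1])] at h1
        have h2 := (div_lt_iff₀ (h.pos n)).1 (hN n hnN)
        have h3 : η * a n ≤ η * x := mul_le_mul_of_nonneg_left hn.1.le hη.le
        linarith [hn.2]
  · rw [infDist_zero_of_mem (show (x:ℂ) ∈ Ωᶜ from hxΩ)]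
    linarith

theorem exp_qhDist_le (h : IsGappedSlitPlane Ω a b) (n : ℕ) :
    Real.exp (qhDist Ω (((a n + b n) / 2 : ℝ) : ℂ) ((-((a n + b n) / 2) : ℝ) : ℂ)) ≤
      3 * (((a n + b n) / 2) / ((b n - a n) / 2)) * Real.exp 12 := by
  set p := (a n + b n) / 2 with hp
  set δ := (b n - a n) / 2 with hδ
  have hpos := h.pos n
  have hlt := h.lt n
  have hδ0 : 0 < δ := by rw [hδ]; linarith
  have hδp : δ ≤ p := by rw [hδ, hp]; linarith
  have hp0 : 0 < p := hδ0.trans_le hδp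
  have hu : 1 ≤ p / δ := (one_le_div hδ0).2 hδp
  have hC1 := h.isC1Domain
  have hvert : ∀ s : ℝ, (p + s * I : ℂ) ∈ Ω := fun s => by
    refine mem_of_infDist_compl_pos (lt_of_lt_of_le ?_ (h.sqrt_le_infDist n s))
    exact Real.sqrt_pos.2 (by positivity)
  have hmid : (p : ℂ) ∈ Ω := by simpa using hvert 0
  have hneg : ((-p : ℝ) : ℂ) ∈ Ω := h.ofReal_mem.2 (Or.inl (by linarith))
  have hup : qhDist Ω p (p + p * I) ≤ Real.arsinh (p / δ) := by
    have hcurve : IsC1Curve Ω (fun t : ℝ => (p : ℂ) + t • (p * I)) p (p + p * I) := by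
      have := IsC1Curve.segment (S := Ω) (z := (p:ℂ)) (w := p + p * I) fun t _ => by
        have := hvert (t * p)
        simpa [mul_assoc] using this
      simpa using this
    refine hcurve.qhDist_le.trans ?_
    have hd : ∀ t, deriv (fun t : ℝ => (p : ℂ) + t • (p * I)) t = p * I := fun t => by
      have := (((hasDerivAt_id t).smul_const (p * I : ℂ)).const_add (p:ℂ)).deriv
      simpa using this
    have hder : ∀ t, HasDerivAt (fun t : ℝ => Real.arsinh (p / δ * t))
        ((√(1 + (p / δ * t) ^ 2))⁻¹ * (p / δ)) t := fun t => by
      have := ((hasDerivAt_id t).const_mul (p / δ)).arsinh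
      simpa using this
    have hcont : Continuous fun t : ℝ => (√(1 + (p / δ * t) ^ 2))⁻¹ * (p / δ) := by
      refine (Continuous.inv₀ (by fun_prop) fun t => ?_).mul continuous_const
      exact (Real.sqrt_pos.2 (by positivity)).ne'
    have hintegral := intervalIntegral.integral_eq_sub_of_hasDerivAt (a := 0) (b := 1)
      (fun t _ => hder t) (hcont.intervalIntegrable 0 1)
    have hval : Real.arsinh (p / δ) = ∫ t in (0:ℝ)..1, (√(1 + (p / δ * t) ^ 2))⁻¹ * (p / δ) := by
      rw [hintegral]; simp
    rw [hval]
    refine intervalIntegral.integral_mono_on zero_le_one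
      (hcurve.intervalIntegrable hC1.continuousOn_qhDensity)
      (hcont.intervalIntegrable 0 1) fun t _ => ?_
    have hs : √(δ ^ 2 + (t * p) ^ 2) = δ * √(1 + (p / δ * t) ^ 2) := by
      rw [show δ ^ 2 + (t * p) ^ 2 = δ ^ 2 * (1 + (p / δ * t) ^ 2) by field_simp,
        Real.sqrt_mul (by positivity), Real.sqrt_sq hδ0.le]
    have hle := h.sqrt_le_infDist n (t * p)
    rw [← hδ, hs] at hle
    have hnorm : ‖(p * I : ℂ)‖ = p := by simp [abs_of_pos hp0]
    have hpt : ((p : ℂ) + t • (p * I)) = (((a n + b n) / 2 : ℝ) : ℂ) + ((t * p : ℝ) : ℂ) * I := by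
      rw [← hp, Complex.real_smul]; push_cast; ring
    rw [hd, hnorm, qhDensity]
    beta_reduce
    rw [hpt]
    have hsp : 0 < √(1 + (p / δ * t) ^ 2) := Real.sqrt_pos.2 (by positivity)
    calc (infDist _ Ωᶜ)⁻¹ * p ≤ (δ * √(1 + (p / δ * t) ^ 2))⁻¹ * p := by gcongr
      _ = _ := by field_simp
  have hacross : qhDist Ω (p + p * I) ((-p : ℝ) : ℂ) ≤ 12 := by
    refine (qhDist_le_of_segment (m := p / 4) (by positivity) fun t ht => ?_).trans ?_
    · set y : ℂ := p + p * I + t • (((-p : ℝ) : ℂ) - (p + p * I)) with hy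
      have e1 : y.im = (1 - t) * p := by rw [hy]; simp; ring
      have e2 : y.re = (1 - 2 * t) * p := by rw [hy]; simp; ring
      rcases le_total t (3 / 4) with ht' | ht'
      · refine le_trans ?_ (h.abs_im_le_infDist y)
        rw [e1]
        exact le_trans (by nlinarith) (le_abs_self _)
      · refine le_trans ?_ (h.neg_re_le_infDist y)
        rw [e2]
        nlinarith
    · rw [div_le_iff₀ (by positivity)]
      have h1 : ((-p : ℝ) : ℂ) - (p + p * I) = ((-2 * p : ℝ) : ℂ) + ((-p : ℝ) : ℂ) * I := by
        push_cast; ring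
      rw [h1]
      refine (norm_add_le _ _).trans ?_
      rw [norm_mul, Complex.norm_I, Complex.norm_real, Complex.norm_real, Real.norm_eq_abs,
        Real.norm_eq_abs, abs_neg, abs_mul, abs_of_pos hp0]
      norm_num
      linarith
  have hpp : (p + p * I : ℂ) ∈ Ω := hvert p
  have htri := hC1.qhDist_triangle hmid hpp hneg
  calc _ ≤ Real.exp (Real.arsinh (p / δ) + 12) := Real.exp_le_exp.2 (by linarith)
    _ = (p / δ + √(1 + (p / δ) ^ 2)) * Real.exp 12 := by rw [Real.exp_add, Real.exp_arsinh]
    _ ≤ _ := by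
      have hs : √(1 + (p / δ) ^ 2) ≤ 2 * (p / δ) := by
        rw [Real.sqrt_le_left (by positivity)]
        nlinarith
      gcongr
      linarith

/-- A geodesic from a gap to its mirror image in the origin stays away from the origin. -/
theorem le_norm_of_qhDist_add_eq (h : IsGappedSlitPlane Ω a b) (n : ℕ) (hz : z ∈ Ω)
    (hd : qhDist Ω (((a n + b n) / 2 : ℝ) : ℂ) z +
      qhDist Ω z ((-((a n + b n) / 2) : ℝ) : ℂ) =
      qhDist Ω (((a n + b n) / 2 : ℝ) : ℂ) ((-((a n + b n) / 2) : ℝ) : ℂ)) :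
    (a n + b n) / 2 ≤ 6 * Real.exp 12 * ‖z‖ := by
  have hexp := h.exp_qhDist_le n
  have hmid := h.infDist_midpoint_le n
  rw [← hd, Real.exp_add] at hexp
  have hpos := h.pos n
  have hlt := h.lt n
  have hmem : (((a n + b n) / 2 : ℝ) : ℂ) ∈ Ω :=
    h.ofReal_mem.2 (Or.inr ⟨n, by constructor <;> linarith⟩)
  have hneg : ((-((a n + b n) / 2) : ℝ) : ℂ) ∈ Ω := h.ofReal_mem.2 (Or.inl (by linarith))
  have hC1 := h.isC1Domain
  have h1 := hC1.norm_sub_le hmem hz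
  have h2 := hC1.infDist_le hz hneg
  have h3 := h.neg_re_le_infDist ((-((a n + b n) / 2) : ℝ) : ℂ)
  have h4 := h.infDist_le_norm z
  have hδ0 : 0 < (b n - a n) / 2 := by linarith
  have hp0 : 0 < (a n + b n) / 2 := by linarith
  have hnp : ‖(((a n + b n) / 2 : ℝ) : ℂ)‖ = (a n + b n) / 2 := by
    rw [Complex.norm_real, Real.norm_of_nonneg hp0.le]
  have h5 := norm_sub_norm_le (((a n + b n) / 2 : ℝ) : ℂ) z
  rw [hnp, norm_sub_rev] at h5
  set p := (a n + b n) / 2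
  set δ := (b n - a n) / 2
  set d₁ := qhDist Ω (p : ℂ) z
  set d₂ := qhDist Ω z ((-p : ℝ) : ℂ)
  have he12 : (1:ℝ) ≤ Real.exp 12 := Real.one_le_exp (by norm_num)
  rcases le_total (p / 2) ‖z‖ with hzp | hzp
  · nlinarith [norm_nonneg z]
  · have h6 : p / 2 ≤ δ * Real.exp d₁ := by
      have : infDist (p : ℂ) Ωᶜ * (Real.exp d₁ - 1) ≤ δ * (Real.exp d₁ - 1) :=
        mul_le_mul_of_nonneg_right hmid (by
          have := Real.one_le_exp (qhDist_nonneg Ω (p:ℂ) z); linarith)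
      linarith
    have h7 : p ≤ ‖z‖ * Real.exp d₂ := by
      have h8 : infDist z Ωᶜ * Real.exp d₂ ≤ ‖z‖ * Real.exp d₂ :=
        mul_le_mul_of_nonneg_right h4 (Real.exp_pos _).le
      simp only [Complex.ofReal_re, neg_neg] at h3
      linarith
    have h9 : p / 2 * p ≤ (δ * Real.exp d₁) * (‖z‖ * Real.exp d₂) :=
      mul_le_mul h6 h7 hp0.le (by positivity)
    have h10 : δ * ‖z‖ * (Real.exp d₁ * Real.exp d₂) ≤
        δ * ‖z‖ * (3 * (p / δ) * Real.exp 12) :=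
      mul_le_mul_of_nonneg_left hexp (by positivity)
    have h11 : δ * ‖z‖ * (3 * (p / δ) * Real.exp 12) = p * (3 * Real.exp 12 * ‖z‖) := by
      field_simp
    have h12 : p * (p / 2) ≤ p * (3 * Real.exp 12 * ‖z‖) := by linarith
    have := le_of_mul_le_mul_left h12 hp0
    linarith

/-- In a thin sector along the slit, points far away from the origin are far away from the real
points of the domain. -/
theorem re_le_of_qhDist_lt (h : IsGappedSlitPlane Ω a b) {κ C D : ℝ} (hκ : 0 < κ)
    (hκD : 4 * κ * Real.exp D = 1) (hC0 : 0 ≤ C) (hD : 0 ≤ D)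
    (hC : ∀ x : ℝ, 0 ≤ x → infDist (x : ℂ) Ωᶜ ≤ κ ^ 2 * x + C) (hz : z ∈ Ω)
    (hzim : |z.im| = κ * z.re) {x : ℝ} (hx : (x : ℂ) ∈ Ω) (hd : qhDist Ω z x < D) :
    z.re ≤ 2 * Real.exp D * C / κ := by
  have hC1 := h.isC1Domain
  have hre : 0 ≤ z.re := by
    have := abs_nonneg z.im
    rw [hzim] at this
    exact nonneg_of_mul_nonneg_right this hκ
  set M := Real.exp D with hM
  have hM1 : 1 ≤ M := Real.one_le_exp hD
  have hκ1 : κ ≤ 1 / 4 := by nlinarith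
  have hexp : ∀ d < D, ∀ r : ℝ, 0 ≤ r → r * (Real.exp d - 1) ≤ M * r := fun d hd r hr => by
    have : Real.exp d ≤ M := Real.exp_le_exp.2 hd.le
    nlinarith
  have him := Complex.abs_im_le_norm (z - x)
  have hrel := Complex.abs_re_le_norm (z - x)
  simp only [Complex.sub_im, Complex.ofReal_im, sub_zero, Complex.sub_re, Complex.ofReal_re]
    at him hrel
  rw [hzim] at him
  rw [le_div_iff₀ hκ]
  have hMC : 0 ≤ M * C := by positivity
  rcases lt_or_ge x 0 with hx0 | hx0
  · have h1 := (hC1.norm_sub_le hz hx).trans (hexp _ hd _ infDist_nonneg)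
    rw [norm_sub_rev] at h1
    have h2 := infDist_le_infDist_add_dist (s := Ωᶜ) (x := z) (y := (z.re : ℂ))
    have h3 : dist z (z.re : ℂ) = κ * z.re := by
      rw [dist_eq_norm, ← hzim]
      have : z - (z.re : ℂ) = z.im * I := by
        apply Complex.ext <;> simp
      rw [this]; simp
    rw [h3] at h2
    have h4 := hC z.re hre
    have h5 := (le_abs_self (z.re - x)).trans hrel
    have h6 : M * infDist z Ωᶜ ≤ M * (κ ^ 2 * z.re + C + κ * z.re) := by gcongr; linarith
    have h7 : M * (κ ^ 2 * z.re + C + κ * z.re) = (1 / 4) * (κ * z.re + z.re) + M * C := by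
      linear_combination (1 / 4) * (κ * z.re + z.re) * hκD
    nlinarith
  · have h1 := hC1.norm_sub_le hx hz
    rw [hC1.qhDist_comm hx hz] at h1
    replace h1 := h1.trans (hexp _ hd _ infDist_nonneg)
    have h4 := hC x hx0
    have h5 := (neg_le_abs (z.re - x)).trans hrel
    have h6 : M * infDist (x:ℂ) Ωᶜ ≤ M * (κ ^ 2 * (z.re + ‖z - x‖) + C) := by
      gcongr
      refine h4.trans ?_
      gcongr
      linarith
    have h7 : M * (κ ^ 2 * (z.re + ‖z - x‖) + C) = κ / 4 * (z.re + ‖z - x‖) + M * C := by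
      linear_combination (κ / 4) * (z.re + ‖z - x‖) * hκD
    nlinarith [norm_nonneg (z - x)]

end IsGappedSlitPlane

end DenjoyDomains

noncomputable section

/-- Theorem 1.1(2), quasihyperbolic case: if `lim (bₙ - aₙ)/aₙ = 0` then `(Ω, k_Ω)` is not
Gromov hyperbolic. -/
theorem denjoy_qh_not_hyperbolic_of_lim_zero
    (Ω : Set ℂ) (a b : ℕ → ℝ)
    (hΩ : IsDenjoyDomain Ω)
    (hapos : ∀ n, 0 < a n)
    (hab : ∀ n, a n < b n)
    (hba : ∀ n, b n ≤ a (n + 1))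
    (hlim : Filter.Tendsto a Filter.atTop Filter.atTop)
    (hre : (fun x : ℝ => (x : ℂ)) ⁻¹' Ω = Iio 0 ∪ ⋃ n, Ioo (a n) (b n))
    (hlim0 : Filter.Tendsto (fun n => (b n - a n) / a n) Filter.atTop (nhds 0)) :
    ¬ IsGromovHyperbolic Ω (qhDist Ω) := by
  rintro ⟨D, hD0, hD⟩
  have h := hΩ.isGappedSlitPlane hapos hab hba hre
  set κ : ℝ := (4 * Real.exp (D + 1))⁻¹ with hκ_def
  have hκ : 0 < κ := by positivity
  have hκD : 4 * κ * Real.exp (D + 1) = 1 := by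
    rw [hκ_def]
    field_simp
  obtain ⟨C, hC0, hC⟩ := h.exists_infDist_le hlim0 (pow_pos hκ 2)
  set X := 2 * Real.exp (D + 1) * C / κ with hX
  obtain ⟨n, hn⟩ := (hlim.eventually_gt_atTop (6 * Real.exp 12 * (X + κ * X))).exists
  have hpos := hapos n
  have hlt := hab n
  obtain ⟨z, hz, hzim, hdist, x, hx, hzx⟩ := exists_point_of_isGromovHyperbolic h.isC1Domain
    h.conj_mem h.zero_notMem hD (p := (a n + b n) / 2) (q := -((a n + b n) / 2))
    (h.ofReal_mem.2 (Or.inr ⟨n, by constructor <;> linarith⟩))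
    (h.ofReal_mem.2 (Or.inl (by linarith))) (by linarith) (by linarith) hκ (lt_add_one D)
  have hre_le := h.re_le_of_qhDist_lt hκ hκD hC0 (by linarith) hC hz hzim hx hzx
  have hfar := h.le_norm_of_qhDist_add_eq n hz hdist
  have hre0 : 0 ≤ z.re := by
    have := abs_nonneg z.im
    rw [hzim] at this
    exact nonneg_of_mul_nonneg_right this hκ
  have hnorm : ‖z‖ ≤ X + κ * X := by
    refine (Complex.norm_le_abs_re_add_abs_im z).trans ?_
    rw [hzim, abs_of_nonneg hre0]
    gcongr
  have : 6 * Real.exp 12 * ‖z‖ ≤ 6 * Real.exp 12 * (X + κ * X) := by gcongr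
  linarith

end
end

section
/- Let Ω ⊆ ℂ be a Denjoy domain with Ω ∩ ℝ = (−∞, 0) ∪ ⋃_{n=1}^∞ (a_n, b_n), where 0 < a_n < b_n ≤ a_{n+1} for every n ≥ 1 and lim_{n→∞} a_n = ∞. If lim_{n→∞} (b_n − a_n)/a_n = 0, then the metric space (Ω, h_Ω) with the Poincaré metric is not Gromov hyperbolic. -/
open Set Metric Filter Complex

namespace Denjoy

section Landau

/-- **Bloch's theorem**: a holomorphic function on the unit disk covers a disk of radius
comparable to its derivative at the origin. -/
theorem exists_ball_subset_image {f : ℂ → ℂ} (hf : DifferentiableOn ℂ f (ball 0 1))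
    (h0 : deriv f 0 ≠ 0) : ∃ c, ball c (‖deriv f 0‖ / 96) ⊆ f '' ball 0 1 := by
  have hd : DifferentiableOn ℂ (deriv f) (ball 0 1) := hf.deriv isOpen_ball
  have hsub : closedBall (0 : ℂ) (1 / 2) ⊆ ball 0 1 := closedBall_subset_ball (by norm_num)
  obtain ⟨a, ha, hmax⟩ := (isCompact_closedBall (0 : ℂ) (1 / 2)).exists_isMaxOn
    ⟨0, by simp⟩ (f := fun z => (1 / 2 - ‖z‖) * ‖deriv f z‖)
    ((continuousOn_const.sub continuous_norm.continuousOn).mul (hd.continuousOn.mono hsub).norm)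
  have hφ : ‖deriv f 0‖ / 2 ≤ (1 / 2 - ‖a‖) * ‖deriv f a‖ := by
    have := hmax (show (0 : ℂ) ∈ closedBall (0 : ℂ) (1 / 2) by simp)
    simp only [mem_ofPred_eq, norm_zero] at this
    linarith
  have hpos : 0 < (1 / 2 - ‖a‖) * ‖deriv f a‖ :=
    lt_of_lt_of_le (half_pos (norm_pos_iff.2 h0)) hφ
  have hM : 0 < ‖deriv f a‖ := pos_of_mul_pos_right hpos (by simpa using ha)
  have ha' : 0 < 1 / 2 - ‖a‖ := pos_of_mul_pos_left hpos hM.le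
  set M := ‖deriv f a‖ with hMdef
  set s := (1 / 2 - ‖a‖) / 2 with hs
  have hspos : 0 < s := by positivity
  have hnear : ∀ z ∈ ball a s, ‖z‖ ≤ 1 / 2 - s := by
    intro z hz
    have := norm_le_norm_add_norm_sub' z a
    rw [mem_ball, dist_eq_norm] at hz
    linarith
  have hballs : ball a s ⊆ ball 0 1 := fun z hz => by
    rw [mem_ball_zero_iff]; linarith [hnear z hz]
  have hbound : ∀ z ∈ ball a s, ‖deriv f z‖ ≤ 2 * M := by
    intro z hz
    have h1 := hnear z hz
    have h2 := hmax (show z ∈ closedBall (0 : ℂ) (1 / 2) by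
      rw [mem_closedBall_zero_iff]; linarith)
    simp only [mem_ofPred_eq] at h2
    have h3 : s * ‖deriv f z‖ ≤ (1 / 2 - ‖z‖) * ‖deriv f z‖ := by gcongr; linarith
    have h4 : s * ‖deriv f z‖ ≤ s * (2 * M) := by
      rw [hs] at h3 ⊢; linarith
    exact le_of_mul_le_mul_left h4 hspos
  have hlip : ∀ z ∈ ball a s, dist (deriv f z) (deriv f a) ≤ 3 * M / s * dist z a := by
    intro z hz
    refine dist_le_div_mul_dist_of_mapsTo_ball (hd.mono hballs) (fun w hw => ?_) hz
    rw [mem_closedBall, dist_eq_norm]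
    linarith [norm_sub_le (deriv f w) (deriv f a), hbound w hw]
  have hrs : closedBall a (s / 6) ⊆ ball a s := closedBall_subset_ball (by linarith)
  have hg : ∀ z ∈ closedBall a (s / 6),
      ‖(f z - deriv f a * z) - (f a - deriv f a * a)‖ ≤ M / 2 * ‖z - a‖ := by
    intro z hz
    have hdf : ∀ w ∈ closedBall a (s / 6), HasDerivAt f (deriv f w) w := fun w hw =>
      (hf.differentiableAt (isOpen_ball.mem_nhds (hballs (hrs hw)))).hasDerivAt
    refine (convex_closedBall a (s / 6)).norm_image_sub_le_of_norm_hasDerivWithin_le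
      (f := fun z => f z - deriv f a * z) (f' := fun w => deriv f w - deriv f a * 1)
      (fun w hw => ((hdf w hw).sub ((hasDerivAt_id w).const_mul _)).hasDerivWithinAt)
      (fun w hw => ?_) (mem_closedBall_self (by positivity)) hz
    have h1 := hlip w (hrs hw)
    rw [dist_eq_norm] at h1
    rw [mul_one]
    refine h1.trans ?_
    have h2 : dist w a ≤ s / 6 := hw
    calc 3 * M / s * dist w a ≤ 3 * M / s * (s / 6) := by gcongr
      _ = M / 2 := by field_simp; norm_num
  have hfa : HasDerivAt f (deriv f a) a :=
    (hf.differentiableAt (isOpen_ball.mem_nhds (hballs (mem_ball_self hspos)))).hasDerivAt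
  refine ⟨f a, ?_⟩
  have key := DiffContOnCl.ball_subset_image_closedBall (f := f) (z₀ := a) (r := s / 6)
    (ε := M * s / 12)
    ((hf.mono (hrs.trans hballs)).diffContOnCl_ball Subset.rfl) (by positivity)
    (fun z hz => ?_) ?_
  · refine (ball_subset_ball ?_).trans (key.trans (image_mono (hrs.trans hballs)))
    rw [hs]; linarith
  · rw [mem_sphere, dist_eq_norm] at hz
    have h1 := hg z (by rw [mem_closedBall, dist_eq_norm, hz])
    have h2 : ‖deriv f a * (z - a)‖ = M * (s / 6) := by rw [norm_mul, hz]
    have h3 : deriv f a * (z - a)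
        = (f z - f a) - ((f z - deriv f a * z) - (f a - deriv f a * a)) := by ring
    have h4 := norm_sub_le (f z - f a) ((f z - deriv f a * z) - (f a - deriv f a * a))
    rw [← h3, h2] at h4
    rw [hz] at h1
    linarith
  · intro hev
    have hev' : f =ᶠ[nhds a] fun _ => f a := by
      filter_upwards [hev] with z hz using not_not.1 hz
    have := hev'.deriv_eq
    rw [deriv_const] at this
    rw [hMdef, this, norm_zero] at hM
    exact lt_irrefl _ hM

theorem exists_exp_eq {g : ℂ → ℂ} (hg : DifferentiableOn ℂ g (ball 0 1))
    (h0 : ∀ z ∈ ball (0 : ℂ) 1, g z ≠ 0) :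
    ∃ L : ℂ → ℂ, DifferentiableOn ℂ L (ball 0 1) ∧ ∀ z ∈ ball (0 : ℂ) 1, exp (L z) = g z := by
  obtain ⟨L, hL⟩ := ((hg.deriv isOpen_ball).div hg h0).isExactOn_ball
  have hgd : ∀ z ∈ ball (0 : ℂ) 1, HasDerivAt g (deriv g z) z := fun z hz =>
    (hg.differentiableAt (isOpen_ball.mem_nhds hz)).hasDerivAt
  have hder : ∀ z ∈ ball (0 : ℂ) 1, HasDerivAt (fun z => g z * exp (-L z)) 0 z := by
    intro z hz
    have h := (hgd z hz).mul (hL z hz).neg.cexp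
    have e : deriv g z * exp ((-L) z) + g z * (exp ((-L) z) * -(deriv g / g) z) = 0 := by
      rw [Pi.div_apply]
      field_simp [h0 z hz]
      ring
    rwa [e] at h
  have hconst : ∀ z ∈ ball (0 : ℂ) 1, g z * exp (-L z) = g 0 * exp (-L 0) := by
    intro z hz
    refine isOpen_ball.is_const_of_deriv_eq_zero (convex_ball (0 : ℂ) 1).isPreconnected
      (f := fun z => g z * exp (-L z))
      (fun w hw => (hder w hw).differentiableAt.differentiableWithinAt)
      (fun w hw => (hder w hw).deriv) hz (mem_ball_self one_pos)
  have h00 := h0 0 (mem_ball_self one_pos)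
  refine ⟨fun z => L z + log (g 0 * exp (-L 0)),
    (fun z hz => ((hL z hz).differentiableAt.add_const _).differentiableWithinAt),
    fun z hz => ?_⟩
  rw [exp_add, exp_log (mul_ne_zero h00 (exp_ne_zero _)), ← hconst z hz, mul_comm, mul_assoc,
    ← exp_add]
  simp

theorem exists_cos_eq {F : ℂ → ℂ} (hF : DifferentiableOn ℂ F (ball 0 1))
    (h1 : ∀ z ∈ ball (0 : ℂ) 1, F z ≠ 1) (h2 : ∀ z ∈ ball (0 : ℂ) 1, F z ≠ -1) :
    ∃ h : ℂ → ℂ, DifferentiableOn ℂ h (ball 0 1) ∧ ∀ z ∈ ball (0 : ℂ) 1, cos (h z) = F z := by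
  obtain ⟨L, hL, hexp⟩ := exists_exp_eq (g := fun z => F z ^ 2 - 1) ((hF.pow 2).sub_const 1)
    (fun z hz h => by
      have : (F z - 1) * (F z + 1) = 0 := by rw [← h]; ring
      rcases mul_eq_zero.1 this with h' | h'
      · exact h1 z hz (sub_eq_zero.1 h')
      · exact h2 z hz (eq_neg_of_add_eq_zero_left h'))
  have hG : ∀ z ∈ ball (0 : ℂ) 1, exp (L z / 2) ^ 2 = F z ^ 2 - 1 := fun z hz => by
    rw [← exp_nat_mul, ← hexp z hz]; congr 1; push_cast; ring
  have hmul : ∀ z ∈ ball (0 : ℂ) 1, (F z + exp (L z / 2)) * (F z - exp (L z / 2)) = 1 :=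
    fun z hz => by linear_combination -hG z hz
  obtain ⟨N, hN, hNexp⟩ := exists_exp_eq (g := fun z => F z + exp (L z / 2))
    (hF.add (hL.div_const 2).cexp) (fun z hz => left_ne_zero_of_mul_eq_one (hmul z hz))
  refine ⟨fun z => N z / I, hN.div_const I, fun z hz => ?_⟩
  rw [Complex.cos, neg_mul, div_mul_cancel₀ _ I_ne_zero, exp_neg, hNexp z hz,
    inv_eq_of_mul_eq_one_right (hmul z hz)]
  ring

theorem exists_cos_eq_int_mem_ball (ζ : ℂ) : ∃ k ∈ ball ζ 6, ∃ n : ℤ, cos k = n := by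
  have hpi := Real.pi_pos
  obtain ⟨n, hn1, hn2⟩ : ∃ n : ℤ, Real.cosh |ζ.im| ≤ n ∧ (n : ℝ) ≤ Real.cosh (|ζ.im| + 2) := by
    refine ⟨⌈Real.cosh |ζ.im|⌉, Int.le_ceil _, ((Int.ceil_lt_add_one _).le).trans ?_⟩
    rw [Real.cosh_add]
    have h1 := Real.one_le_cosh |ζ.im|
    have h2 : 2 ≤ Real.cosh 2 := by
      rw [Real.cosh_eq]
      have := Real.add_one_le_exp 1
      have h3 : Real.exp 2 = Real.exp 1 * Real.exp 1 := by rw [← Real.exp_add]; norm_num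
      nlinarith [Real.exp_pos (-2)]
    have h3 := Real.sinh_nonneg_iff.2 (abs_nonneg ζ.im)
    have h4 := Real.sinh_nonneg_iff.2 (zero_le_two (α := ℝ))
    nlinarith [mul_nonneg h3 h4]
  obtain ⟨y, ⟨hy1, hy2⟩, hy⟩ := intermediate_value_Icc (show |ζ.im| ≤ |ζ.im| + 2 by linarith)
    Real.continuous_cosh.continuousOn ⟨hn1, hn2⟩
  obtain ⟨y', hy'1, hy'⟩ : ∃ y' : ℝ, |ζ.im - y'| ≤ 2 ∧ Real.cosh y' = n := by
    rcases le_total 0 ζ.im with h | h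
    · rw [abs_of_nonneg h] at hy1 hy2
      exact ⟨y, by rw [abs_le]; constructor <;> linarith, hy⟩
    · rw [abs_of_nonpos h] at hy1 hy2
      exact ⟨-y, by rw [abs_le]; constructor <;> linarith, by rw [Real.cosh_neg, hy]⟩
  set j := round (ζ.re / (2 * Real.pi)) with hj
  have hre : |ζ.re - j * (2 * Real.pi)| ≤ Real.pi := by
    have h := abs_sub_round (ζ.re / (2 * Real.pi))
    have h2 : ζ.re - j * (2 * Real.pi) = (ζ.re / (2 * Real.pi) - j) * (2 * Real.pi) := by
      field_simp
    rw [h2, abs_mul, abs_of_pos (show (0 : ℝ) < 2 * Real.pi by positivity)]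
    nlinarith
  refine ⟨y' * I + j * (2 * Real.pi), ?_, n, ?_⟩
  · rw [mem_ball', dist_eq_norm]
    refine (norm_le_abs_re_add_abs_im _).trans_lt ?_
    have e1 : (ζ - (y' * I + j * (2 * Real.pi))).re = ζ.re - j * (2 * Real.pi) := by simp
    have e2 : (ζ - (y' * I + j * (2 * Real.pi))).im = ζ.im - y' := by simp
    rw [e1, e2]
    linarith [Real.pi_lt_d2]
  · rw [cos_add_int_mul_two_pi, cos_mul_I, ← ofReal_cosh, hy']
    simp

theorem exists_cos_eq_re_le (w : ℂ) {z : ℂ} (h : cos z = w) :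
    ∃ n : ℤ, |(z + n * (2 * Real.pi)).re| ≤ Real.pi ∧ cos (z + n * (2 * Real.pi)) = w := by
  have hpi := Real.pi_pos
  refine ⟨-round (z.re / (2 * Real.pi)), ?_, by rw [cos_add_int_mul_two_pi, h]⟩
  have h1 := abs_sub_round (z.re / (2 * Real.pi))
  have h2 : (z + ((-round (z.re / (2 * Real.pi)) : ℤ) : ℂ) * (2 * Real.pi)).re
      = (z.re / (2 * Real.pi) - round (z.re / (2 * Real.pi))) * (2 * Real.pi) := by
    simp only [Int.cast_neg, add_re, mul_re, neg_re, intCast_re, neg_im, intCast_im, re_ofNat,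
      ofReal_re, im_ofNat, ofReal_im]
    field_simp
    simp; ring
  rw [h2, abs_mul, abs_of_pos (show (0 : ℝ) < 2 * Real.pi by positivity)]
  nlinarith

/-- A version of **Landau's theorem**: a holomorphic function on the disk omitting `0` and `1`
has derivative at the origin controlled by its value there. -/
theorem norm_deriv_le_of_omits {f : ℂ → ℂ} (hf : DifferentiableOn ℂ f (ball 0 1))
    (h0 : ∀ z ∈ ball (0 : ℂ) 1, f z ≠ 0) (h1 : ∀ z ∈ ball (0 : ℂ) 1, f z ≠ 1)
    (hle : ‖f 0‖ ≤ 1) : ‖deriv f 0‖ ≤ 7000 * √‖f 0‖ := by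
  have hpi := Real.pi_pos
  have hm0 : (0 : ℂ) ∈ ball (0 : ℂ) 1 := mem_ball_self one_pos
  have hnh : ball (0 : ℂ) 1 ∈ nhds (0 : ℂ) := isOpen_ball.mem_nhds hm0
  obtain ⟨h', hh', hcos'⟩ := exists_cos_eq (F := fun z => 2 * f z - 1)
    ((hf.const_mul 2).sub_const 1)
    (fun z hz h => h1 z hz (by linear_combination h / 2))
    (fun z hz h => h0 z hz (by linear_combination h / 2))
  obtain ⟨n, hn, -⟩ := exists_cos_eq_re_le _ (hcos' 0 hm0)
  obtain ⟨h, hh, hcos, hre⟩ : ∃ h : ℂ → ℂ, DifferentiableOn ℂ h (ball 0 1) ∧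
      (∀ z ∈ ball (0 : ℂ) 1, cos (h z) = 2 * f z - 1) ∧ |(h 0).re| ≤ Real.pi :=
    ⟨fun z => h' z + n * (2 * Real.pi), hh'.add_const _,
      fun z hz => by rw [cos_add_int_mul_two_pi, hcos' z hz], hn⟩
  have hsin : ∀ z ∈ ball (0 : ℂ) 1, sin (h z) ≠ 0 := by
    intro z hz hs
    have h2 := sin_sq_add_cos_sq (h z)
    rw [hs, hcos z hz] at h2
    have h3 : f z * (f z - 1) = 0 := by linear_combination h2 / 4
    rcases mul_eq_zero.1 h3 with h4 | h4
    · exact h0 z hz h4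
    · exact h1 z hz (sub_eq_zero.1 h4)
  have hper : ∀ z ∈ ball (0 : ℂ) 1, ∀ m : ℤ, h z / Real.pi ≠ m := by
    intro z hz m hm
    refine hsin z hz (sin_eq_zero_iff.2 ⟨m, ?_⟩)
    rw [← hm, div_mul_cancel₀ _ (by exact_mod_cast hpi.ne')]
  obtain ⟨k, hk, hkcos⟩ := exists_cos_eq (F := fun z => h z / Real.pi) (hh.div_const _)
    (fun z hz => by simpa using hper z hz 1) (fun z hz => by simpa using hper z hz (-1))
  have hk' : ‖deriv k 0‖ ≤ 576 := by
    by_contra! hlt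
    obtain ⟨c, hc⟩ := exists_ball_subset_image hk (by
      rw [← norm_pos_iff]; linarith)
    obtain ⟨w, hw, m, hm⟩ := exists_cos_eq_int_mem_ball c
    obtain ⟨z, hz, rfl⟩ := hc (ball_subset_ball (by linarith) hw)
    exact hper z hz m (by rw [← hm, hkcos z hz])
  have e1 : 2 * deriv f 0 = -sin (h 0) * deriv h 0 := by
    have d1 : HasDerivAt (fun z => cos (h z)) (-sin (h 0) * deriv h 0) 0 :=
      (hh.differentiableAt hnh).hasDerivAt.ccos
    have d2 : HasDerivAt (fun z => 2 * f z - 1) (2 * deriv f 0) 0 :=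
      ((hf.differentiableAt hnh).hasDerivAt.const_mul 2).sub_const 1
    refine d2.unique (d1.congr_of_eventuallyEq ?_)
    filter_upwards [hnh] with z hz using (hcos z hz).symm
  have e2 : deriv h 0 = -(Real.pi * (sin (k 0) * deriv k 0)) := by
    have d1 : HasDerivAt (fun z => cos (k z)) (-sin (k 0) * deriv k 0) 0 :=
      (hk.differentiableAt hnh).hasDerivAt.ccos
    have d2 : HasDerivAt (fun z => h z / Real.pi) (deriv h 0 / Real.pi) 0 :=
      (hh.differentiableAt hnh).hasDerivAt.div_const _
    have := d2.unique (d1.congr_of_eventuallyEq (by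
      filter_upwards [hnh] with z hz using (hkcos z hz).symm))
    have hpi' : (Real.pi : ℂ) ≠ 0 := by exact_mod_cast hpi.ne'
    rw [div_eq_iff hpi'] at this
    rw [this]; ring
  have b1 : ‖sin (h 0)‖ ≤ 3 * √‖f 0‖ := by
    have h2 : sin (h 0) ^ 2 = 4 * (f 0 * (1 - f 0)) := by
      have := sin_sq_add_cos_sq (h 0)
      rw [hcos 0 hm0] at this
      linear_combination this
    refine abs_le_of_sq_le_sq' ?_ (by positivity) |>.2
    rw [← norm_pow, h2, mul_pow, Real.sq_sqrt (norm_nonneg _), norm_mul, norm_mul]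
    have h3 : ‖1 - f 0‖ ≤ 2 := (norm_sub_le _ _).trans (by rw [norm_one]; linarith)
    have : ‖(4 : ℂ)‖ = 4 := by norm_num
    rw [this]
    nlinarith [norm_nonneg (f 0)]
  have him : |(h 0).im| ≤ Real.pi := by
    have h2 : ‖cos (h 0)‖ ≤ 3 := by
      rw [hcos 0 hm0]
      refine (norm_sub_le _ _).trans ?_
      rw [norm_mul, norm_one]
      have : ‖(2 : ℂ)‖ = 2 := by norm_num
      rw [this]
      linarith
    have h3 : Real.sinh (h 0).im ^ 2 ≤ ‖cos (h 0)‖ ^ 2 := by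
      rw [Complex.sq_norm, Complex.cos_eq, normSq_apply]
      simp only [← ofReal_cos, ← ofReal_sin, ← ofReal_cosh, ← ofReal_sinh, sub_re, sub_im,
        mul_re, mul_im, ofReal_re, ofReal_im, I_re, I_im]
      nlinarith [Real.cosh_sq (h 0).im, Real.sin_sq_add_cos_sq (h 0).re,
        sq_nonneg (Real.cos (h 0).re), sq_nonneg (Real.sin (h 0).re)]
    have h4 : |Real.sinh (h 0).im| ≤ 3 := by
      refine (abs_le_of_sq_le_sq' ?_ (by norm_num)).2
      rw [sq_abs]
      exact h3.trans (pow_le_pow_left₀ (norm_nonneg _) h2 2)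
    have h5 : |(h 0).im| ≤ |Real.sinh (h 0).im| := by
      rw [Real.abs_sinh]
      exact Real.self_le_sinh_iff.2 (abs_nonneg _)
    linarith [Real.pi_gt_three]
  have b2 : ‖sin (k 0)‖ ≤ 2 := by
    have h2 : sin (k 0) ^ 2 = 1 - (h 0 / Real.pi) ^ 2 := by
      have := sin_sq_add_cos_sq (k 0)
      rw [hkcos 0 hm0] at this
      linear_combination this
    have h3 : ‖h 0‖ ^ 2 ≤ 2 * Real.pi ^ 2 := by
      rw [Complex.sq_norm, normSq_apply]
      nlinarith [sq_abs (h 0).re, sq_abs (h 0).im, abs_nonneg (h 0).re, abs_nonneg (h 0).im]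
    have h4 : ‖(h 0 / Real.pi) ^ 2‖ ≤ 2 := by
      rw [norm_pow, norm_div, norm_real, Real.norm_of_nonneg hpi.le, div_pow, div_le_iff₀
        (by positivity)]
      exact h3
    refine abs_le_of_sq_le_sq' ?_ (by positivity) |>.2
    rw [← norm_pow, h2]
    refine (norm_sub_le _ _).trans ?_
    rw [norm_one]; linarith
  have e3 : 2 * ‖deriv f 0‖ = ‖sin (h 0)‖ * (Real.pi * (‖sin (k 0)‖ * ‖deriv k 0‖)) := by
    have := congrArg norm e1
    rw [e2] at this
    simpa [abs_of_pos hpi] using this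
  have : 2 * ‖deriv f 0‖ ≤ 3 * √‖f 0‖ * (3.15 * (2 * 576)) := by
    rw [e3]
    gcongr
    exact Real.pi_lt_d2.le
  nlinarith [Real.sqrt_nonneg ‖f 0‖]

end Landau

section Cover

open scoped Topology ComplexConjugate

/-- `p` is a holomorphic covering of `Ω` by the unit disk realizing the density `lam`. -/
structure IsPoincareCover (Ω : Set ℂ) (lam : ℂ → ℝ) (p : ℂ → ℂ) : Prop where
  diff : ∀ z ∈ ball (0 : ℂ) 1, DifferentiableAt ℂ p z
  image : p '' ball (0 : ℂ) 1 = Ω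
  cov : IsCoveringMapOn (fun z : ball (0 : ℂ) 1 => p z) Ω
  dens : ∀ z ∈ ball (0 : ℂ) 1, lam (p z) * ‖deriv p z‖ = 2 / (1 - ‖z‖ ^ 2)

/-- The hyperbolic distance in the unit disk from the origin to a point of modulus `r`. -/
noncomputable def hyp (r : ℝ) : ℝ := Real.log (1 + r) - Real.log (1 - r)

theorem hyp_zero : hyp 0 = 0 := by simp [hyp]

theorem hasDerivAt_hyp {r : ℝ} (h1 : -1 < r) (h2 : r < 1) :
    HasDerivAt hyp (2 / (1 - r ^ 2)) r := by
  have h := (((hasDerivAt_id r).const_add 1).log (by simp; linarith)).sub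
    (((hasDerivAt_id r).const_sub 1).log (by simp; linarith))
  refine h.congr_deriv ?_
  have : 1 + r ≠ 0 := by linarith
  have : 1 - r ≠ 0 := by linarith
  have : 1 - r ^ 2 ≠ 0 := by nlinarith
  simp only [id_eq]
  field_simp
  ring

theorem hyp_le_hyp {r s : ℝ} (h1 : -1 < r) (h : r ≤ s) (h2 : s < 1) : hyp r ≤ hyp s := by
  unfold hyp
  have := Real.log_le_log (x := 1 + r) (y := 1 + s) (by linarith) (by linarith)
  have := Real.log_le_log (x := 1 - s) (y := 1 - r) (by linarith) (by linarith)
  linarith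

theorem hyp_add {r s : ℝ} (hr : |r| < 1) (hs : |s| < 1) :
    hyp ((r + s) / (1 + r * s)) = hyp r + hyp s := by
  obtain ⟨r1, r2⟩ := abs_lt.1 hr
  obtain ⟨s1, s2⟩ := abs_lt.1 hs
  have h : 0 < 1 + r * s := by
    have := abs_mul r s
    have : |r * s| < 1 := by
      rw [this]; nlinarith [abs_nonneg r, abs_nonneg s]
    linarith [(abs_lt.1 this).1]
  have e1 : 1 + (r + s) / (1 + r * s) = (1 + r) * (1 + s) / (1 + r * s) := by
    field_simp; ring
  have e2 : 1 - (r + s) / (1 + r * s) = (1 - r) * (1 - s) / (1 + r * s) := by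
    field_simp; ring
  unfold hyp
  rw [e1, e2, Real.log_div, Real.log_div, Real.log_mul, Real.log_mul]
  · ring
  all_goals first | positivity | nlinarith

theorem hyp_tanh (t : ℝ) : hyp (Real.tanh (t / 2)) = t := by
  have hc := Real.cosh_pos (t / 2)
  have e1 : 1 + Real.tanh (t / 2) = Real.exp (t / 2) / Real.cosh (t / 2) := by
    rw [Real.tanh_eq_sinh_div_cosh, ← Real.cosh_add_sinh]; field_simp
  have e2 : 1 - Real.tanh (t / 2) = Real.exp (-(t / 2)) / Real.cosh (t / 2) := by
    rw [Real.tanh_eq_sinh_div_cosh, ← Real.cosh_sub_sinh]; field_simp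
  unfold hyp
  rw [e1, e2, Real.log_div (Real.exp_pos _).ne' hc.ne', Real.log_div (Real.exp_pos _).ne' hc.ne',
    Real.log_exp, Real.log_exp]
  ring

theorem exists_localInverse {p : ℂ → ℂ} {u : ℂ} (hp : ∀ᶠ z in 𝓝 u, DifferentiableAt ℂ p z)
    (h0 : deriv p u ≠ 0) :
    ∃ ψ : ℂ → ℂ, HasDerivAt ψ (deriv p u)⁻¹ (p u) ∧ ∀ᶠ z in 𝓝 u, ψ (p z) = z := by
  have han : AnalyticAt ℂ p u := analyticAt_iff_eventually_differentiableAt.2 hp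
  have hs : HasStrictDerivAt p (deriv p u) u := han.hasStrictDerivAt
  exact ⟨_, (hs.to_localInverse h0).hasDerivAt,
    (hs.hasStrictFDerivAt_equiv h0).eventually_left_inverse⟩

namespace IsPoincareCover

variable {Ω : Set ℂ} {lam : ℂ → ℝ} {p : ℂ → ℂ}

theorem mem (hp : IsPoincareCover Ω lam p) {v : ℂ} (hv : v ∈ ball (0 : ℂ) 1) : p v ∈ Ω :=
  hp.image ▸ mem_image_of_mem p hv

theorem one_sub_pos {v : ℂ} (hv : v ∈ ball (0 : ℂ) 1) : 0 < 1 - ‖v‖ ^ 2 := by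
  have : ‖v‖ < 1 := by simpa using hv
  nlinarith [norm_nonneg v]

theorem mul_pos (hp : IsPoincareCover Ω lam p) {v : ℂ} (hv : v ∈ ball (0 : ℂ) 1) :
    0 < lam (p v) * ‖deriv p v‖ := by
  rw [hp.dens v hv]
  exact div_pos two_pos (one_sub_pos hv)

theorem deriv_ne_zero (hp : IsPoincareCover Ω lam p) {v : ℂ} (hv : v ∈ ball (0 : ℂ) 1) :
    deriv p v ≠ 0 := by
  intro h
  have := hp.mul_pos hv
  simp [h] at this

theorem lam_pos (hp : IsPoincareCover Ω lam p) {z : ℂ} (hz : z ∈ Ω) : 0 < lam z := by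
  rw [← hp.image] at hz
  obtain ⟨v, hv, rfl⟩ := hz
  exact pos_of_mul_pos_left (hp.mul_pos hv) (norm_nonneg _)

theorem exists_inverse (hp : IsPoincareCover Ω lam p) {u : ℂ} (hu : u ∈ ball (0 : ℂ) 1) :
    ∃ ψ : ℂ → ℂ, HasDerivAt ψ (deriv p u)⁻¹ (p u) ∧ ∀ᶠ z in 𝓝 u, ψ (p z) = z :=
  exists_localInverse (eventually_of_mem (isOpen_ball.mem_nhds hu) hp.diff) (hp.deriv_ne_zero hu)

theorem exists_lift (hp : IsPoincareCover Ω lam p) {A : Type*} [TopologicalSpace A]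
    [SimplyConnectedSpace A] [LocallyPathConnectedSpace A] {f : A → ℂ} (hf : Continuous f)
    (hfΩ : ∀ x, f x ∈ Ω) {x₀ : A} {u : ℂ} (hu : u ∈ ball (0 : ℂ) 1) (h0 : p u = f x₀) :
    ∃ F : A → ℂ, Continuous F ∧ (∀ x, F x ∈ ball (0 : ℂ) 1) ∧ F x₀ = u ∧ ∀ x, p (F x) = f x := by
  obtain ⟨F, ⟨h1, h2⟩, -⟩ := hp.cov.existsUnique_continuousMap_lifts ⟨f, hf⟩ (a₀ := x₀)
    (e₀ := ⟨u, hu⟩) h0 hfΩ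
  exact ⟨fun x => F x, by fun_prop, fun x => (F x).2, congrArg Subtype.val h1,
    fun x => congrFun h2 x⟩

theorem exists_lift_path (hp : IsPoincareCover Ω lam p) {γ : ℝ → ℂ}
    (hγ : ContinuousOn γ (Icc 0 1)) (hγΩ : ∀ t ∈ Icc (0 : ℝ) 1, γ t ∈ Ω) {u : ℂ}
    (hu : u ∈ ball (0 : ℂ) 1) (h0 : p u = γ 0) :
    ∃ Γ : ℝ → ℂ, Continuous Γ ∧ (∀ t, Γ t ∈ ball (0 : ℂ) 1) ∧ Γ 0 = u ∧
      ∀ t ∈ Icc (0 : ℝ) 1, p (Γ t) = γ t := by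
  have h01 : (0 : ℝ) ≤ 1 := zero_le_one
  obtain ⟨Γ, h1, h2, h3, h4⟩ := hp.exists_lift (f := fun t : ℝ => γ (projIcc 0 1 h01 t))
    (hγ.comp_continuous (by fun_prop) (fun t => (projIcc 0 1 h01 t).2))
    (fun t => hγΩ _ (projIcc 0 1 h01 t).2) (x₀ := 0) hu (by simpa [projIcc] using h0)
  refine ⟨Γ, h1, h2, h3, fun t ht => ?_⟩
  rw [h4, projIcc_of_mem h01 ht]

theorem exists_lift_disk (hp : IsPoincareCover Ω lam p) {f : ℂ → ℂ}
    (hf : DifferentiableOn ℂ f (ball 0 1)) (hfΩ : MapsTo f (ball 0 1) Ω) (h0 : p 0 = f 0) :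
    ∃ F : ℂ → ℂ, DifferentiableOn ℂ F (ball 0 1) ∧ MapsTo F (ball 0 1) (ball 0 1) ∧ F 0 = 0 ∧
      ∀ v ∈ ball (0 : ℂ) 1, p (F v) = f v := by
  have := (convex_ball (0 : ℂ) 1).contractibleSpace ⟨0, mem_ball_self one_pos⟩
  have := (isOpen_ball (x := (0 : ℂ)) (ε := 1)).locallyPathConnectedSpace
  obtain ⟨G, h1, h2, h3, h4⟩ := hp.exists_lift (A := ball (0 : ℂ) 1) (f := fun v => f v)
    (continuousOn_iff_continuous_domRestrict.1 hf.continuousOn) (fun v => hfΩ v.2)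
    (x₀ := ⟨0, mem_ball_self one_pos⟩) (mem_ball_self one_pos) h0
  classical
  have hF : ∀ v : ball (0 : ℂ) 1, (fun z => if hz : z ∈ ball (0 : ℂ) 1 then G ⟨z, hz⟩ else 0) v
      = G v := fun v => by simp
  generalize (fun z => if hz : z ∈ ball (0 : ℂ) 1 then G ⟨z, hz⟩ else 0) = F at hF
  have hFb : MapsTo F (ball 0 1) (ball 0 1) := fun v hv => by
    rw [hF ⟨v, hv⟩]; exact h2 _
  have hpF : ∀ v ∈ ball (0 : ℂ) 1, p (F v) = f v := fun v hv => by
    rw [hF ⟨v, hv⟩]; exact h4 _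
  have hFc : ContinuousOn F (ball 0 1) := by
    rw [continuousOn_iff_continuous_domRestrict]
    convert h1 using 1
    ext v
    exact hF v
  refine ⟨F, fun v hv => ?_, hFb, (hF ⟨0, _⟩).trans h3, hpF⟩
  obtain ⟨ψ, hψ, hψ'⟩ := hp.exists_inverse (hFb hv)
  rw [hpF v hv] at hψ
  have hfd := (hf.differentiableAt (isOpen_ball.mem_nhds hv))
  have hcomp := hψ.differentiableAt.comp v hfd
  have hev : F =ᶠ[𝓝 v] ψ ∘ f := by
    filter_upwards [(hFc.continuousAt (isOpen_ball.mem_nhds hv)).eventually hψ',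
      isOpen_ball.mem_nhds hv] with w hw hwb
    rw [Function.comp, ← hpF w hwb, hw]
  exact (hev.differentiableAt_iff.2 hcomp).differentiableWithinAt

theorem continuous_lam_comp (hp : IsPoincareCover Ω lam p) :
    ContinuousOn (fun v => lam (p v)) (ball 0 1) := by
  have hd : DifferentiableOn ℂ p (ball 0 1) := fun z hz => (hp.diff z hz).differentiableWithinAt
  have h : ContinuousOn (fun v : ℂ => 2 / (1 - ‖v‖ ^ 2) / ‖deriv p v‖) (ball 0 1) := by
    refine ContinuousOn.div (ContinuousOn.div continuousOn_const (by fun_prop)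
      fun v hv => (one_sub_pos hv).ne') (hd.deriv isOpen_ball).continuousOn.norm
      fun v hv => norm_ne_zero_iff.2 (hp.deriv_ne_zero hv)
  refine h.congr fun v hv => ?_
  rw [eq_div_iff (norm_ne_zero_iff.2 (hp.deriv_ne_zero hv)), hp.dens v hv]

theorem exists_le_curveLen (hp : IsPoincareCover Ω lam p) {γ : ℝ → ℂ}
    (hγ : ContDiffOn ℝ 1 γ (Icc 0 1)) (hγΩ : ∀ t ∈ Icc (0 : ℝ) 1, γ t ∈ Ω) (h0 : p 0 = γ 0) :
    ∃ v ∈ ball (0 : ℂ) 1, p v = γ 1 ∧ hyp ‖v‖ ≤ curveLen lam γ := by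
  obtain ⟨Γ, hΓc, hΓb, hΓ0, hpΓ⟩ :=
    hp.exists_lift_path hγ.continuousOn hγΩ (mem_ball_self one_pos) h0
  refine ⟨Γ 1, hΓb 1, hpΓ 1 (by simp), ?_⟩
  obtain ⟨e, he, hev⟩ : ∃ e : ℂ, ‖e‖ = 1 ∧ Γ 1 * e = ‖Γ 1‖ := by
    by_cases h : Γ 1 = 0
    · exact ⟨1, by simp, by simp [h]⟩
    · have h' : (‖Γ 1‖ : ℂ) ≠ 0 := by exact_mod_cast norm_ne_zero_iff.2 h
      refine ⟨conj (Γ 1) / ‖Γ 1‖, ?_, ?_⟩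
      · rw [norm_div, RCLike.norm_conj, norm_real, norm_norm, div_self (norm_ne_zero_iff.2 h)]
      · rw [← mul_div_assoc, mul_conj, ← Complex.sq_norm]
        push_cast
        field_simp
  have hderivWithin : ∀ t ∈ Ioo (0 : ℝ) 1, derivWithin γ (Icc 0 1) t = deriv γ t := fun t ht =>
    derivWithin_of_mem_nhds (Icc_mem_nhds ht.1 ht.2)
  have hγd : ∀ t ∈ Ioo (0 : ℝ) 1, HasDerivAt γ (deriv γ t) t := fun t ht =>
    (((hγ.differentiableOn one_ne_zero) t (Ioo_subset_Icc_self ht)).differentiableAt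
      (Icc_mem_nhds ht.1 ht.2)).hasDerivAt
  have hΓd : ∀ t ∈ Ioo (0 : ℝ) 1, HasDerivAt Γ ((deriv p (Γ t))⁻¹ * deriv γ t) t := by
    intro t ht
    obtain ⟨ψ, hψ, hψ'⟩ := hp.exists_inverse (hΓb t)
    rw [hpΓ t (Ioo_subset_Icc_self ht)] at hψ
    refine (hψ.comp t (hγd t ht)).congr_of_eventuallyEq ?_
    filter_upwards [hΓc.continuousAt.eventually hψ', Ioo_mem_nhds ht.1 ht.2] with s hs hs'
    rw [Function.comp, ← hpΓ s (Ioo_subset_Icc_self hs'), hs]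
  have hre : ∀ t, |(Γ t * e).re| ≤ ‖Γ t‖ := fun t => by
    simpa [he] using abs_re_le_norm (Γ t * e)
  have hlt : ∀ t, |(Γ t * e).re| < 1 := fun t =>
    (hre t).trans_lt (by simpa using hΓb t)
  have hrd : ∀ t ∈ Ioo (0 : ℝ) 1, HasDerivAt (fun t => (Γ t * e).re)
      ((deriv p (Γ t))⁻¹ * deriv γ t * e).re t := fun t ht =>
    (Complex.reCLM.hasFDerivAt.comp_hasDerivAt t ((hΓd t ht).mul_const e))
  have hper : MeasureTheory.IntegrableOn (fun t => lam (γ t) * ‖deriv γ t‖) (Icc 0 1) := by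
    have hc : ContinuousOn (fun t => lam (p (Γ t)) * ‖derivWithin γ (Icc 0 1) t‖) (Icc 0 1) :=
      (hp.continuous_lam_comp.comp hΓc.continuousOn fun t _ => hΓb t).mul
        (hγ.continuousOn_derivWithin (uniqueDiffOn_Icc one_pos) le_rfl).norm
    have h2 := hc.integrableOn_Icc (μ := MeasureTheory.volume)
    rw [integrableOn_Icc_iff_integrableOn_Ioo] at h2 ⊢
    refine h2.congr_fun (fun t ht => ?_) measurableSet_Ioo
    simp only [hpΓ t (Ioo_subset_Icc_self ht), hderivWithin t ht]
  have key := intervalIntegral.sub_le_integral_of_hasDeriv_right_of_le (zero_le_one' ℝ)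
    (g := fun t => hyp (Γ t * e).re)
    (g' := fun t => 2 / (1 - (Γ t * e).re ^ 2) * ((deriv p (Γ t))⁻¹ * deriv γ t * e).re)
    (φ := fun t => lam (γ t) * ‖deriv γ t‖) ?_ ?_ hper ?_
  · simpa [hΓ0, hyp_zero, hev, curveLen] using key
  · refine fun t _ => ContinuousAt.continuousWithinAt ?_
    exact ContinuousAt.comp (g := hyp)
      (hasDerivAt_hyp (abs_lt.1 (hlt t)).1 (abs_lt.1 (hlt t)).2).continuousAt
      (by fun_prop)
  · intro t ht
    exact ((hasDerivAt_hyp (abs_lt.1 (hlt t)).1 (abs_lt.1 (hlt t)).2).comp t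
      (hrd t ht)).hasDerivWithinAt
  · intro t ht
    have hd := hp.dens (Γ t) (hΓb t)
    have hpn := norm_pos_iff.2 (hp.deriv_ne_zero (hΓb t))
    rw [hpΓ t (Ioo_subset_Icc_self ht), ← eq_div_iff hpn.ne'] at hd
    have h1 : ((deriv p (Γ t))⁻¹ * deriv γ t * e).re ≤ ‖deriv γ t‖ / ‖deriv p (Γ t)‖ := by
      refine (re_le_norm _).trans_eq ?_
      rw [norm_mul, norm_mul, he, norm_inv]
      ring
    have h2 : (Γ t * e).re ^ 2 ≤ ‖Γ t‖ ^ 2 := by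
      rw [← sq_abs]
      exact pow_le_pow_left₀ (abs_nonneg _) (hre t) 2
    have h3 := one_sub_pos (hΓb t)
    calc 2 / (1 - (Γ t * e).re ^ 2) * ((deriv p (Γ t))⁻¹ * deriv γ t * e).re
        ≤ 2 / (1 - (Γ t * e).re ^ 2) * (‖deriv γ t‖ / ‖deriv p (Γ t)‖) := by
          gcongr
          exact div_nonneg zero_le_two (by linarith)
      _ ≤ 2 / (1 - ‖Γ t‖ ^ 2) * (‖deriv γ t‖ / ‖deriv p (Γ t)‖) := by
          gcongr
      _ = lam (γ t) * ‖deriv γ t‖ := by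
          rw [hd]; ring

theorem densityDist_le (hp : IsPoincareCover Ω lam p) {v : ℂ} (hv : v ∈ ball (0 : ℂ) 1) :
    densityDist Ω lam (p 0) (p v) ≤ hyp ‖v‖ := by
  have hv1 : ‖v‖ < 1 := by simpa using hv
  have hmem : ∀ t ∈ Icc (0 : ℝ) 1, (t : ℂ) * v ∈ ball (0 : ℂ) 1 := by
    intro t ht
    simp only [mem_ball_zero_iff, norm_mul, norm_real, Real.norm_of_nonneg ht.1]
    nlinarith [ht.1, ht.2, norm_nonneg v]
  have hd : DifferentiableOn ℂ p (ball 0 1) := fun z hz => (hp.diff z hz).differentiableWithinAt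
  have hγd : ∀ t ∈ Icc (0 : ℝ) 1,
      HasDerivAt (fun t : ℝ => p (t * v)) (deriv p (t * v) * v) t := by
    intro t ht
    have h1 : HasDerivAt (fun t : ℝ => (t : ℂ) * v) v t := by
      simpa using (ofRealCLM.hasDerivAt (x := t)).mul_const v
    exact (hp.diff _ (hmem t ht)).hasDerivAt.comp t h1
  refine csInf_le ⟨0, ?_⟩ ⟨fun t => p (t * v), ?_, by simp, by simp,
    fun t ht => hp.mem (hmem t ht), ?_⟩
  · rintro L ⟨γ, -, -, -, h, rfl⟩
    exact intervalIntegral.integral_nonneg zero_le_one fun t ht =>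
      mul_nonneg (hp.lam_pos (h t ht)).le (norm_nonneg _)
  · have hc : ContDiffOn ℝ 1 p (ball 0 1) := (hd.contDiffOn isOpen_ball).restrict_scalars ℝ
    refine hc.comp (t := ball 0 1) (g := p) ?_ hmem
    exact (ofRealCLM.contDiff.mul contDiff_const).contDiffOn
  · have h : ∀ t ∈ uIcc (0 : ℝ) 1, HasDerivAt (fun t : ℝ => hyp (t * ‖v‖))
        (lam (p (t * v)) * ‖deriv (fun t : ℝ => p (t * v)) t‖) t := by
      rw [uIcc_of_le zero_le_one]
      intro t ht
      have h1 : t * ‖v‖ < 1 := by nlinarith [ht.1, ht.2, norm_nonneg v]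
      have h2 : 0 ≤ t * ‖v‖ := mul_nonneg ht.1 (norm_nonneg v)
      refine ((hasDerivAt_hyp (by linarith) h1).comp t
        ((hasDerivAt_id t).mul_const ‖v‖)).congr_deriv ?_
      rw [(hγd t ht).deriv, norm_mul, ← mul_assoc (lam _), hp.dens _ (hmem t ht)]
      simp [abs_of_nonneg ht.1]
    have h2 := intervalIntegral.integral_eq_sub_of_hasDerivAt h ?_
    · simpa [hyp_zero, curveLen] using h2.symm
    · refine ContinuousOn.intervalIntegrable ?_
      rw [uIcc_of_le zero_le_one]
      have hc : ContinuousOn (fun t : ℝ => lam (p (t * v)) * ‖deriv p (t * v) * v‖) (Icc 0 1) :=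
        (hp.continuous_lam_comp.comp (by fun_prop) hmem).mul
          (((hd.deriv isOpen_ball).continuousOn.comp (by fun_prop) hmem).mul
            continuousOn_const).norm
      exact hc.congr fun t ht => by simp only [(hγd t ht).deriv]

theorem exists_densityDist_eq (hp : IsPoincareCover Ω lam p) {w : ℂ} (hw : w ∈ Ω) :
    ∃ v ∈ ball (0 : ℂ) 1, p v = w ∧ densityDist Ω lam (p 0) w = hyp ‖v‖ := by
  obtain ⟨v₀, hv₀, rfl⟩ := hp.image ▸ hw
  have hsub : closedBall (0 : ℂ) ‖v₀‖ ⊆ ball 0 1 := closedBall_subset_ball (by simpa using hv₀)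
  have hcp : ContinuousOn p (closedBall (0 : ℂ) ‖v₀‖) := fun z hz =>
    (hp.diff z (hsub hz)).continuousAt.continuousWithinAt
  have hK : IsCompact (closedBall (0 : ℂ) ‖v₀‖ ∩ p ⁻¹' {p v₀}) :=
    (isCompact_closedBall (0 : ℂ) ‖v₀‖).of_isClosed_subset
      (hcp.preimage_isClosed_of_isClosed isClosed_closedBall isClosed_singleton) inter_subset_left
  obtain ⟨v, ⟨hvb, hpv⟩, hmin⟩ := hK.exists_isMinOn ⟨v₀, by simp⟩ continuous_norm.continuousOn
  have hpv : p v = p v₀ := hpv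
  have hvb' := hsub hvb
  have hv1 : ‖v‖ < 1 := by simpa using hvb'
  refine ⟨v, hvb', hpv, le_antisymm (hpv ▸ hp.densityDist_le hvb') ?_⟩
  have hne : {L | ∃ γ : ℝ → ℂ, ContDiffOn ℝ 1 γ (Icc 0 1) ∧ γ 0 = p 0 ∧ γ 1 = p v₀ ∧
      (∀ t ∈ Icc (0:ℝ) 1, γ t ∈ Ω) ∧ L = curveLen lam γ}.Nonempty := by
    have hmem : ∀ t ∈ Icc (0 : ℝ) 1, (t : ℂ) * v ∈ ball (0 : ℂ) 1 := by
      intro t ht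
      simp only [mem_ball_zero_iff, norm_mul, norm_real, Real.norm_of_nonneg ht.1]
      nlinarith [ht.1, ht.2, norm_nonneg v]
    have hd : DifferentiableOn ℂ p (ball 0 1) := fun z hz => (hp.diff z hz).differentiableWithinAt
    have hc : ContDiffOn ℝ 1 p (ball 0 1) := (hd.contDiffOn isOpen_ball).restrict_scalars ℝ
    exact ⟨_, fun t => p (t * v), hc.comp (t := ball 0 1) (g := p)
      (ofRealCLM.contDiff.mul contDiff_const).contDiffOn hmem, by simp, by simp [hpv],
      fun t ht => hp.mem (hmem t ht), rfl⟩
  refine le_csInf hne ?_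
  rintro L ⟨γ, h1, h2, h3, h4, rfl⟩
  obtain ⟨v', hv', hpv', hle⟩ := hp.exists_le_curveLen h1 h4 h2.symm
  refine le_trans ?_ hle
  have hv'1 : ‖v'‖ < 1 := by simpa using hv'
  refine hyp_le_hyp (by linarith [norm_nonneg v]) ?_ hv'1
  by_cases h : ‖v'‖ ≤ ‖v₀‖
  · exact hmin (show v' ∈ _ from ⟨by simpa using h, hpv'.trans h3⟩)
  · have : ‖v‖ ≤ ‖v₀‖ := by simpa using hvb
    linarith

end IsPoincareCover

end Cover

section Mobius

open scoped Topology ComplexConjugate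

/-- The automorphism of the unit disk sending `0` to `a`. -/
noncomputable def mob (a z : ℂ) : ℂ := (z + a) / (1 + conj a * z)

variable {a z : ℂ}

theorem one_add_conj_mul_ne_zero (ha : a ∈ ball (0 : ℂ) 1) (hz : z ∈ ball (0 : ℂ) 1) :
    1 + conj a * z ≠ 0 := by
  intro h
  have h1 : ‖conj a * z‖ = 1 := by
    rw [show conj a * z = -1 by linear_combination h]; simp
  rw [norm_mul, RCLike.norm_conj] at h1
  rw [mem_ball_zero_iff] at ha hz
  nlinarith [norm_nonneg a, norm_nonneg z]

theorem one_sub_norm_mob_sq (ha : a ∈ ball (0 : ℂ) 1) (hz : z ∈ ball (0 : ℂ) 1) :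
    1 - ‖mob a z‖ ^ 2 = (1 - ‖a‖ ^ 2) * (1 - ‖z‖ ^ 2) / ‖1 + conj a * z‖ ^ 2 := by
  have h := norm_ne_zero_iff.2 (one_add_conj_mul_ne_zero ha hz)
  rw [mob, norm_div, div_pow, eq_div_iff (pow_ne_zero 2 h), sub_mul, div_mul_cancel₀ _
    (pow_ne_zero 2 h)]
  simp only [Complex.sq_norm, normSq_apply, add_re, add_im, mul_re, mul_im, conj_re, conj_im,
    one_re, one_im]
  ring

theorem mob_mem (ha : a ∈ ball (0 : ℂ) 1) (hz : z ∈ ball (0 : ℂ) 1) :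
    mob a z ∈ ball (0 : ℂ) 1 := by
  have h := norm_pos_iff.2 (one_add_conj_mul_ne_zero ha hz)
  have h1 := one_sub_norm_mob_sq ha hz
  have h2 : 0 < 1 - ‖mob a z‖ ^ 2 := by
    rw [h1]
    exact div_pos (mul_pos (IsPoincareCover.one_sub_pos ha) (IsPoincareCover.one_sub_pos hz))
      (by positivity)
  rw [mem_ball_zero_iff]
  nlinarith [norm_nonneg (mob a z)]

theorem neg_mem (ha : a ∈ ball (0 : ℂ) 1) : -a ∈ ball (0 : ℂ) 1 := by simpa using ha

theorem mob_neg_mob (ha : a ∈ ball (0 : ℂ) 1) (hz : z ∈ ball (0 : ℂ) 1) :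
    mob (-a) (mob a z) = z := by
  have h := one_add_conj_mul_ne_zero ha hz
  have h1 := one_add_conj_mul_ne_zero (neg_mem ha) (mob_mem ha hz)
  rw [mob, div_eq_iff h1, mob, map_neg, eq_comm, ← sub_eq_zero]
  linear_combination -div_mul_cancel₀ (z + a) h

theorem mob_mob_neg (ha : a ∈ ball (0 : ℂ) 1) (hz : z ∈ ball (0 : ℂ) 1) :
    mob a (mob (-a) z) = z := by
  simpa using mob_neg_mob (neg_mem ha) hz

theorem hasDerivAt_mob (ha : a ∈ ball (0 : ℂ) 1) (hz : z ∈ ball (0 : ℂ) 1) :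
    HasDerivAt (mob a) ((1 - ‖a‖ ^ 2) / (1 + conj a * z) ^ 2) z := by
  have h := one_add_conj_mul_ne_zero ha hz
  have h1 : HasDerivAt (fun z : ℂ => 1 + conj a * z) (conj a) z := by
    simpa using ((hasDerivAt_id z).const_mul (conj a)).const_add 1
  refine (((hasDerivAt_id z).add_const a).div h1 h).congr_deriv ?_
  congr 1
  have : (‖a‖ : ℂ) ^ 2 = a * conj a := by
    rw [mul_conj, ← Complex.sq_norm]; push_cast; ring
  rw [this, id_eq]
  ring

theorem norm_mob_le (ha : a ∈ ball (0 : ℂ) 1) (hz : z ∈ ball (0 : ℂ) 1) :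
    ‖mob a z‖ ≤ (‖a‖ + ‖z‖) / (1 + ‖a‖ * ‖z‖) := by
  have h1 := one_sub_norm_mob_sq ha hz
  have h := norm_pos_iff.2 (one_add_conj_mul_ne_zero ha hz)
  have h2 : ‖1 + conj a * z‖ ≤ 1 + ‖a‖ * ‖z‖ := by
    refine (norm_add_le _ _).trans ?_
    rw [norm_mul, RCLike.norm_conj, norm_one]
  have h3 : (1 - ‖a‖ ^ 2) * (1 - ‖z‖ ^ 2) / (1 + ‖a‖ * ‖z‖) ^ 2 ≤ 1 - ‖mob a z‖ ^ 2 := by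
    rw [h1]
    have := mul_pos (IsPoincareCover.one_sub_pos ha) (IsPoincareCover.one_sub_pos hz)
    gcongr
  refine abs_le_of_sq_le_sq' ?_ (by positivity) |>.2
  have : ((‖a‖ + ‖z‖) / (1 + ‖a‖ * ‖z‖)) ^ 2
      = 1 - (1 - ‖a‖ ^ 2) * (1 - ‖z‖ ^ 2) / (1 + ‖a‖ * ‖z‖) ^ 2 := by
    field_simp
    ring
  linarith

/-- `mob a` as a homeomorphism of the unit disk. -/
noncomputable def mobHomeomorph (ha : a ∈ ball (0 : ℂ) 1) : ball (0 : ℂ) 1 ≃ₜ ball (0 : ℂ) 1 where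
  toFun z := ⟨mob a z, mob_mem ha z.2⟩
  invFun z := ⟨mob (-a) z, mob_mem (neg_mem ha) z.2⟩
  left_inv z := Subtype.ext (mob_neg_mob ha z.2)
  right_inv z := Subtype.ext (mob_mob_neg ha z.2)
  continuous_toFun := Continuous.subtype_mk (ContinuousOn.comp_continuous (s := ball 0 1)
    (fun _ hz => (hasDerivAt_mob ha hz).continuousAt.continuousWithinAt) continuous_subtype_val
    fun z => z.2) _
  continuous_invFun := Continuous.subtype_mk (ContinuousOn.comp_continuous (s := ball 0 1)
    (fun _ hz => (hasDerivAt_mob (neg_mem ha) hz).continuousAt.continuousWithinAt)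
    continuous_subtype_val fun z => z.2) _

end Mobius

section Metric

open scoped Topology ComplexConjugate

variable {Ω : Set ℂ} {lam : ℂ → ℝ} {p : ℂ → ℂ}

theorem IsPoincareCover.comp_mob (hp : IsPoincareCover Ω lam p) {a : ℂ}
    (ha : a ∈ ball (0 : ℂ) 1) : IsPoincareCover Ω lam (fun z => p (mob a z)) where
  diff z hz := (hp.diff _ (mob_mem ha hz)).comp z (hasDerivAt_mob ha hz).differentiableAt
  image := by
    rw [← hp.image]
    apply Subset.antisymm
    · rintro _ ⟨z, hz, rfl⟩
      exact ⟨_, mob_mem ha hz, rfl⟩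
    · rintro _ ⟨z, hz, rfl⟩
      exact ⟨_, mob_mem (neg_mem ha) hz, congrArg p (mob_mob_neg ha hz)⟩
  cov := hp.cov.comp_homeomorph (mobHomeomorph ha)
  dens z hz := by
    have hd : HasDerivAt (fun z => p (mob a z)) _ z :=
      (hp.diff _ (mob_mem ha hz)).hasDerivAt.comp z (hasDerivAt_mob ha hz)
    have h := norm_ne_zero_iff.2 (one_add_conj_mul_ne_zero ha hz)
    have h1 : ‖((1 - ‖a‖ ^ 2) / (1 + conj a * z) ^ 2 : ℂ)‖
        = (1 - ‖a‖ ^ 2) / ‖1 + conj a * z‖ ^ 2 := by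
      rw [norm_div, norm_pow]
      congr 1
      rw [← Real.norm_of_nonneg (one_sub_pos ha).le, ← norm_real]
      push_cast
      rfl
    rw [hd.deriv, norm_mul, ← mul_assoc, hp.dens _ (mob_mem ha hz), h1,
      one_sub_norm_mob_sq ha hz]
    have := (one_sub_pos ha).ne'
    have := (one_sub_pos hz).ne'
    field_simp

theorem mob_zero_right (a : ℂ) : mob a 0 = a := by simp [mob]

theorem IsPoincareCover.exists_of_mem (hp : IsPoincareCover Ω lam p) {z : ℂ} (hz : z ∈ Ω) :
    ∃ q, IsPoincareCover Ω lam q ∧ q 0 = z := by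
  obtain ⟨a, ha, rfl⟩ := hp.image ▸ hz
  exact ⟨_, hp.comp_mob ha, by rw [mob_zero_right]⟩

variable (h : IsPoincareDensity Ω lam)
include h

theorem exists_cover {z : ℂ} (hz : z ∈ Ω) : ∃ q, IsPoincareCover Ω lam q ∧ q 0 = z := by
  obtain ⟨p, h1, h2, h3, h4⟩ := h
  exact IsPoincareCover.exists_of_mem ⟨h1, h2, h3, h4⟩ hz

theorem lam_pos {z : ℂ} (hz : z ∈ Ω) : 0 < lam z := by
  obtain ⟨q, hq, -⟩ := exists_cover h hz
  exact hq.lam_pos hz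

theorem densityDist_nonneg (z w : ℂ) : 0 ≤ densityDist Ω lam z w := by
  refine Real.sInf_nonneg ?_
  rintro L ⟨γ, -, -, -, hγ, rfl⟩
  exact intervalIntegral.integral_nonneg zero_le_one fun t ht =>
      mul_nonneg (lam_pos h (hγ t ht)).le (norm_nonneg _)

theorem densityDist_self {z : ℂ} (hz : z ∈ Ω) : densityDist Ω lam z z = 0 := by
  obtain ⟨q, hq, rfl⟩ := exists_cover h hz
  refine le_antisymm ?_ (densityDist_nonneg h _ _)
  simpa [hyp_zero] using hq.densityDist_le (mem_ball_self one_pos)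

theorem densityDist_comm_le {z w : ℂ} (hz : z ∈ Ω) (hw : w ∈ Ω) :
    densityDist Ω lam w z ≤ densityDist Ω lam z w := by
  obtain ⟨q, hq, rfl⟩ := exists_cover h hz
  obtain ⟨v, hv, rfl, he⟩ := hq.exists_densityDist_eq hw
  have := (hq.comp_mob hv).densityDist_le (neg_mem hv)
  rw [he]
  simpa [mob] using this

theorem densityDist_comm {z w : ℂ} (hz : z ∈ Ω) (hw : w ∈ Ω) :
    densityDist Ω lam z w = densityDist Ω lam w z :=
  le_antisymm (densityDist_comm_le h hw hz) (densityDist_comm_le h hz hw)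

theorem densityDist_triangle {z w x : ℂ} (hz : z ∈ Ω) (hw : w ∈ Ω) (hx : x ∈ Ω) :
    densityDist Ω lam z x ≤ densityDist Ω lam z w + densityDist Ω lam w x := by
  obtain ⟨q, hq, rfl⟩ := exists_cover h hz
  obtain ⟨v, hv, rfl, he⟩ := hq.exists_densityDist_eq hw
  obtain ⟨v', hv', rfl, he'⟩ := (hq.comp_mob hv).exists_densityDist_eq hx
  rw [mob_zero_right] at he'
  rw [he, he']
  refine (hq.densityDist_le (mob_mem hv hv')).trans ?_
  have h1 : ‖v‖ < 1 := by simpa using hv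
  have h2 : ‖v'‖ < 1 := by simpa using hv'
  rw [← hyp_add (by simpa using h1) (by simpa using h2)]
  refine hyp_le_hyp (by linarith [norm_nonneg (mob v v')]) (norm_mob_le hv hv') ?_
  rw [div_lt_one (by positivity)]
  nlinarith

theorem isGeodesicIn_of_le {g : ℝ → ℂ} {z w : ℂ} (hg0 : g 0 = z)
    (hg1 : g (densityDist Ω lam z w) = w)
    (hgΩ : ∀ t ∈ Icc 0 (densityDist Ω lam z w), g t ∈ Ω)
    (hle : ∀ s ∈ Icc 0 (densityDist Ω lam z w), ∀ t ∈ Icc 0 (densityDist Ω lam z w), s ≤ t →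
      densityDist Ω lam (g s) (g t) ≤ t - s) :
    IsGeodesicIn Ω (densityDist Ω lam) g z w := by
  have hD := densityDist_nonneg h z w
  have hz : z ∈ Ω := hg0 ▸ hgΩ 0 (left_mem_Icc.2 hD)
  have hw : w ∈ Ω := hg1 ▸ hgΩ _ (right_mem_Icc.2 hD)
  have key : ∀ s ∈ Icc 0 (densityDist Ω lam z w), ∀ t ∈ Icc 0 (densityDist Ω lam z w), s ≤ t →
      densityDist Ω lam (g s) (g t) = t - s := by
    intro s hs t ht hst
    refine le_antisymm (hle s hs t ht hst) ?_
    have h1 := hle 0 (left_mem_Icc.2 hD) s hs hs.1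
    have h2 := hle t ht _ (right_mem_Icc.2 hD) ht.2
    rw [hg0] at h1
    rw [hg1] at h2
    have h3 := densityDist_triangle h hz (hgΩ s hs) hw
    have h4 := densityDist_triangle h (hgΩ s hs) (hgΩ t ht) hw
    linarith
  refine ⟨hg0, hg1, hgΩ, fun s hs t ht => ?_⟩
  rcases le_total s t with hst | hst
  · rw [key s hs t ht hst, abs_of_nonpos (by linarith)]; ring
  · rw [densityDist_comm h (hgΩ s hs) (hgΩ t ht), key t ht s hs hst, abs_of_nonneg (by linarith)]

theorem exists_unitSpeed_geodesic {z w : ℂ} (hz : z ∈ Ω) (hw : w ∈ Ω) :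
    ∃ g g' : ℝ → ℂ, (∀ t, g t ∈ Ω) ∧ (∀ t, HasDerivAt g (g' t) t) ∧
      (∀ t, lam (g t) * ‖g' t‖ = 1) ∧ IsGeodesicIn Ω (densityDist Ω lam) g z w := by
  obtain ⟨q, hq, rfl⟩ := exists_cover h hz
  obtain ⟨v, hv, rfl, he⟩ := hq.exists_densityDist_eq hw
  have hv1 : ‖v‖ < 1 := by simpa using hv
  obtain ⟨u, hu, hvu⟩ : ∃ u : ℂ, ‖u‖ = 1 ∧ v = ‖v‖ * u := by
    by_cases h0 : v = 0
    · exact ⟨1, by simp, by simp [h0]⟩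
    · have h' : (‖v‖ : ℂ) ≠ 0 := by exact_mod_cast norm_ne_zero_iff.2 h0
      refine ⟨v / ‖v‖, ?_, by field_simp⟩
      rw [norm_div, norm_real, norm_norm, div_self (norm_ne_zero_iff.2 h0)]
  have huu : conj u * u = 1 := by
    rw [mul_comm, mul_conj, ← Complex.sq_norm, hu]; simp
  have hb : ∀ r : ℝ, |r| < 1 → (r : ℂ) * u ∈ ball (0 : ℂ) 1 := by
    intro r hr
    simpa [hu] using hr
  have hT : ∀ t : ℝ, |Real.tanh (t / 2)| < 1 := fun t => Real.abs_tanh_lt_one _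
  have hle : ∀ s t : ℝ, s ≤ t → densityDist Ω lam (q (Real.tanh (s / 2) * u))
      (q (Real.tanh (t / 2) * u)) ≤ t - s := by
    intro s t hst
    set σ := Real.tanh (s / 2) with hσ
    set τ := Real.tanh (t / 2) with hτ
    have hσ1 := hT s
    have hτ1 := hT t
    rw [← hσ] at hσ1
    rw [← hτ] at hτ1
    have hmem := mob_mem (neg_mem (hb σ hσ1)) (hb τ hτ1)
    have h1 := (hq.comp_mob (hb σ hσ1)).densityDist_le hmem
    rw [mob_zero_right, mob_mob_neg (hb σ hσ1) (hb τ hτ1)] at h1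
    refine h1.trans_eq ?_
    have h2 : mob (-(σ * u)) (τ * u) = ((τ + -σ) / (1 + τ * -σ) : ℝ) * u := by
      simp only [mob, map_neg, map_mul, conj_ofReal]
      push_cast
      rw [show (1 : ℂ) + -(σ * conj u) * (τ * u) = 1 + τ * -σ by
        linear_combination (-(σ : ℂ) * τ) * huu]
      ring
    have hσ2 : |-σ| < 1 := by rwa [abs_neg]
    have hadd := hyp_add hτ1 hσ2
    have hneg : hyp (-σ) = -hyp σ := by
      simp [hyp]; ring_nf
    rw [hneg, hτ, hyp_tanh, ← hτ, hσ, hyp_tanh, ← hσ] at hadd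
    have hpos : 0 ≤ (τ + -σ) / (1 + τ * -σ) := by
      refine div_nonneg ?_ ?_
      · have : σ ≤ τ := by
          by_contra! hlt
          have h3 := hyp_le_hyp (abs_lt.1 hτ1).1 hlt.le (abs_lt.1 hσ1).2
          rw [hτ, hσ, hyp_tanh, hyp_tanh] at h3
          rw [hτ, hσ, le_antisymm hst h3] at hlt
          exact lt_irrefl _ hlt
        linarith
      · have : |τ * -σ| < 1 := by
          rw [abs_mul]
          nlinarith [abs_nonneg τ, abs_nonneg (-σ)]
        linarith [(abs_lt.1 this).1]
    rw [h2, norm_mul, hu, mul_one, norm_real, Real.norm_of_nonneg hpos, hadd]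
    ring
  have hgD : Real.tanh (hyp ‖v‖ / 2) = ‖v‖ := by
    have h1 := hyp_tanh (hyp ‖v‖)
    obtain ⟨h2, h3⟩ := abs_lt.1 (hT (hyp ‖v‖))
    generalize Real.tanh (hyp ‖v‖ / 2) = r at *
    have h4 := norm_nonneg v
    unfold hyp at h1
    rw [← Real.log_div (by linarith) (by linarith), ← Real.log_div (by linarith) (by linarith)]
      at h1
    have h5 := Real.log_injOn_pos (mem_Ioi.2 (div_pos (by linarith) (by linarith)))
      (mem_Ioi.2 (div_pos (by linarith) (by linarith))) h1
    rw [div_eq_div_iff (by linarith) (by linarith)] at h5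
    linarith
  have hgend : q (Real.tanh (densityDist Ω lam (q 0) (q v) / 2) * u) = q v := by
    rw [he, hgD, ← hvu]
  have hgΩ : ∀ t : ℝ, q (Real.tanh (t / 2) * u) ∈ Ω := fun t => hq.mem (hb _ (hT t))
  refine ⟨fun t => q (Real.tanh (t / 2) * u),
    fun t => deriv q (Real.tanh (t / 2) * u) * (((1 - Real.tanh (t / 2) ^ 2) / 2 : ℝ) * u),
    hgΩ, ?_, ?_, isGeodesicIn_of_le h (by simp) hgend (fun t _ => hgΩ t)
      fun s _ t _ => hle s t⟩
  · intro t
    have h1 : HasDerivAt (fun t : ℝ => Real.tanh (t / 2)) ((1 - Real.tanh (t / 2) ^ 2) / 2) t := by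
      have := (Real.cosh_pos (t / 2)).ne'
      have h2 := ((Real.hasDerivAt_sinh (t / 2)).div (Real.hasDerivAt_cosh (t / 2)) this).comp t
        ((hasDerivAt_id t).div_const 2)
      rw [Real.tanh_eq_sinh_div_cosh]
      refine (h2.congr_of_eventuallyEq (.of_forall fun s =>
        Real.tanh_eq_sinh_div_cosh _)).congr_deriv ?_
      field_simp
    exact (hq.diff _ (hb _ (hT t))).hasDerivAt.comp t (h1.ofReal_comp.mul_const u)
  · intro t
    have h1 := IsPoincareCover.one_sub_pos (hb _ (hT t))
    have h2 : ‖(Real.tanh (t / 2) : ℂ) * u‖ ^ 2 = Real.tanh (t / 2) ^ 2 := by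
      rw [norm_mul, hu, mul_one, norm_real, Real.norm_eq_abs, sq_abs]
    rw [norm_mul, ← mul_assoc, hq.dens _ (hb _ (hT t)), h2, norm_mul, hu, mul_one, norm_real]
    rw [h2] at h1
    rw [Real.norm_of_nonneg (by linarith)]
    field_simp

end Metric

section Comparison

open scoped Topology ComplexConjugate

variable {Ω : Set ℂ} {lam : ℂ → ℝ}

theorem hasDerivAt_log_norm {g : ℝ → ℂ} {g' : ℂ} {t : ℝ} (hg : HasDerivAt g g' t) (c : ℂ) {r : ℝ}
    (hr : 0 < r) : ∃ φ : ℝ, HasDerivAt (fun t => Real.log (‖g t - c‖ ^ 2 + r ^ 2) / 2) φ t ∧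
      |φ| * (‖g t - c‖ + r) ≤ 2 * ‖g'‖ := by
  have h1 := (hg.sub_const c).norm_sq
  have hpos : 0 < ‖g t - c‖ ^ 2 + r ^ 2 := by positivity
  refine ⟨_, ((h1.add_const (r ^ 2)).log hpos.ne').div_const 2, ?_⟩
  have h2 : |inner ℝ (g t - c) g'| ≤ ‖g t - c‖ * ‖g'‖ := abs_real_inner_le_norm _ _
  rw [abs_div, abs_div, abs_mul, abs_of_pos hpos, abs_two, div_div, div_mul_eq_mul_div,
    div_le_iff₀ (by positivity)]
  have h3 : ‖g t - c‖ * (‖g t - c‖ + r) ≤ 2 * (‖g t - c‖ ^ 2 + r ^ 2) := by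
    nlinarith [sq_nonneg (‖g t - c‖ - r)]
  have h4 := mul_le_mul_of_nonneg_right h2 (by positivity : 0 ≤ ‖g t - c‖ + r)
  have h5 := mul_le_mul_of_nonneg_right h3 (norm_nonneg g')
  linarith

/-- Reflection of the lower half-plane in the real axis. -/
def fold (z : ℂ) : ℂ := ⟨z.re, |z.im|⟩

theorem fold_of_nonneg {z : ℂ} (hz : 0 ≤ z.im) : fold z = z :=
  Complex.ext rfl (abs_of_nonneg hz)

theorem fold_of_nonpos {z : ℂ} (hz : z.im ≤ 0) : fold z = conj z :=
  Complex.ext rfl (abs_of_nonpos hz)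

theorem fold_mem (hΩ : ∀ z ∈ Ω, conj z ∈ Ω) {z : ℂ} (hz : z ∈ Ω) : fold z ∈ Ω := by
  rcases le_total 0 z.im with hz0 | hz0
  · rwa [fold_of_nonneg hz0]
  · rw [fold_of_nonpos hz0]; exact hΩ z hz

variable (h : IsPoincareDensity Ω lam)
include h

/-- The Schwarz-Pick lemma: holomorphic maps from the disk are contractions. -/
theorem densityDist_le_hyp {f : ℂ → ℂ} (hf : DifferentiableOn ℂ f (ball 0 1))
    (hfΩ : MapsTo f (ball 0 1) Ω) {v : ℂ} (hv : v ∈ ball (0 : ℂ) 1) :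
    densityDist Ω lam (f 0) (f v) ≤ hyp ‖v‖ := by
  obtain ⟨q, hq, hq0⟩ := exists_cover h (hfΩ (mem_ball_self one_pos))
  obtain ⟨F, hF, hFb, hF0, hqF⟩ := hq.exists_lift_disk hf hfΩ hq0
  have hv1 : ‖v‖ < 1 := by simpa using hv
  rw [← hqF v hv, ← hq0]
  refine (hq.densityDist_le (hFb hv)).trans (hyp_le_hyp (by linarith [norm_nonneg (F v)]) ?_ hv1)
  exact norm_le_norm_of_mapsTo_ball hF (hFb.mono_right ball_subset_closedBall) hF0 hv1

/-- Landau's lower bound for the Poincaré density. -/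
theorem one_le_lam_mul {z x₁ x₂ : ℂ} (hz : z ∈ Ω) (h₁ : x₁ ∉ Ω) (h₂ : x₂ ∉ Ω) (hne : x₁ ≠ x₂)
    (hle : ‖z - x₁‖ ≤ ‖x₂ - x₁‖) : 1 ≤ lam z * (3500 * √(‖z - x₁‖ * ‖x₂ - x₁‖)) := by
  obtain ⟨q, hq, rfl⟩ := exists_cover h hz
  have hx : x₂ - x₁ ≠ 0 := sub_ne_zero.2 hne.symm
  have hn : 0 < ‖x₂ - x₁‖ := norm_pos_iff.2 hx
  have h0 : (0 : ℂ) ∈ ball (0 : ℂ) 1 := mem_ball_self one_pos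
  have hd : ∀ v ∈ ball (0 : ℂ) 1,
      HasDerivAt (fun v => (q v - x₁) / (x₂ - x₁)) (deriv q v / (x₂ - x₁)) v := fun v hv =>
    ((hq.diff v hv).hasDerivAt.sub_const x₁).div_const _
  have key := norm_deriv_le_of_omits (f := fun v => (q v - x₁) / (x₂ - x₁))
    (fun v hv => (hd v hv).differentiableAt.differentiableWithinAt)
    (fun v hv h0 => h₁ ?_) (fun v hv h0 => h₂ ?_) ?_
  · rw [(hd 0 h0).deriv, norm_div, norm_div, div_le_iff₀ hn] at key
    have hs : √(‖q 0 - x₁‖ / ‖x₂ - x₁‖) * ‖x₂ - x₁‖ = √(‖q 0 - x₁‖ * ‖x₂ - x₁‖) := by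
      rw [Real.sqrt_div (norm_nonneg _), Real.sqrt_mul (norm_nonneg _)]
      have h' := (Real.sqrt_pos.2 hn).ne'
      field_simp
      rw [Real.sq_sqrt hn.le]
    rw [mul_assoc, hs] at key
    have hdens := hq.dens 0 h0
    rw [norm_zero] at hdens
    have := mul_le_mul_of_nonneg_left key (hq.lam_pos hz).le
    norm_num at hdens
    linarith
  · rw [div_eq_zero_iff, or_iff_left hx, sub_eq_zero] at h0
    exact h0 ▸ hq.mem hv
  · rw [div_eq_one_iff_eq hx, sub_left_inj] at h0
    exact h0 ▸ hq.mem hv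
  · rw [norm_div, div_le_one hn]
    exact hle

theorem densityDist_conj_le (hΩ : ∀ z ∈ Ω, conj z ∈ Ω) {z w : ℂ} (hz : z ∈ Ω) (hw : w ∈ Ω) :
    densityDist Ω lam (conj z) (conj w) ≤ densityDist Ω lam z w := by
  obtain ⟨q, hq, rfl⟩ := exists_cover h hz
  obtain ⟨v, hv, rfl, he⟩ := hq.exists_densityDist_eq hw
  have hc : ∀ {v : ℂ}, v ∈ ball (0 : ℂ) 1 → conj v ∈ ball (0 : ℂ) 1 := by simp
  have := densityDist_le_hyp h (f := conj ∘ q ∘ conj)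
    (fun v hv => (differentiableAt_conj_conj_iff.2 (hq.diff _ (hc hv))).differentiableWithinAt)
    (fun v hv => hΩ _ (hq.mem (hc hv))) (hc hv)
  rw [he]
  simpa using this

theorem abs_log_sub_log_le {c : ℂ} {r K : ℝ} (hr : 0 < r)
    (hK : ∀ x ∈ Ω, 1 ≤ lam x * (K * (‖x - c‖ + r))) {z w : ℂ} (hz : z ∈ Ω) (hw : w ∈ Ω) :
    |Real.log (‖w - c‖ ^ 2 + r ^ 2) / 2 - Real.log (‖z - c‖ ^ 2 + r ^ 2) / 2|
      ≤ 2 * K * densityDist Ω lam z w := by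
  obtain ⟨g, g', hgΩ, hg, hlam, hg0, hg1, -⟩ := exists_unitSpeed_geodesic h hz hw
  have hD := densityDist_nonneg h z w
  choose φ hφ hφle using fun t => hasDerivAt_log_norm (hg t) c hr
  have hb : ∀ t, ‖φ t‖ ≤ 2 * K := by
    intro t
    have hl := lam_pos h (hgΩ t)
    have hρ : 0 < ‖g t - c‖ + r := by positivity
    have h1 : ‖g' t‖ ≤ K * (‖g t - c‖ + r) := by
      have h2 := hK _ (hgΩ t)
      rw [← hlam t] at h2
      exact le_of_mul_le_mul_left h2 hl
    rw [Real.norm_eq_abs]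
    refine le_of_mul_le_mul_right ((hφle t).trans ?_) hρ
    linarith
  have := (convex_univ (𝕜 := ℝ) (E := ℝ)).norm_image_sub_le_of_norm_hasDerivWithin_le
    (fun t _ => (hφ t).hasDerivWithinAt) (fun t _ => hb t) (mem_univ 0)
    (mem_univ (densityDist Ω lam z w))
  rw [hg0, hg1] at this
  simpa [abs_of_nonneg hD] using this

theorem exists_real_between {z w : ℂ} (hz : z ∈ Ω) (hw : w ∈ Ω) (hz0 : 0 ≤ z.im)
    (hw0 : w.im ≤ 0) : ∃ r ∈ Ω, r.im = 0 ∧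
      densityDist Ω lam z r + densityDist Ω lam r w = densityDist Ω lam z w := by
  obtain ⟨g, g', hgΩ, hg, -, hg0, hg1, -, hgd⟩ := exists_unitSpeed_geodesic h hz hw
  have hD := densityDist_nonneg h z w
  have hc : Continuous fun t => (g t).im :=
    continuous_im.comp (continuous_iff_continuousAt.2 fun t => (hg t).continuousAt)
  obtain ⟨t, ht, ht0⟩ := intermediate_value_Icc' hD hc.continuousOn
    (show (0 : ℝ) ∈ Icc _ _ by rw [hg0, hg1]; exact ⟨hw0, hz0⟩)
  refine ⟨g t, hgΩ t, ht0, ?_⟩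
  have h1 := hgd 0 (left_mem_Icc.2 hD) t ht
  have h2 := hgd t ht _ (right_mem_Icc.2 hD)
  rw [hg0] at h1
  rw [hg1] at h2
  rw [h1, h2, abs_of_nonpos (by linarith [ht.1]), abs_of_nonpos (by linarith [ht.2])]
  ring

theorem densityDist_fold_le (hΩ : ∀ z ∈ Ω, conj z ∈ Ω) {z w : ℂ} (hz : z ∈ Ω) (hw : w ∈ Ω) :
    densityDist Ω lam (fold z) (fold w) ≤ densityDist Ω lam z w := by
  have key : ∀ {z w : ℂ}, z ∈ Ω → w ∈ Ω → 0 ≤ z.im → w.im ≤ 0 →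
      densityDist Ω lam (fold z) (fold w) ≤ densityDist Ω lam z w := by
    intro z w hz hw hz0 hw0
    rw [fold_of_nonneg hz0, fold_of_nonpos hw0]
    obtain ⟨r, hr, hr0, he⟩ := exists_real_between h hz hw hz0 hw0
    have h1 := densityDist_triangle h hz hr (hΩ w hw)
    have h2 := densityDist_conj_le h hΩ hr hw
    rw [conj_eq_iff_im.2 hr0] at h2
    linarith
  rcases le_total 0 z.im with hz0 | hz0 <;> rcases le_total 0 w.im with hw0 | hw0
  · rw [fold_of_nonneg hz0, fold_of_nonneg hw0]
  · exact key hz hw hz0 hw0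
  · rw [densityDist_comm h (fold_mem hΩ hz) (fold_mem hΩ hw), densityDist_comm h hz hw]
    exact key hw hz hw0 hz0
  · rw [fold_of_nonpos hz0, fold_of_nonpos hw0]
    exact densityDist_conj_le h hΩ hz hw

theorem isGeodesicIn_fold (hΩ : ∀ z ∈ Ω, conj z ∈ Ω) {g : ℝ → ℂ} {z w : ℂ}
    (hg : IsGeodesicIn Ω (densityDist Ω lam) g z w) (hz : 0 ≤ z.im) (hw : 0 ≤ w.im) :
    IsGeodesicIn Ω (densityDist Ω lam) (fun t => fold (g t)) z w := by
  obtain ⟨hg0, hg1, hgΩ, hgd⟩ := hg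
  refine isGeodesicIn_of_le h (by rw [hg0, fold_of_nonneg hz]) (by rw [hg1, fold_of_nonneg hw])
    (fun t ht => fold_mem hΩ (hgΩ t ht)) fun s hs t ht hst => ?_
  refine (densityDist_fold_le h hΩ (hgΩ s hs) (hgΩ t ht)).trans_eq ?_
  rw [hgd s hs t ht, abs_of_nonpos (by linarith)]
  ring

theorem isGeodesicIn_conj (hΩ : ∀ z ∈ Ω, conj z ∈ Ω) {g : ℝ → ℂ} {z w : ℂ}
    (hg : IsGeodesicIn Ω (densityDist Ω lam) g z w) (hz : z.im = 0) (hw : w.im = 0) :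
    IsGeodesicIn Ω (densityDist Ω lam) (fun t => conj (g t)) z w := by
  obtain ⟨hg0, hg1, hgΩ, hgd⟩ := hg
  refine isGeodesicIn_of_le h (by rw [hg0, conj_eq_iff_im.2 hz])
    (by rw [hg1, conj_eq_iff_im.2 hw]) (fun t ht => hΩ _ (hgΩ t ht)) fun s hs t ht hst => ?_
  refine (densityDist_conj_le h hΩ (hgΩ s hs) (hgΩ t ht)).trans_eq ?_
  rw [hgd s hs t ht, abs_of_nonpos (by linarith)]
  ring

end Comparison

section Comb

open scoped Topology ComplexConjugate

/-- The complement of a closed subset of `[0, ∞)` whose complementary intervals are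
`(-∞, 0)` and the `(aₙ, bₙ)`, where the relative lengths of the latter tend to zero. -/
structure IsComb (Ω : Set ℂ) (a b : ℕ → ℝ) : Prop where
  isOpen : IsOpen Ω
  mem_of_im_ne_zero : ∀ z : ℂ, z.im ≠ 0 → z ∈ Ω
  ofReal_mem_iff : ∀ x : ℝ, (x : ℂ) ∈ Ω ↔ x < 0 ∨ ∃ n, a n < x ∧ x < b n
  pos : ∀ n, 0 < a n
  lt : ∀ n, a n < b n
  le : ∀ n, b n ≤ a (n + 1)
  tendsto : Tendsto a atTop atTop
  tendsto_ratio : Tendsto (fun n => (b n - a n) / a n) atTop (𝓝 0)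

theorem IsDenjoyDomain.mem_of_im_ne_zero {Ω : Set ℂ} (hΩ : IsDenjoyDomain Ω) {x : ℝ}
    (hx : (x : ℂ) ∈ Ω) {z : ℂ} (hz : z.im ≠ 0) : z ∈ Ω := by
  obtain ⟨ε, hε, hball⟩ := Metric.isOpen_iff.1 hΩ.1 _ hx
  have key : ∀ U : Set ℂ, IsPreconnected U → (∀ w ∈ U, w.im ≠ 0) →
      (∃ c : ℝ, |c| < ε ∧ x + c * I ∈ U) → z ∈ U → z ∈ Ω := by
    rintro U hU hU0 ⟨c, hc, hcU⟩ hzU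
    refine hU.subset_of_closure_inter_subset hΩ.1
      ⟨_, hcU, hball (by simpa [dist_eq_norm] using hc)⟩ ?_ hzU
    rintro w ⟨hw, hwU⟩
    by_contra hwΩ
    exact hU0 w hwU (hΩ.2.2 ⟨hw, by rwa [hΩ.1.interior_eq]⟩)
  rcases hz.lt_or_gt with h | h
  · refine key {w | w.im < 0} (convex_halfSpace_im_lt 0).isPreconnected (fun w hw => ne_of_lt hw)
      ⟨-(ε / 2), ?_, ?_⟩ h
    · rw [abs_neg, abs_of_pos (by linarith)]; linarith
    · simpa using hε
  · refine key {w | 0 < w.im} (convex_halfSpace_im_gt 0).isPreconnected (fun w hw => ne_of_gt hw)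
      ⟨ε / 2, ?_, ?_⟩ h
    · rw [abs_of_pos (by linarith)]; linarith
    · simpa using hε

namespace IsComb

variable {Ω : Set ℂ} {a b : ℕ → ℝ}

theorem monotone (hC : IsComb Ω a b) : Monotone a :=
  monotone_nat_of_le_succ fun n => (hC.lt n).le.trans (hC.le n)

theorem neg_mem (hC : IsComb Ω a b) {s : ℝ} (hs : 0 < s) : ((-s : ℝ) : ℂ) ∈ Ω :=
  (hC.ofReal_mem_iff _).2 (Or.inl (by linarith))

theorem window_mem (hC : IsComb Ω a b) {n : ℕ} {x : ℝ} (hx : x ∈ Ioo (a n) (b n)) :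
    (x : ℂ) ∈ Ω :=
  (hC.ofReal_mem_iff _).2 (Or.inr ⟨n, hx⟩)

theorem conj_mem (hC : IsComb Ω a b) : ∀ z ∈ Ω, conj z ∈ Ω := by
  intro z hz
  by_cases h : z.im = 0
  · rwa [conj_eq_iff_im.2 h]
  · exact hC.mem_of_im_ne_zero _ (by simpa using h)

theorem left_notMem (hC : IsComb Ω a b) (n : ℕ) : (a n : ℂ) ∉ Ω := by
  rw [hC.ofReal_mem_iff]
  rintro (h | ⟨k, h1, h2⟩)
  · linarith [hC.pos n]
  · rcases le_or_gt n k with hk | hk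
    · linarith [hC.monotone hk]
    · linarith [hC.monotone hk, hC.le k]

theorem right_notMem (hC : IsComb Ω a b) (n : ℕ) : (b n : ℂ) ∉ Ω := by
  rw [hC.ofReal_mem_iff]
  rintro (h | ⟨k, h1, h2⟩)
  · linarith [hC.pos n, hC.lt n]
  · rcases lt_trichotomy n k with hk | rfl | hk
    · linarith [hC.monotone hk, hC.le n]
    · linarith
    · linarith [hC.monotone hk, hC.le k, hC.lt n]

theorem zero_notMem (hC : IsComb Ω a b) : (0 : ℂ) ∉ Ω := by
  rw [← ofReal_zero, hC.ofReal_mem_iff]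
  rintro (h | ⟨k, h1, h2⟩)
  · exact lt_irrefl _ h
  · linarith [hC.pos k]

theorem exists_ofReal_of_notMem (hC : IsComb Ω a b) {z : ℂ} (hz : z ∉ Ω) :
    ∃ x : ℝ, 0 ≤ x ∧ z = x := by
  have him : z.im = 0 := by
    by_contra h
    exact hz (hC.mem_of_im_ne_zero z h)
  have hzx : z = (z.re : ℂ) := Complex.ext rfl (by simpa using him)
  refine ⟨z.re, ?_, hzx⟩
  by_contra! h
  rw [hzx, hC.ofReal_mem_iff] at hz
  exact hz (Or.inl h)

theorem exists_notMem_near (hC : IsComb Ω a b) {m : ℕ} {ε : ℝ} (hε : 0 ≤ ε)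
    (hm : ∀ k ≥ m, (b k - a k) / a k ≤ ε) {X : ℝ} (hX : a m ≤ X) :
    ∃ x : ℝ, X ≤ x ∧ x ≤ X * (1 + ε) ∧ (x : ℂ) ∉ Ω := by
  have hX0 := (hC.pos m).trans_le hX
  by_cases h : (X : ℂ) ∈ Ω
  · rcases (hC.ofReal_mem_iff X).1 h with h1 | ⟨k, h1, h2⟩
    · linarith
    · have hk : m ≤ k := by
        by_contra! hk
        linarith [hC.monotone hk, hC.le k]
      have h3 := hm k hk
      rw [div_le_iff₀ (hC.pos k)] at h3
      refine ⟨b k, h2.le, ?_, hC.right_notMem k⟩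
      nlinarith
  · exact ⟨X, le_rfl, by nlinarith, h⟩

theorem eventually_ratio_le (hC : IsComb Ω a b) {ε : ℝ} (hε : 0 < ε) :
    ∃ m, ∀ k ≥ m, (b k - a k) / a k ≤ ε :=
  eventually_atTop.1 ((hC.tendsto_ratio.eventually_lt_const hε).mono fun _ h => h.le)

variable {lam : ℂ → ℝ}

theorem one_le_lam_mul_sqrt (hC : IsComb Ω a b) (h : IsPoincareDensity Ω lam) {m : ℕ}
    (hm : ∀ k ≥ m, (b k - a k) / a k ≤ 1) {z : ℂ} (hz : z ∈ Ω) :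
    1 ≤ lam z * (7000 * √(infDist z Ωᶜ * (‖z‖ + a m))) := by
  obtain ⟨x₁, hx₁, hd⟩ := hC.isOpen.isClosed_compl.exists_infDist_eq_dist
    ⟨0, hC.zero_notMem⟩ z
  have hy : infDist z Ωᶜ ≤ ‖z‖ := by
    simpa using infDist_le_dist_of_mem (x := z) (show (0 : ℂ) ∈ Ωᶜ from hC.zero_notMem)
  rw [hd, dist_eq_norm] at *
  obtain ⟨x, hx0, rfl⟩ := hC.exists_ofReal_of_notMem hx₁
  have ha := hC.pos m
  have hz0 := norm_nonneg z
  have hx2 : x ≤ 2 * ‖z‖ := by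
    have := norm_sub_norm_le (x : ℂ) z
    rw [norm_sub_rev, norm_real, Real.norm_of_nonneg hx0] at this
    linarith
  obtain ⟨x', h1, h2, h3⟩ := hC.exists_notMem_near zero_le_one hm
    (X := x + (‖z‖ + a m)) (by linarith)
  have hn : ‖(x' : ℂ) - x‖ = x' - x := by
    rw [← ofReal_sub, norm_real, Real.norm_of_nonneg (by linarith)]
  have key := one_le_lam_mul h hz hx₁ h3 (by
    intro he
    have := ofReal_injective he
    linarith) (by rw [hn]; linarith)
  refine key.trans ?_
  rw [hn]
  have hs : √(‖z - x‖ * (x' - x)) ≤ 2 * √(‖z - x‖ * (‖z‖ + a m)) := by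
    rw [show (2 : ℝ) = √4 by rw [show (4 : ℝ) = 2 ^ 2 by norm_num]; simp,
      ← Real.sqrt_mul (by norm_num)]
    refine Real.sqrt_le_sqrt ?_
    nlinarith [norm_nonneg (z - x)]
  have := lam_pos h hz
  nlinarith

theorem one_le_lam_mul_add (hC : IsComb Ω a b) (h : IsPoincareDensity Ω lam) {m : ℕ}
    (hm : ∀ k ≥ m, (b k - a k) / a k ≤ 1) {z : ℂ} (hz : z ∈ Ω) :
    1 ≤ lam z * (7000 * (‖z - 0‖ + a m)) := by
  refine (hC.one_le_lam_mul_sqrt h hm hz).trans ?_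
  have hy : infDist z Ωᶜ ≤ ‖z‖ := by
    simpa using infDist_le_dist_of_mem (x := z) (show (0 : ℂ) ∈ Ωᶜ from hC.zero_notMem)
  have ha := hC.pos m
  have hz0 := norm_nonneg z
  have := lam_pos h hz
  rw [sub_zero]
  gcongr
  refine Real.sqrt_le_iff.2 ⟨by positivity, ?_⟩
  nlinarith

theorem one_le_lam_mul_window (hC : IsComb Ω a b) (h : IsPoincareDensity Ω lam) {m : ℕ} {ε : ℝ}
    (hε : 0 < ε) (hε1 : ε ≤ 1) (hm : ∀ k ≥ m, (b k - a k) / a k ≤ ε) {w : ℝ}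
    (hw : w ∈ Ioo (a m) (b m)) {z : ℂ} (hz : z ∈ Ω) :
    1 ≤ lam z * (7000 * (‖z - w‖ + ε * a m)) := by
  have ha := hC.pos m
  have hb := hm m le_rfl
  rw [div_le_iff₀ ha] at hb
  obtain ⟨hw1, hw2⟩ := hw
  have hn0 := norm_nonneg (z - w)
  have hεa := mul_pos hε ha
  obtain ⟨x', h1, h2, h3⟩ := hC.exists_notMem_near hε.le hm
    (X := a m + (‖z - w‖ + ε * a m)) (by linarith)
  have hn : ‖(x' : ℂ) - a m‖ = x' - a m := by
    rw [← ofReal_sub, norm_real, Real.norm_of_nonneg (by linarith)]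
  have hle : ‖z - a m‖ ≤ ‖z - w‖ + ε * a m := by
    have h4 := norm_sub_le_norm_sub_add_norm_sub z (w : ℂ) (a m : ℂ)
    rw [← ofReal_sub, norm_real, Real.norm_of_nonneg (by linarith)] at h4
    linarith
  have key := one_le_lam_mul h hz (hC.left_notMem m) h3 (by
    intro he
    have := ofReal_injective he
    linarith) (by rw [hn]; linarith)
  refine key.trans ?_
  rw [hn]
  have := lam_pos h hz
  have hs : √(‖z - a m‖ * (x' - a m)) ≤ 2 * (‖z - w‖ + ε * a m) := by
    refine Real.sqrt_le_iff.2 ⟨by positivity, ?_⟩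
    have h5 : x' - a m ≤ 3 * (‖z - w‖ + ε * a m) := by nlinarith
    nlinarith [norm_nonneg (z - a m)]
  nlinarith

/-- The windows far away are hyperbolically far from the negative half-line. -/
theorem exists_le_densityDist (hC : IsComb Ω a b) (h : IsPoincareDensity Ω lam) {D : ℝ}
    (hD : 0 ≤ D) : ∃ N, ∀ m ≥ N, ∀ w ∈ Ioo (a m) (b m), ∀ s > 0,
      D ≤ densityDist Ω lam ((-s : ℝ) : ℂ) (w : ℝ) := by
  set ε := Real.exp (-(14000 * D)) with hε
  have hε0 : 0 < ε := Real.exp_pos _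
  have hε1 : ε ≤ 1 := Real.exp_le_one_iff.2 (by linarith)
  obtain ⟨N, hN⟩ := hC.eventually_ratio_le hε0
  refine ⟨N, fun m hm w hw s hs => ?_⟩
  have ha := hC.pos m
  have hεa := mul_pos hε0 ha
  have key := abs_log_sub_log_le h hεa (fun x hx => hC.one_le_lam_mul_window h hε0 hε1
    (fun k hk => hN k (hm.le.trans hk)) hw hx) (hC.neg_mem hs) (hC.window_mem hw)
  have h1 := (abs_le.1 key).1
  rw [sub_self, norm_zero, zero_pow two_ne_zero, zero_add, Real.log_pow,
    Real.log_mul hε0.ne' ha.ne', hε, Real.log_exp, ← hε] at h1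
  have h2 : Real.log (a m ^ 2) ≤ Real.log (‖((-s : ℝ) : ℂ) - w‖ ^ 2 + (ε * a m) ^ 2) := by
    refine Real.log_le_log (by positivity) ?_
    rw [← ofReal_sub, norm_real, Real.norm_eq_abs, sq_abs]
    nlinarith [hw.1, sq_nonneg (ε * a m)]
  rw [Real.log_pow] at h2
  simp only [Nat.cast_ofNat] at h1 h2
  linarith

end IsComb

end Comb

section UpperBound

open scoped Topology ComplexConjugate

theorem exists_unit_sqrt {u : ℂ} (hu : ‖u‖ = 1) : ∃ ω : ℂ, ω ^ 2 = u ∧ ‖ω‖ = 1 ∧ 0 ≤ ω.re := by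
  obtain ⟨ω, hω⟩ := IsAlgClosed.exists_pow_nat_eq u two_pos
  have h1 : ‖ω‖ = 1 := by
    have : ‖ω‖ ^ 2 = 1 := by rw [← norm_pow, hω, hu]
    exact (pow_eq_one_iff_of_nonneg (norm_nonneg ω) two_ne_zero).1 this
  rcases le_total 0 ω.re with h | h
  · exact ⟨ω, hω, h1, h⟩
  · exact ⟨-ω, by rw [neg_sq, hω], by rwa [norm_neg], by simpa using h⟩

theorem hyp_le_log {r c : ℝ} (hr : 0 ≤ r) (hc : 0 < c) (h : c ≤ 1 - r ^ 2) :
    hyp r ≤ Real.log (4 / c) := by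
  have h1 : r < 1 := by nlinarith
  rw [hyp, ← Real.log_div (by linarith) (by linarith)]
  refine Real.log_le_log (div_pos (by linarith) (by linarith)) ?_
  rw [div_le_div_iff₀ (by linarith) hc]
  nlinarith

namespace IsComb

variable {Ω : Set ℂ} {a b : ℕ → ℝ} {lam : ℂ → ℝ}

theorem infDist_pos (hC : IsComb Ω a b) {z : ℂ} (hz : z ∈ Ω) : 0 < infDist z Ωᶜ :=
  (hC.isOpen.isClosed_compl.notMem_iff_infDist_pos ⟨0, hC.zero_notMem⟩).1 (by simpa using hz)

theorem infDist_le_norm (hC : IsComb Ω a b) (z : ℂ) : infDist z Ωᶜ ≤ ‖z‖ := by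
  simpa using infDist_le_dist_of_mem (x := z) (show (0 : ℂ) ∈ Ωᶜ from hC.zero_notMem)

theorem densityDist_neg_norm_le (hC : IsComb Ω a b) (h : IsPoincareDensity Ω lam) {z : ℂ}
    (hz : z.im ≠ 0) :
    densityDist Ω lam ((-‖z‖ : ℝ) : ℂ) z ≤ Real.log (8 * ‖z‖ / |z.im|) := by
  have hz0 : z ≠ 0 := by rintro rfl; exact hz rfl
  set s := ‖z‖ with hs
  have hs0 : 0 < s := norm_pos_iff.2 hz0
  have hsC : (s : ℂ) ≠ 0 := ofReal_ne_zero.2 hs0.ne'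
  obtain ⟨ω, hω, hω1, hωre⟩ := exists_unit_sqrt (u := -z / s) (by
    rw [norm_div, norm_neg, norm_real, ← hs, Real.norm_of_nonneg hs0.le, div_self hs0.ne'])
  have hzω : z = -(s * ω ^ 2) := by rw [hω]; field_simp
  have hω2 : ω.re ^ 2 + ω.im ^ 2 = 1 := by
    have := Complex.sq_norm ω
    rw [hω1, normSq_apply] at this
    linarith
  have hre : |z.im| ≤ 2 * s * ω.re := by
    have h1 : z.im = -(2 * s * ω.re * ω.im) := by
      rw [hzω, sq]
      simp
      ring
    rw [h1, abs_neg, abs_mul, abs_of_nonneg (by positivity)]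
    have : |ω.im| ≤ 1 := by rw [← hω1]; exact abs_im_le_norm ω
    nlinarith [abs_nonneg ω.im, mul_nonneg hs0.le hωre]
  have him := abs_pos.2 hz
  have hre0 : 0 < ω.re := by
    by_contra! h0
    nlinarith
  have hω0 : ω + 1 ≠ 0 := by
    intro h0
    have := congrArg re h0
    simp at this
    linarith
  set v := (ω - 1) / (ω + 1) with hv
  have hnv : ω.re ≤ 1 - ‖v‖ ^ 2 := by
    have h1 : ‖ω + 1‖ ^ 2 = 2 + 2 * ω.re := by
      rw [Complex.sq_norm, normSq_apply]; simp; nlinarith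
    have h2 : ‖ω - 1‖ ^ 2 = 2 - 2 * ω.re := by
      rw [Complex.sq_norm, normSq_apply]; simp; nlinarith
    rw [hv, norm_div, div_pow, h1, h2, le_sub_iff_add_le, ← le_sub_iff_add_le',
      div_le_iff₀ (by linarith)]
    nlinarith
  have hv1 : v ∈ ball (0 : ℂ) 1 := by
    rw [mem_ball_zero_iff]
    nlinarith [norm_nonneg v]
  have hne : ∀ {v : ℂ}, v ∈ ball (0 : ℂ) 1 → 1 - v ≠ 0 := by
    intro v hv h0
    rw [← sub_eq_zero.1 h0] at hv
    simp at hv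
  have hmaps : MapsTo (fun v : ℂ => -(s * ((1 + v) / (1 - v)) ^ 2)) (ball 0 1) Ω := by
    intro v hv
    set W := (1 + v) / (1 - v) with hW
    have hWre : 0 < W.re := by
      have h1 : ‖v‖ ^ 2 < 1 := by linarith [IsPoincareCover.one_sub_pos hv]
      rw [Complex.sq_norm, normSq_apply] at h1
      rw [hW, div_re, ← add_div]
      refine div_pos ?_ (normSq_pos.2 (hne hv))
      simp
      nlinarith
    by_cases him : (-(s * W ^ 2)).im = 0
    · have h2 : W.im = 0 := by
        have : (-(s * W ^ 2)).im = -(2 * s * W.re * W.im) := by rw [sq]; simp; ring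
        rw [this] at him
        have h3 : 2 * s * W.re ≠ 0 := by positivity
        simpa [h3] using him
      have h3 : W = (W.re : ℂ) := Complex.ext rfl (by simpa using h2)
      show -(s * W ^ 2) ∈ Ω
      have h4 := hC.neg_mem (s := s * W.re ^ 2) (by positivity)
      rw [h3]
      push_cast at h4
      exact h4
    · exact hC.mem_of_im_ne_zero _ him
  have hdiff : DifferentiableOn ℂ (fun v : ℂ => -(s * ((1 + v) / (1 - v)) ^ 2)) (ball 0 1) := by
    intro v hv
    have := hne hv
    refine DifferentiableAt.differentiableWithinAt ?_
    fun_prop (disch := assumption)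
  have key := densityDist_le_hyp h hdiff hmaps hv1
  have hf : (1 + v) / (1 - v) = ω := by
    rw [div_eq_iff (hne hv1), hv]
    field_simp
    ring
  simp only [hf, ← hzω, add_zero, sub_zero, div_one, one_pow, mul_one] at key
  push_cast
  refine key.trans ((hyp_le_log (norm_nonneg v) hre0 hnv).trans
    (Real.log_le_log (by positivity) ?_))
  rw [div_le_div_iff₀ hre0 him]
  linarith

theorem exists_densityDist_neg_le (hC : IsComb Ω a b) (h : IsPoincareDensity Ω lam) {z : ℂ}
    (hz : z ∈ Ω) : ∃ s > 0, densityDist Ω lam ((-s : ℝ) : ℂ) z ≤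
      Real.log (96 * ‖z‖ / infDist z Ωᶜ) := by
  set y := infDist z Ωᶜ with hy
  have hy0 : 0 < y := hC.infDist_pos hz
  have hyz : y ≤ ‖z‖ := hC.infDist_le_norm z
  obtain ⟨c, hc, hcz⟩ : ∃ c : ℝ, |c| = 1 / 2 ∧ y / 2 ≤ |z.im + y * c| := by
    rcases le_total 0 z.im with h0 | h0
    · exact ⟨1 / 2, by norm_num, by rw [abs_of_nonneg] <;> linarith⟩
    · exact ⟨-(1 / 2), by norm_num, by rw [abs_of_nonpos] <;> linarith⟩
  have hmaps : MapsTo (fun v : ℂ => z + y * v) (ball 0 1) Ω := by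
    intro v hv
    by_contra h0
    have h1 := infDist_le_dist_of_mem (x := z) (show z + y * v ∈ Ωᶜ from h0)
    rw [dist_eq_norm, ← hy] at h1
    rw [mem_ball_zero_iff] at hv
    have h2 : ‖z - (z + y * v)‖ = y * ‖v‖ := by
      rw [sub_add_cancel_left, norm_neg, norm_mul, norm_real, Real.norm_of_nonneg hy0.le]
    nlinarith
  have hcn : ‖(c : ℂ) * I‖ = 1 / 2 := by simpa using hc
  have hcI : (c : ℂ) * I ∈ ball (0 : ℂ) 1 := by
    rw [mem_ball_zero_iff, hcn]; norm_num
  have h1 := densityDist_le_hyp h (f := fun v : ℂ => z + y * v)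
    (by fun_prop) hmaps hcI
  set z' := z + y * (c * I) with hz'
  have hz'Ω : z' ∈ Ω := hmaps hcI
  have him : z'.im = z.im + y * c := by simp [hz']
  have h3 : hyp (1 / 2) = Real.log 3 := by
    rw [hyp, ← Real.log_div (by norm_num) (by norm_num)]
    norm_num
  simp only [mul_zero, add_zero, hcn, h3] at h1
  have him0 : 0 < |z'.im| := by rw [him]; linarith
  have h4 := hC.densityDist_neg_norm_le h (abs_pos.1 him0)
  have hnz' : ‖z'‖ ≤ 3 / 2 * ‖z‖ := by
    have := norm_add_le z (y * (c * I))
    rw [norm_mul, norm_real, Real.norm_of_nonneg hy0.le, hcn] at this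
    linarith
  have hz'0 : 0 < ‖z'‖ := by
    rw [norm_pos_iff]; intro h0; rw [h0] at him0; simp at him0
  refine ⟨‖z'‖, hz'0, ?_⟩
  have h5 := densityDist_triangle h (hC.neg_mem hz'0) hz'Ω hz
  rw [densityDist_comm h hz'Ω hz] at h5
  refine (h5.trans (add_le_add h4 h1)).trans ?_
  rw [← Real.log_mul (by positivity) (by norm_num)]
  refine Real.log_le_log (by positivity) ?_
  rw [div_mul_eq_mul_div, div_le_div_iff₀ him0 hy0]
  rw [← him] at hcz
  nlinarith [mul_le_mul hnz' hcz (by positivity) (by positivity)]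

end IsComb

end UpperBound

section Main

open scoped Topology ComplexConjugate

namespace IsComb

variable {Ω : Set ℂ} {a b : ℕ → ℝ} {lam : ℂ → ℝ}

theorem infDist_le_of_far (hC : IsComb Ω a b) (h : IsPoincareDensity Ω lam) {z : ℂ} (hz : z ∈ Ω)
    {t : ℝ} (ht : ∀ s > 0, t - 1 ≤ densityDist Ω lam ((-s : ℝ) : ℂ) z) :
    infDist z Ωᶜ ≤ 18 ^ 2 * ‖z‖ * Real.exp (-(t / 2)) ^ 2 := by
  obtain ⟨s, hs, hle⟩ := hC.exists_densityDist_neg_le h hz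
  have hy := hC.infDist_pos hz
  have hz0 : 0 < ‖z‖ := hy.trans_le (hC.infDist_le_norm z)
  have h1 := (ht s hs).trans hle
  rw [Real.le_log_iff_exp_le (by positivity), le_div_iff₀ hy, Real.exp_sub, div_mul_eq_mul_div,
    div_le_iff₀ (Real.exp_pos _)] at h1
  have h2 : Real.exp (-(t / 2)) ^ 2 = (Real.exp t)⁻¹ := by
    rw [← Real.exp_nat_mul, ← Real.exp_neg]
    congr 1
    push_cast
    ring
  rw [h2, ← div_eq_mul_inv, le_div_iff₀ (Real.exp_pos _)]
  have := Real.exp_one_lt_d9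
  nlinarith

/-- Along a curve of unit speed which moves away from the negative half-line, the logarithm of the
modulus is controlled. -/
theorem log_le_of_far (hC : IsComb Ω a b) (h : IsPoincareDensity Ω lam) {m : ℕ}
    (hm : ∀ k ≥ m, (b k - a k) / a k ≤ 1) {g g' : ℝ → ℂ} {T : ℝ} (hT : 0 ≤ T)
    (hgΩ : ∀ t, g t ∈ Ω) (hg : ∀ t, HasDerivAt g (g' t) t) (hlam : ∀ t, lam (g t) * ‖g' t‖ = 1)
    (hfar : ∀ t ∈ Icc 0 T, ∀ s > 0, t - 1 ≤ densityDist Ω lam ((-s : ℝ) : ℂ) (g t)) :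
    Real.log (‖g T - 0‖ ^ 2 + a m ^ 2) / 2 ≤ Real.log (‖g 0 - 0‖ ^ 2 + a m ^ 2) / 2 + 504000 := by
  have ha := hC.pos m
  choose φ hφ hφle using fun t => hasDerivAt_log_norm (hg t) 0 ha
  have hb : ∀ t ∈ Icc 0 T, φ t ≤ 252000 * Real.exp (-(t / 2)) := by
    intro t ht
    have hl := lam_pos h (hgΩ t)
    set ρ := ‖g t - 0‖ + a m with hρ
    have hρ0 : 0 < ρ := by positivity
    set e := Real.exp (-(t / 2)) with he
    have he0 : 0 < e := Real.exp_pos _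
    have h1 : √(infDist (g t) Ωᶜ * (‖g t‖ + a m)) ≤ 18 * ρ * e := by
      have h2 := hC.infDist_le_of_far h (hgΩ t) (hfar t ht)
      rw [sub_zero] at hρ
      refine Real.sqrt_le_iff.2 ⟨by positivity, ?_⟩
      rw [← hρ]
      have h3 : ‖g t‖ ≤ ρ := by linarith
      calc infDist (g t) Ωᶜ * ρ ≤ 18 ^ 2 * ‖g t‖ * e ^ 2 * ρ := by gcongr
        _ ≤ 18 ^ 2 * ρ * e ^ 2 * ρ := by gcongr
        _ = (18 * ρ * e) ^ 2 := by ring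
    have h2 : ‖g' t‖ ≤ 126000 * ρ * e := by
      have h3 := hC.one_le_lam_mul_sqrt h hm (hgΩ t)
      rw [← hlam t] at h3
      have h4 := le_of_mul_le_mul_left h3 hl
      linarith
    refine (le_abs_self _).trans (le_of_mul_le_mul_right ((hφle t).trans ?_) hρ0)
    linarith
  have hexp : ∀ t : ℝ, HasDerivAt (fun t : ℝ => 504000 * Real.exp (-(t / 2)))
      (-(252000 * Real.exp (-(t / 2)))) t := by
    intro t
    have := ((((hasDerivAt_id t).div_const 2).neg).exp).const_mul 504000
    refine this.congr_deriv ?_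
    simp only [id, Pi.neg_apply]
    ring
  have hd := fun t => (hφ t).add (hexp t)
  have hanti := antitoneOn_of_deriv_nonpos (convex_Icc 0 T)
    (fun t _ => (hd t).continuousAt.continuousWithinAt)
    (fun t _ => (hd t).differentiableAt.differentiableWithinAt) (by
      intro t ht
      rw [(hd t).deriv]
      linarith [hb t (interior_subset ht)])
  have := hanti (left_mem_Icc.2 hT) (right_mem_Icc.2 hT) hT
  simp only [Pi.add_apply, zero_div, neg_zero, Real.exp_zero, mul_one] at this
  linarith [Real.exp_pos (-(T / 2))]

theorem exists_almost_nearest (h : IsPoincareDensity Ω lam) (w : ℂ) :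
    ∃ s > 0, ∀ s' > 0, densityDist Ω lam ((-s : ℝ) : ℂ) w
      ≤ densityDist Ω lam ((-s' : ℝ) : ℂ) w + 1 := by
  set S := (fun s : ℝ => densityDist Ω lam ((-s : ℝ) : ℂ) w) '' Ioi 0 with hS
  have hne : S.Nonempty := ⟨_, 1, mem_Ioi.2 one_pos, rfl⟩
  obtain ⟨_, ⟨s, hs, rfl⟩, hlt⟩ := Real.lt_sInf_add_pos hne one_pos
  refine ⟨s, hs, fun s' hs' => hlt.le.trans ?_⟩
  gcongr
  exact csInf_le ⟨0, by rintro _ ⟨x, -, rfl⟩; exact densityDist_nonneg h _ _⟩ ⟨s', hs', rfl⟩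

theorem exists_window_large (hC : IsComb Ω a b) (N : ℕ) (M : ℝ) :
    ∃ m ≥ N, M < Real.log (a m) :=
  (((Real.tendsto_log_atTop.comp hC.tendsto).eventually_gt_atTop M).and
    (eventually_ge_atTop N)).exists.imp fun _ hm => ⟨hm.2, hm.1⟩

/-- The bigon formed by a geodesic in the closed upper half-plane from the negative half-line to a
window far away and by its reflection is fat. -/
theorem not_gromovHyperbolicWith (hC : IsComb Ω a b) (h : IsPoincareDensity Ω lam) {δ : ℝ}
    (hδ : 0 ≤ δ) : ¬ GromovHyperbolicWith Ω (densityDist Ω lam) δ := by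
  intro hG
  obtain ⟨N, hN⟩ := hC.exists_le_densityDist h (D := 2 * δ + 4) (by linarith)
  obtain ⟨m₀, hm₀⟩ := hC.eventually_ratio_le one_pos
  have hR := hC.pos m₀
  set L : ℂ → ℝ := fun z => Real.log (‖z - 0‖ ^ 2 + a m₀ ^ 2) / 2 with hL
  obtain ⟨m, hmN, hm⟩ := hC.exists_window_large N
    (L (a N) + 504000 + 14000 * (2 * δ + 3))
  obtain ⟨w, hw⟩ := nonempty_Ioo.2 (hC.lt m)
  have hB := hC.window_mem hw
  obtain ⟨s₀, hs₀, hnear⟩ := exists_almost_nearest h (w : ℂ)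
  have hA := hC.neg_mem hs₀
  have hTD := hN m hmN w hw s₀ hs₀
  set A : ℂ := ((-s₀ : ℝ) : ℂ) with hAdef
  obtain ⟨g, g', hgΩ, hg, hlam, hgeo⟩ := exists_unitSpeed_geodesic h hA hB
  set T := densityDist Ω lam A w with hT
  have hT0 : 0 ≤ T := densityDist_nonneg h _ _
  have hAim : A.im = 0 := ofReal_im _
  have hwim : (w : ℂ).im = 0 := ofReal_im _
  have hfar : ∀ k : ℝ → ℂ, IsGeodesicIn Ω (densityDist Ω lam) k A w → ∀ t ∈ Icc 0 T, ∀ s > 0,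
      t - 1 ≤ densityDist Ω lam ((-s : ℝ) : ℂ) (k t) := by
    rintro k ⟨hk0, hk1, hkΩ, hkd⟩ t ht s hs
    have h1 := hnear s hs
    have h2 := densityDist_triangle h (hC.neg_mem hs) (hkΩ t ht) hB
    have h3 := hkd t ht T (right_mem_Icc.2 hT0)
    rw [hk1, abs_of_nonpos (by linarith [ht.2])] at h3
    linarith
  have hLB : L w ≤ L A + 504000 := by
    have := hC.log_le_of_far h hm₀ hT0 hgΩ hg hlam (hfar g hgeo)
    rwa [hgeo.1, hgeo.2.1] at this
  have hLw : Real.log (a m) ≤ L w := by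
    have h1 : Real.log (a m ^ 2) ≤ Real.log (‖(w : ℂ) - 0‖ ^ 2 + a m₀ ^ 2) := by
      have := hC.pos m
      refine Real.log_le_log (by positivity) ?_
      rw [sub_zero, norm_real, Real.norm_eq_abs, sq_abs]
      nlinarith [hw.1, sq_nonneg (a m₀)]
    rw [Real.log_pow] at h1
    simp only [Nat.cast_ofNat] at h1
    simp only [hL]
    linarith
  have hf := isGeodesicIn_fold h hC.conj_mem hgeo hAim.ge hwim.ge
  have hfc := isGeodesicIn_conj h hC.conj_mem hf hAim hwim
  have hAA := densityDist_self h hA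
  have hconst : IsGeodesicIn Ω (densityDist Ω lam) (fun _ => A) A A := by
    refine ⟨rfl, rfl, fun _ _ => hA, fun s hs t ht => ?_⟩
    rw [hAA, Icc_self, mem_singleton_iff] at hs ht
    rw [hs, ht, hAA, sub_self, abs_zero]
  have ht₀ : δ + 3 ∈ Icc 0 T := ⟨by linarith, by linarith⟩
  have hz := hf.2.2.1 _ ht₀
  have hAz := hf.2.2.2 0 (left_mem_Icc.2 hT0) _ ht₀
  have hzfar := hfar _ hf _ ht₀
  rw [hf.1, abs_of_nonpos (by linarith)] at hAz
  obtain ⟨p, hp, hpd⟩ := hG A hA w hB A hA _ _ _ hf hconst hfc _ ht₀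
  simp only at hz hAz hzfar hpd
  set z := fold (g (δ + 3)) with hzdef
  rcases hp with ⟨_, -, rfl⟩ | ⟨t₁, ht₁, rfl⟩
  · rw [densityDist_comm h hz hA] at hpd
    linarith
  · obtain ⟨q, hqΩ, hq0, hq⟩ := exists_real_between h hz (hfc.2.2.1 t₁ ht₁) (abs_nonneg _)
      (by simp [fold])
    have hzq : densityDist Ω lam z q ≤ δ := by
      have := densityDist_nonneg h q (conj (fold (g t₁)))
      linarith
    have hAq : densityDist Ω lam A q ≤ 2 * δ + 3 := by
      have := densityDist_triangle h hA hz hqΩ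
      linarith
    have hqre : q = (q.re : ℂ) := Complex.ext rfl (by simpa using hq0)
    rcases (hC.ofReal_mem_iff q.re).1 (hqre ▸ hqΩ) with hneg | ⟨k, hk1, hk2⟩
    · have h1 := hzfar (-q.re) (by linarith)
      rw [neg_neg, ← hqre, densityDist_comm h hqΩ hz] at h1
      linarith
    · have hkN : k < N := by
        by_contra! hkN
        have := hN k hkN q.re ⟨hk1, hk2⟩ s₀ hs₀
        rw [← hqre] at this
        linarith
      have h1 := abs_log_sub_log_le h hR (fun x hx => hC.one_le_lam_mul_add h hm₀ hx) hA hqΩ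
      have h2 : L A - L q ≤ 14000 * (2 * δ + 3) := by
        have := (abs_le.1 h1).1
        simp only [hL]
        linarith
      have h3 : L q ≤ L (a N) := by
        have h4 : q.re ≤ a N := by
          linarith [hC.le k, hC.monotone (Nat.succ_le_of_lt hkN)]
        have h5 := (hC.pos k).trans hk1
        simp only [hL, sub_zero]
        rw [hqre, norm_real, norm_real, Real.norm_of_nonneg h5.le,
          Real.norm_of_nonneg (hC.pos N).le]
        gcongr
      linarith

end IsComb

end Main

end Denjoy

noncomputable section

/-- Theorem 1.1(2), Poincaré case: if `lim (bₙ - aₙ)/aₙ = 0` then `(Ω, h_Ω)` is not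
Gromov hyperbolic. -/
theorem denjoy_poincare_not_hyperbolic_of_lim_zero
    (Ω : Set ℂ) (a b : ℕ → ℝ)
    (hΩ : IsDenjoyDomain Ω)
    (hapos : ∀ n, 0 < a n)
    (hab : ∀ n, a n < b n)
    (hba : ∀ n, b n ≤ a (n + 1))
    (hlim : Filter.Tendsto a Filter.atTop Filter.atTop)
    (hre : (fun x : ℝ => (x : ℂ)) ⁻¹' Ω = Iio 0 ∪ ⋃ n, Ioo (a n) (b n))
    (hlim0 : Filter.Tendsto (fun n => (b n - a n) / a n) Filter.atTop (nhds 0))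
    (lam : ℂ → ℝ) (hlam : IsPoincareDensity Ω lam) :
    ¬ IsGromovHyperbolic Ω (densityDist Ω lam) := by
  rintro ⟨δ, hδ, hG⟩
  have hmem : ∀ x : ℝ, (x : ℂ) ∈ Ω ↔ x < 0 ∨ ∃ n, a n < x ∧ x < b n := by
    intro x
    have := Set.ext_iff.1 hre x
    simpa using this
  have hC : Denjoy.IsComb Ω a b :=
    { isOpen := hΩ.1
      mem_of_im_ne_zero := fun z hz =>
        Denjoy.IsDenjoyDomain.mem_of_im_ne_zero hΩ ((hmem (-1)).2 (Or.inl (by norm_num))) hz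
      ofReal_mem_iff := hmem
      pos := hapos
      lt := hab
      le := hba
      tendsto := hlim
      tendsto_ratio := hlim0 }
  exact hC.not_gromovHyperbolicWith hlam hδ hG

end
end
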